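/- Theorem 2: For all p₁, p₂ ∈ ℝ there exists ε₀ > 0 such that for every ε ∈ (0, ε₀), the total number of limit cycles of the perturbed autonomous system ẋ = y, ẏ = x − x³ + ε(p₁ + p₂x − x²)y in the plane does not exceed three, where a limit cycle is the image Γ of a nonconstant periodic solution such that some neighborhood of Γ contains no point of the image of any other nonconstant periodic solution. -/

import Mathlib

/-- (x, y) is a nonconstant periodic solution of
ẋ = y, ẏ = x − x³ + ε(p₁ + p₂x − x²)y. -/
def IsPeriodicOrbit (ε p₁ p₂ : ℝ) (x y : ℝ → ℝ) : Prop :=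
  (∀ t, HasDerivAt x (y t) t) ∧
  (∀ t, HasDerivAt y
    (x t - (x t) ^ 3 + ε * (p₁ + p₂ * x t - (x t) ^ 2) * y t) t) ∧
  (∃ T > (0:ℝ), ∀ t, x (t + T) = x t ∧ y (t + T) = y t) ∧
  (∃ t₁ t₂, (x t₁, y t₁) ≠ (x t₂, y t₂))

/-- Γ is a limit cycle of the perturbed system: the image of a nonconstant periodic
solution possessing a neighborhood containing no point of the image of any other
nonconstant periodic solution. -/
def IsLimitCycle (ε p₁ p₂ : ℝ) (Γ : Set (ℝ × ℝ)) : Prop :=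
  (∃ x y : ℝ → ℝ, IsPeriodicOrbit ε p₁ p₂ x y ∧
    Γ = Set.range fun t => (x t, y t)) ∧
  (∃ U : Set (ℝ × ℝ), IsOpen U ∧ Γ ⊆ U ∧
    ∀ x y : ℝ → ℝ, IsPeriodicOrbit ε p₁ p₂ x y →
      (Set.range fun t => (x t, y t)) ≠ Γ → ∀ t, (x t, y t) ∉ U)

namespace DuffingVanDerPol

open Set Filter Topology

/-- `(x, y)` solves `ẋ = y`, `ẏ = x - x³ + ε(a + bx - x²)y`. -/
structure Sol (ε a b : ℝ) (x y : ℝ → ℝ) : Prop where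
  hx : ∀ t, HasDerivAt x (y t) t
  hy : ∀ t, HasDerivAt y (x t - (x t) ^ 3 + ε * (a + b * x t - (x t) ^ 2) * y t) t

namespace Sol

variable {ε a b : ℝ} {x y : ℝ → ℝ}

lemma contX (h : Sol ε a b x y) : Continuous x :=
  continuous_iff_continuousAt.2 fun t => (h.hx t).continuousAt

lemma contY (h : Sol ε a b x y) : Continuous y :=
  continuous_iff_continuousAt.2 fun t => (h.hy t).continuousAt

lemma shift (h : Sol ε a b x y) (c : ℝ) :
    Sol ε a b (fun t => x (t + c)) (fun t => y (t + c)) :=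
  ⟨fun t => (h.hx (t + c)).comp_add_const t c, fun t => (h.hy (t + c)).comp_add_const t c⟩

lemma neg (h : Sol ε a b x y) : Sol ε a (-b) (fun t => -x t) (fun t => -y t) :=
  ⟨fun t => (h.hx t).neg, fun t => by
    have h1 := (h.hy t).neg
    have e : -x t - (-x t) ^ 3 + ε * (a + -b * -x t - (-x t) ^ 2) * -y t =
      -(x t - x t ^ 3 + ε * (a + b * x t - x t ^ 2) * y t) := by ring
    rw [e]
    exact h1⟩

lemma reverse (h : Sol ε a b x y) : Sol (-ε) a b (fun t => x (-t)) (fun t => -y (-t)) :=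
  ⟨fun t => by
    have h1 := (h.hx (-t)).scomp t (hasDerivAt_neg t)
    rw [neg_one_smul] at h1
    exact h1, fun t => by
    have h1 := ((h.hy (-t)).scomp t (hasDerivAt_neg t)).neg
    have e : x (-t) - x (-t) ^ 3 + -ε * (a + b * x (-t) - x (-t) ^ 2) * -y (-t) =
      -((-1 : ℝ) • (x (-t) - x (-t) ^ 3 + ε * (a + b * x (-t) - x (-t) ^ 2) * y (-t))) := by
      rw [smul_eq_mul]; ring
    rw [e]
    exact h1⟩

end Sol

/-- The vector field of the system. -/
def field (ε a b : ℝ) (z : ℝ × ℝ) : ℝ × ℝ :=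
  (z.2, z.1 - z.1 ^ 3 + ε * (a + b * z.1 - z.1 ^ 2) * z.2)

lemma Sol.hasDerivAt {ε a b : ℝ} {x y : ℝ → ℝ} (h : Sol ε a b x y) (t : ℝ) :
    HasDerivAt (fun t => (x t, y t)) (field ε a b (x t, y t)) t :=
  (h.hx t).prodMk (h.hy t)

lemma Sol.eq_of_eq_zero {ε a b : ℝ} {x₁ y₁ x₂ y₂ : ℝ → ℝ} (h₁ : Sol ε a b x₁ y₁)
    (h₂ : Sol ε a b x₂ y₂) (hx : x₁ 0 = x₂ 0) (hy : y₁ 0 = y₂ 0) (s : ℝ) :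
    x₁ s = x₂ s ∧ y₁ s = y₂ s := by
  set A : ℝ := |s| + 1
  have hA : 0 < A := by positivity
  have c₁ : Continuous fun t => (x₁ t, y₁ t) := h₁.contX.prodMk h₁.contY
  have c₂ : Continuous fun t => (x₂ t, y₂ t) := h₂.contX.prodMk h₂.contY
  have hK : IsCompact ((fun t => (x₁ t, y₁ t)) '' Icc (-A) A ∪ (fun t => (x₂ t, y₂ t)) '' Icc (-A) A) :=
    (isCompact_Icc.image c₁).union (isCompact_Icc.image c₂)
  obtain ⟨R, hR⟩ := hK.isBounded.subset_closedBall (0 : ℝ × ℝ)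
  have hC : ContDiffOn ℝ 1 (field ε a b) (Metric.closedBall 0 R) := by
    apply ContDiff.contDiffOn
    unfold field
    fun_prop
  obtain ⟨K, hLip⟩ := hC.exists_lipschitzOnWith one_ne_zero (convex_closedBall _ _)
    (isCompact_closedBall _ _)
  have := ODE_solution_unique_of_mem_Icc (v := fun _ => field ε a b)
    (s := fun _ => Metric.closedBall 0 R) (f := fun t => (x₁ t, y₁ t)) (g := fun t => (x₂ t, y₂ t))
    (a := -A) (b := A) (t₀ := 0) (fun _ _ => hLip) ⟨by linarith, hA⟩ c₁.continuousOn
    (fun t _ => h₁.hasDerivAt t)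
    (fun t ht => hR (Or.inl ⟨t, Ioo_subset_Icc_self ht, rfl⟩)) c₂.continuousOn
    (fun t _ => h₂.hasDerivAt t)
    (fun t ht => hR (Or.inr ⟨t, Ioo_subset_Icc_self ht, rfl⟩)) (by simp [hx, hy])
  have hs : s ∈ Icc (-A) A := ⟨by linarith [neg_abs_le s], by linarith [le_abs_self s]⟩
  have := this hs
  simpa using this

/-- Uniqueness of solutions of the autonomous system, up to a time shift. -/
lemma Sol.unique {ε a b : ℝ} {x₁ y₁ x₂ y₂ : ℝ → ℝ} (h₁ : Sol ε a b x₁ y₁)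
    (h₂ : Sol ε a b x₂ y₂) {t₁ t₂ : ℝ} (hx : x₁ t₁ = x₂ t₂) (hy : y₁ t₁ = y₂ t₂) (s : ℝ) :
    x₁ (t₁ + s) = x₂ (t₂ + s) ∧ y₁ (t₁ + s) = y₂ (t₂ + s) := by
  have := (h₁.shift t₁).eq_of_eq_zero (h₂.shift t₂) (by simpa using hx) (by simpa using hy) s
  simpa [add_comm] using this

/-- The inverse of an increasing differentiable function on an interval, extended by constants. -/
lemma exists_inverse {f f' : ℝ → ℝ} {P Q : ℝ} (hPQ : P < Q) (hf : ∀ t, HasDerivAt f (f' t) t)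
    (hpos : ∀ t ∈ Ioo P Q, 0 < f' t) :
    StrictMonoOn f (Icc P Q) ∧ ∃ g : ℝ → ℝ, Continuous g ∧ (∀ ξ, g ξ ∈ Icc P Q) ∧
      (∀ t ∈ Icc P Q, g (f t) = t) ∧ (∀ ξ ∈ Icc (f P) (f Q), f (g ξ) = ξ) ∧
      (∀ ξ ≤ f P, g ξ = P) ∧ (∀ ξ, f Q ≤ ξ → g ξ = Q) ∧
      ∀ ξ ∈ Ioo (f P) (f Q), g ξ ∈ Ioo P Q ∧ HasDerivAt g (f' (g ξ))⁻¹ ξ := by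
  have hfc : Continuous f := continuous_iff_continuousAt.2 fun t => (hf t).continuousAt
  have hmono : StrictMonoOn f (Icc P Q) := by
    apply strictMonoOn_of_deriv_pos (convex_Icc P Q) hfc.continuousOn
    intro t ht
    rw [interior_Icc] at ht
    rw [(hf t).deriv]
    exact hpos t ht
  refine ⟨hmono, ?_⟩
  have hP : P ∈ Icc P Q := left_mem_Icc.2 hPQ.le
  have hQ : Q ∈ Icc P Q := right_mem_Icc.2 hPQ.le
  have hlt : f P < f Q := hmono hP hQ hPQ
  have himg : f '' Icc P Q = Icc (f P) (f Q) := by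
    apply Subset.antisymm
    · rintro _ ⟨t, ht, rfl⟩
      exact ⟨hmono.monotoneOn hP ht ht.1, hmono.monotoneOn ht hQ ht.2⟩
    · exact intermediate_value_Icc hPQ.le hfc.continuousOn
  let e : Icc P Q ≃o Icc (f P) (f Q) :=
    (hmono.orderIso f (Icc P Q)).trans (OrderIso.setCongr _ _ himg)
  have he : ∀ t : Icc P Q, ((e t : Icc (f P) (f Q)) : ℝ) = f t := fun t => rfl
  let g : ℝ → ℝ := fun ξ => (e.symm (projIcc (f P) (f Q) hlt.le ξ) : ℝ)
  have gc : Continuous g :=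
    continuous_subtype_val.comp (e.symm.continuous.comp continuous_projIcc)
  have gmem : ∀ ξ, g ξ ∈ Icc P Q := fun ξ => (e.symm _).2
  have gright : ∀ ξ ∈ Icc (f P) (f Q), f (g ξ) = ξ := by
    intro ξ hξ
    have : f (g ξ) = (e (e.symm (projIcc (f P) (f Q) hlt.le ξ)) : ℝ) := rfl
    rw [this, e.apply_symm_apply, projIcc_of_mem hlt.le hξ]
  have gleft : ∀ t ∈ Icc P Q, g (f t) = t := by
    intro t ht
    apply hmono.injOn (gmem _) ht
    apply gright
    rw [← himg]
    exact ⟨t, ht, rfl⟩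
  have gP : ∀ ξ ≤ f P, g ξ = P := by
    intro ξ hξ
    have : g ξ = g (f P) := by simp only [g]; rw [projIcc_of_le_left _ hξ, projIcc_left]
    rw [this, gleft P hP]
  have gQ : ∀ ξ, f Q ≤ ξ → g ξ = Q := by
    intro ξ hξ
    have : g ξ = g (f Q) := by simp only [g]; rw [projIcc_of_right_le _ hξ, projIcc_right]
    rw [this, gleft Q hQ]
  refine ⟨g, gc, gmem, gleft, gright, gP, gQ, fun ξ hξ => ?_⟩
  have hin : g ξ ∈ Ioo P Q := by
    have h1 := gright ξ (Ioo_subset_Icc_self hξ)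
    refine ⟨lt_of_le_of_ne (gmem ξ).1 fun h => ?_, lt_of_le_of_ne (gmem ξ).2 fun h => ?_⟩
    · rw [← h] at h1; linarith [hξ.1]
    · rw [h] at h1; linarith [hξ.2]
  refine ⟨hin, (hf (g ξ)).of_local_left_inverse gc.continuousAt (hpos _ hin).ne' ?_⟩
  filter_upwards [Ioo_mem_nhds hξ.1 hξ.2] with z hz using gright z (Ioo_subset_Icc_self hz)

/-- An orbit arc in the upper half plane written as a graph over the `x`-axis, between two
consecutive zeros of `y`, and extended by zero. -/
structure Arc (ε a b : ℝ) (Y : ℝ → ℝ) (p q : ℝ) : Prop where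
  lt : p < q
  cont : Continuous Y
  zero_left : ∀ ξ ≤ p, Y ξ = 0
  zero_right : ∀ ξ, q ≤ ξ → Y ξ = 0
  pos : ∀ ξ ∈ Ioo p q, 0 < Y ξ
  deriv : ∀ ξ ∈ Ioo p q, HasDerivAt Y ((ξ - ξ ^ 3) / Y ξ + ε * (a + b * ξ - ξ ^ 2)) ξ

lemma Arc.nonneg {ε a b : ℝ} {Y : ℝ → ℝ} {p q : ℝ} (h : Arc ε a b Y p q) (ξ : ℝ) : 0 ≤ Y ξ := by
  rcases le_or_gt ξ p with h1 | h1
  · exact (h.zero_left ξ h1).ge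
  rcases le_or_gt q ξ with h2 | h2
  · exact (h.zero_right ξ h2).ge
  · exact (h.pos ξ ⟨h1, h2⟩).le

lemma Sol.exists_arc {ε a b : ℝ} {x y : ℝ → ℝ} (h : Sol ε a b x y) {P Q : ℝ} (hPQ : P < Q)
    (hP : y P = 0) (hQ : y Q = 0) (hpos : ∀ t ∈ Ioo P Q, 0 < y t) :
    StrictMonoOn x (Icc P Q) ∧ ∃ Y : ℝ → ℝ, Arc ε a b Y (x P) (x Q) ∧
      (∀ t ∈ Icc P Q, Y (x t) = y t) ∧
      ∀ ξ ∈ Icc (x P) (x Q), ∃ t ∈ Icc P Q, x t = ξ ∧ Y ξ = y t := by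
  obtain ⟨hm, g, gc, gmem, gl, gr, gP, gQ, gd⟩ := exists_inverse hPQ h.hx hpos
  refine ⟨hm, fun ξ => y (g ξ), ⟨?_, h.contY.comp gc, ?_, ?_, ?_, ?_⟩, ?_, ?_⟩
  · exact hm (left_mem_Icc.2 hPQ.le) (right_mem_Icc.2 hPQ.le) hPQ
  · intro ξ hξ; simp [gP ξ hξ, hP]
  · intro ξ hξ; simp [gQ ξ hξ, hQ]
  · intro ξ hξ; exact hpos _ (gd ξ hξ).1
  · intro ξ hξ
    obtain ⟨h1, h2⟩ := gd ξ hξ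
    have h3 := (h.hy (g ξ)).scomp ξ h2
    rw [gr ξ (Ioo_subset_Icc_self hξ)] at h3
    have h4 := (hpos _ h1).ne'
    have e : (ξ - ξ ^ 3) / y (g ξ) + ε * (a + b * ξ - ξ ^ 2) =
        (y (g ξ))⁻¹ • (ξ - ξ ^ 3 + ε * (a + b * ξ - ξ ^ 2) * y (g ξ)) := by
      rw [smul_eq_mul]
      field_simp
    rw [e]
    exact h3
  · intro t ht; simp [gl t ht]
  · intro ξ hξ
    exact ⟨g ξ, gmem ξ, gr ξ hξ, rfl⟩

section Zeros

variable {ε a b : ℝ} {x y : ℝ → ℝ}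

lemma Sol.next_pos (h : Sol ε a b x y) (hne : ∀ t, y t = 0 → x t - x t ^ 3 ≠ 0) {t₀ : ℝ}
    (h0 : y t₀ = 0) (hd : 0 < x t₀ - x t₀ ^ 3) (hex : ∃ t > t₀, y t = 0) :
    ∃ t₁ > t₀, y t₁ = 0 ∧ (∀ t ∈ Ioo t₀ t₁, 0 < y t) ∧ x t₁ - x t₁ ^ 3 < 0 := by
  have hder : HasDerivAt y (x t₀ - x t₀ ^ 3) t₀ := by
    have := h.hy t₀
    rwa [h0, mul_zero, add_zero] at this
  have hev : ∀ᶠ t in 𝓝[>] t₀, 0 < y t := by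
    have h1 := (hasDerivAt_iff_tendsto_slope_left_right.1 hder).2
    have h2 := h1.eventually (lt_mem_nhds hd)
    filter_upwards [h2, self_mem_nhdsWithin] with t ht ht'
    rw [slope_def_field, h0, sub_zero] at ht
    exact (div_pos_iff_of_pos_right (sub_pos.2 ht')).1 ht
  obtain ⟨u, hu, hu'⟩ := mem_nhdsGT_iff_exists_Ioc_subset.1 hev
  have hu0 : t₀ < u := hu
  set S := Ici u ∩ y ⁻¹' {0}
  have hSc : IsClosed S := isClosed_Ici.inter (isClosed_singleton.preimage h.contY)
  have hSn : S.Nonempty := by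
    obtain ⟨t, ht, ht'⟩ := hex
    refine ⟨t, ?_, ht'⟩
    by_contra hlt
    have h3 : 0 < y t := hu' ⟨ht, (not_le.1 hlt).le⟩
    linarith
  have hSb : BddBelow S := ⟨u, fun t ht => ht.1⟩
  have hmem := hSc.csInf_mem hSn hSb
  set t₁ := sInf S
  have hyu : 0 < y u := hu' ⟨hu0, le_rfl⟩
  have ht₁ : t₀ < t₁ := lt_of_lt_of_le hu0 hmem.1
  have hy1 : y t₁ = 0 := hmem.2
  have hpos : ∀ t ∈ Ioo t₀ t₁, 0 < y t := by
    intro t ht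
    rcases le_or_gt t u with h1 | h1
    · exact hu' ⟨ht.1, h1⟩
    by_contra hneg
    obtain ⟨s, hs, hs'⟩ := intermediate_value_Icc' h1.le h.contY.continuousOn
      ⟨not_lt.1 hneg, hyu.le⟩
    have : t₁ ≤ s := csInf_le hSb ⟨hs.1, hs'⟩
    linarith [hs.2, ht.2]
  refine ⟨t₁, ht₁, hy1, hpos, ?_⟩
  have hder1 : HasDerivAt y (x t₁ - x t₁ ^ 3) t₁ := by
    have := h.hy t₁
    rwa [hy1, mul_zero, add_zero] at this
  refine lt_of_le_of_ne ?_ (hne t₁ hy1)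
  have h1 := (hasDerivAt_iff_tendsto_slope_left_right.1 hder1).1
  refine le_of_tendsto h1 ?_
  filter_upwards [Ioo_mem_nhdsLT ht₁] with t ht
  rw [slope_def_field, hy1, sub_zero]
  exact (div_neg_of_pos_of_neg (hpos t ht) (sub_neg.2 ht.2)).le

lemma Sol.next_neg (h : Sol ε a b x y) (hne : ∀ t, y t = 0 → x t - x t ^ 3 ≠ 0) {t₀ : ℝ}
    (h0 : y t₀ = 0) (hd : x t₀ - x t₀ ^ 3 < 0) (hex : ∃ t > t₀, y t = 0) :
    ∃ t₁ > t₀, y t₁ = 0 ∧ (∀ t ∈ Ioo t₀ t₁, y t < 0) ∧ 0 < x t₁ - x t₁ ^ 3 := by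
  obtain ⟨t₁, h1, h2, h3, h4⟩ := h.neg.next_pos (t₀ := t₀)
    (fun t ht hh => hne t (by simpa using ht) (by linear_combination -hh)) (by simpa using h0)
    (by nlinarith) (by simpa using hex)
  refine ⟨t₁, h1, by simpa using h2, fun t ht => by simpa using h3 t ht, by nlinarith⟩

lemma Sol.prev_neg (h : Sol ε a b x y) (hne : ∀ t, y t = 0 → x t - x t ^ 3 ≠ 0) {t₀ : ℝ}
    (h0 : y t₀ = 0) (hd : 0 < x t₀ - x t₀ ^ 3) (hex : ∃ t < t₀, y t = 0) :
    ∃ t₁ < t₀, y t₁ = 0 ∧ (∀ t ∈ Ioo t₁ t₀, y t < 0) ∧ x t₁ - x t₁ ^ 3 < 0 := by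
  obtain ⟨s, hs, hs'⟩ := hex
  obtain ⟨t₁, h1, h2, h3, h4⟩ := h.reverse.next_pos (t₀ := -t₀)
    (fun t ht hh => hne (-t) (by simpa using ht) hh) (by simpa using h0)
    (by simpa using hd) ⟨-s, by simpa using hs, by simpa using hs'⟩
  refine ⟨-t₁, by linarith, by simpa using h2, fun t ht => ?_, h4⟩
  have := h3 (-t) ⟨by linarith [ht.2], by linarith [ht.1]⟩
  simpa using this

lemma Sol.prev_pos (h : Sol ε a b x y) (hne : ∀ t, y t = 0 → x t - x t ^ 3 ≠ 0) {t₀ : ℝ}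
    (h0 : y t₀ = 0) (hd : x t₀ - x t₀ ^ 3 < 0) (hex : ∃ t < t₀, y t = 0) :
    ∃ t₁ < t₀, y t₁ = 0 ∧ (∀ t ∈ Ioo t₁ t₀, 0 < y t) ∧ 0 < x t₁ - x t₁ ^ 3 := by
  obtain ⟨t₁, h1, h2, h3, h4⟩ := h.neg.prev_neg (t₀ := t₀)
    (fun t ht hh => hne t (by simpa using ht) (by linear_combination -hh)) (by simpa using h0)
    (by nlinarith) (by simpa using hex)
  refine ⟨t₁, h1, by simpa using h2, fun t ht => by simpa using h3 t ht, by nlinarith⟩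

end Zeros

/-- Two upper arcs of orbits do not cross. -/
lemma Sol.compare {ε a b : ℝ} {x₁ y₁ x₂ y₂ : ℝ → ℝ} (h₁ : Sol ε a b x₁ y₁)
    (h₂ : Sol ε a b x₂ y₂) {P₁ Q₁ P₂ Q₂ : ℝ} (l₁ : P₁ < Q₁) (l₂ : P₂ < Q₂)
    (hP₁ : y₁ P₁ = 0) (hQ₁ : y₁ Q₁ = 0) (hP₂ : y₂ P₂ = 0) (hQ₂ : y₂ Q₂ = 0)
    (pos₁ : ∀ t ∈ Ioo P₁ Q₁, 0 < y₁ t) (pos₂ : ∀ t ∈ Ioo P₂ Q₂, 0 < y₂ t)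
    (hl : x₁ P₁ < x₂ P₂) (hr : x₂ P₂ < x₁ Q₁) : x₂ Q₂ < x₁ Q₁ := by
  by_contra hle
  rw [not_lt] at hle
  obtain ⟨-, Y₁, A₁, -, e₁⟩ := h₁.exists_arc l₁ hP₁ hQ₁ pos₁
  obtain ⟨-, Y₂, A₂, -, e₂⟩ := h₂.exists_arc l₂ hP₂ hQ₂ pos₂
  have c : Continuous fun ξ => Y₁ ξ - Y₂ ξ := A₁.cont.sub A₂.cont
  have left : 0 < Y₁ (x₂ P₂) - Y₂ (x₂ P₂) := by
    rw [A₂.zero_left _ le_rfl, sub_zero]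
    exact A₁.pos _ ⟨hl, hr⟩
  have right : Y₁ (x₁ Q₁) - Y₂ (x₁ Q₁) ≤ 0 := by
    rw [A₁.zero_right _ le_rfl]
    linarith [A₂.nonneg (x₁ Q₁)]
  obtain ⟨ξ, hξ, hξ0⟩ := intermediate_value_Icc' hr.le c.continuousOn ⟨right, left.le⟩
  have hξ1 : x₂ P₂ < ξ := by
    refine lt_of_le_of_ne hξ.1 fun h => ?_
    rw [← h] at hξ0
    simp only at hξ0
    linarith
  obtain ⟨τ₁, m₁, hx₁, hY₁⟩ := e₁ ξ ⟨by linarith, hξ.2⟩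
  obtain ⟨τ₂, m₂, hx₂, hY₂⟩ := e₂ ξ ⟨hξ1.le, by linarith [hξ.2]⟩
  have hτ₁ : P₁ < τ₁ := by
    refine lt_of_le_of_ne m₁.1 fun h => ?_
    rw [← h] at hx₁
    linarith
  have hτ₂ : P₂ < τ₂ := by
    refine lt_of_le_of_ne m₂.1 fun h => ?_
    rw [← h] at hx₂
    linarith
  have hu := fun s => h₁.unique h₂ (t₁ := τ₁) (t₂ := τ₂) (by rw [hx₁, hx₂])
    (by simp only at hξ0; linarith) s
  rcases lt_trichotomy (τ₁ - P₁) (τ₂ - P₂) with h | h | h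
  · have h3 := (hu (P₁ - τ₁)).2
    rw [add_sub_cancel, hP₁] at h3
    have := pos₂ (τ₂ + (P₁ - τ₁)) ⟨by linarith, by linarith [m₂.2]⟩
    linarith
  · have h3 := (hu (P₁ - τ₁)).1
    rw [add_sub_cancel, show τ₂ + (P₁ - τ₁) = P₂ by linarith] at h3
    linarith
  · have h3 := (hu (P₂ - τ₂)).2
    rw [add_sub_cancel, hP₂] at h3
    have := pos₁ (τ₁ + (P₂ - τ₂)) ⟨by linarith, by linarith [m₁.2]⟩
    linarith

/-- A closed orbit consisting of exactly one upper and one lower arc, with time normalised. -/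
structure Loop (ε a b : ℝ) (x y : ℝ → ℝ) (τ T : ℝ) : Prop where
  sol : Sol ε a b x y
  τ_pos : 0 < τ
  τ_lt : τ < T
  perX : Function.Periodic x T
  perY : Function.Periodic y T
  y_zero : y 0 = 0
  y_τ : y τ = 0
  pos : ∀ t ∈ Ioo 0 τ, 0 < y t
  neg : ∀ t ∈ Ioo τ T, y t < 0
  left : 0 < x 0 - x 0 ^ 3
  right : x τ - x τ ^ 3 < 0

lemma Sol.equilibrium_ne {ε a b : ℝ} {x y : ℝ → ℝ} (h : Sol ε a b x y)
    (hn : ∃ t₁ t₂, (x t₁, y t₁) ≠ (x t₂, y t₂)) (t : ℝ) (ht : y t = 0) : x t - x t ^ 3 ≠ 0 := by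
  intro h0
  have hc : Sol ε a b (fun _ => x t) (fun _ => 0) :=
    ⟨fun s => hasDerivAt_const s (x t), fun s => by
      rw [mul_zero, add_zero, h0]
      exact hasDerivAt_const s 0⟩
  have hall : ∀ s, x s = x t ∧ y s = 0 := by
    intro s
    have := h.unique hc (t₁ := t) (t₂ := t) rfl ht (s - t)
    simpa using this
  obtain ⟨t₁, t₂, h12⟩ := hn
  apply h12
  rw [(hall t₁).1, (hall t₁).2, (hall t₂).1, (hall t₂).2]

/-- Every nonconstant periodic orbit is a loop. -/
theorem exists_loop {ε a b : ℝ} {x y : ℝ → ℝ} (h : IsPeriodicOrbit ε a b x y) :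
    ∃ x' y' τ T, Loop ε a b x' y' τ T ∧
      (range fun t => (x' t, y' t)) = range fun t => (x t, y t) := by
  obtain ⟨hx, hy, ⟨T, hT, hper⟩, hn⟩ := h
  have hs : Sol ε a b x y := ⟨hx, hy⟩
  have perX : Function.Periodic x T := fun t => (hper t).1
  have perY : Function.Periodic y T := fun t => (hper t).2
  have hne := hs.equilibrium_ne hn
  have fwd : ∀ t, y t = 0 → ∃ s > t, y s = 0 := fun t ht =>
    ⟨t + T, by linarith, by rw [perY t, ht]⟩
  have bwd : ∀ t, y t = 0 → ∃ s < t, y s = 0 := fun t ht =>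
    ⟨t - T, by linarith, by rw [perY.sub_eq t, ht]⟩
  set S := Icc 0 T ∩ {t | y t = 0 ∧ 0 ≤ x t - x t ^ 3}
  have hSc : IsCompact S := by
    apply isCompact_Icc.inter_right
    exact (isClosed_eq hs.contY continuous_const).inter
      (isClosed_le continuous_const (hs.contX.sub (hs.contX.pow 3)))
  have hmod : ∀ t, y t = 0 → 0 ≤ x t - x t ^ 3 → ∃ s ∈ S, x s = x t := by
    intro t h1 h2
    obtain ⟨s, hs1, hs2⟩ :=
      (show Function.Periodic (fun t => (x t, y t)) T from fun t => by
        simp [perX t, perY t]).exists_mem_Ico₀ hT t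
    rw [Prod.mk.injEq] at hs2
    exact ⟨s, ⟨Ico_subset_Icc_self hs1, by rw [← hs2.2, h1], by rw [← hs2.1]; exact h2⟩, hs2.1.symm⟩
  have hSn : S.Nonempty := by
    obtain ⟨c, -, hc⟩ := exists_hasDerivAt_eq_zero (f := x) (f' := y) hT hs.contX.continuousOn
      (by rw [← perX 0, zero_add]) (fun t _ => hx t)
    rcases lt_or_gt_of_ne (hne c hc) with h1 | h1
    · obtain ⟨t, -, h2, -, h3⟩ := hs.next_neg hne hc h1 (fwd c hc)
      obtain ⟨s, hs1, -⟩ := hmod t h2 h3.le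
      exact ⟨s, hs1⟩
    · obtain ⟨s, hs1, -⟩ := hmod c hc h1.le
      exact ⟨s, hs1⟩
  obtain ⟨t₀, ht₀, hmax⟩ := hSc.exists_isMaxOn hSn hs.contX.continuousOn
  have hmax' : ∀ t, y t = 0 → 0 ≤ x t - x t ^ 3 → x t ≤ x t₀ := by
    intro t h1 h2
    obtain ⟨s, hs1, hs2⟩ := hmod t h1 h2
    rw [← hs2]
    exact hmax hs1
  have y0 : y t₀ = 0 := ht₀.2.1
  have d0 : 0 < x t₀ - x t₀ ^ 3 := lt_of_le_of_ne ht₀.2.2 (hne t₀ y0).symm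
  obtain ⟨s₁, ls₁, ys₁, ns₁, ds₁⟩ := hs.prev_neg hne y0 d0 (bwd _ y0)
  obtain ⟨s₂, ls₂, ys₂, ns₂, ds₂⟩ := hs.prev_pos hne ys₁ ds₁ (bwd _ ys₁)
  obtain ⟨t₁, lt₁, yt₁, nt₁, dt₁⟩ := hs.next_pos hne y0 d0 (fwd _ y0)
  obtain ⟨t₂, lt₂, yt₂, nt₂, dt₂⟩ := hs.next_neg hne yt₁ dt₁ (fwd _ yt₁)
  have lower : ∀ {P Q : ℝ}, P < Q → (∀ t ∈ Ioo P Q, y t < 0) → y P = 0 → y Q = 0 → x Q < x P := by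
    intro P Q hPQ hneg hP hQ
    have := (hs.neg.exists_arc hPQ (by simpa using hP) (by simpa using hQ)
      (fun t ht => by simpa using hneg t ht)).1 (left_mem_Icc.2 hPQ.le) (right_mem_Icc.2 hPQ.le) hPQ
    simpa using this
  have hclose : x s₂ = x t₀ := by
    refine le_antisymm (hmax' s₂ ys₂ ds₂.le) ?_
    by_contra hlt
    rw [not_le] at hlt
    have h1 : x t₁ < x s₁ := hs.compare hs ls₂ lt₁ ys₂ ys₁ y0 yt₁ ns₂ nt₁ hlt
      (lower ls₁ ns₁ ys₁ y0)
    have h2 : x t₀ < x t₁ := (hs.exists_arc lt₁ y0 yt₁ nt₁).1 (left_mem_Icc.2 lt₁.le)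
      (right_mem_Icc.2 lt₁.le) lt₁
    have h3 := hs.neg.compare hs.neg (P₁ := s₁) (Q₁ := t₀) (P₂ := t₁) (Q₂ := t₂) ls₁ lt₂
      (by simpa using ys₁) (by simpa using y0) (by simpa using yt₁) (by simpa using yt₂)
      (fun t ht => by simpa using ns₁ t ht) (fun t ht => by simpa using nt₂ t ht)
      (by simpa using h1) (by simpa using h2)
    have := hmax' t₂ yt₂ dt₂.le
    linarith
  have hp : ∀ t, x (t + (t₀ - s₂)) = x t ∧ y (t + (t₀ - s₂)) = y t := by
    intro t
    have h1 := hs.unique hs (t₁ := t₀) (t₂ := s₂) hclose.symm (by rw [y0, ys₂]) (t - s₂)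
    rw [show t₀ + (t - s₂) = t + (t₀ - s₂) by ring, show s₂ + (t - s₂) = t by ring] at h1
    exact h1
  refine ⟨fun t => x (t + s₂), fun t => y (t + s₂), s₁ - s₂, t₀ - s₂, ⟨hs.shift s₂, by linarith,
    by linarith, fun t => ?_, fun t => ?_, by simpa using ys₂, by simpa using ys₁, fun t ht => ?_,
    fun t ht => ?_, by simpa using ds₂, by simpa using ds₁⟩, ?_⟩
  · have := (hp (t + s₂)).1
    rw [← this]; congr 1; ring
  · have := (hp (t + s₂)).2
    rw [← this]; congr 1; ring
  · exact ns₂ _ ⟨by linarith [ht.1], by linarith [ht.2]⟩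
  · exact ns₁ _ ⟨by linarith [ht.1], by linarith [ht.2]⟩
  · ext z
    constructor
    · rintro ⟨t, rfl⟩; exact ⟨t + s₂, rfl⟩
    · rintro ⟨t, rfl⟩; exact ⟨t - s₂, by simp⟩

/-- A nonconstant closed orbit, with its time parametrisation and its two graphs. -/
structure Cycle (ε a b : ℝ) where
  x : ℝ → ℝ
  y : ℝ → ℝ
  τ : ℝ
  T : ℝ
  loop : Loop ε a b x y τ T
  α : ℝ
  β : ℝ
  α_eq : x 0 = α
  β_eq : x τ = β
  Y : ℝ → ℝ
  Z : ℝ → ℝ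
  up : Arc ε a b Y α β
  lo : Arc (-ε) a b Z α β
  eqY : ∀ t ∈ Icc 0 τ, Y (x t) = y t
  eqZ : ∀ t ∈ Icc τ T, Z (x t) = -y t
  memIcc : ∀ t, x t ∈ Icc α β
  exY : ∀ ξ ∈ Icc α β, ∃ t, x t = ξ ∧ y t = Y ξ
  exZ : ∀ ξ ∈ Icc α β, ∃ t, x t = ξ ∧ y t = -Z ξ

namespace Cycle

variable {ε a b : ℝ}

/-- The image of a closed orbit. -/
def set (C : Cycle ε a b) : Set (ℝ × ℝ) := range fun t => (C.x t, C.y t)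

lemma left (C : Cycle ε a b) : 0 < C.α - C.α ^ 3 := by rw [← C.α_eq]; exact C.loop.left

lemma right (C : Cycle ε a b) : C.β - C.β ^ 3 < 0 := by rw [← C.β_eq]; exact C.loop.right

lemma lt (C : Cycle ε a b) : C.α < C.β := C.up.lt

end Cycle

theorem exists_cycle {ε a b : ℝ} {x y : ℝ → ℝ} (h : IsPeriodicOrbit ε a b x y) :
    ∃ C : Cycle ε a b, C.set = range fun t => (x t, y t) := by
  obtain ⟨x', y', τ, T, L, hr⟩ := exists_loop h
  obtain ⟨m1, Y, A, hY1, hY2⟩ := L.sol.exists_arc L.τ_pos L.y_zero L.y_τ L.pos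
  have hyT : y' T = 0 := by
    have := L.perY 0
    rwa [zero_add, L.y_zero] at this
  have hxT : x' T = x' 0 := by
    have := L.perX 0
    rwa [zero_add] at this
  have e : x' (- -T) = x' 0 := by rw [neg_neg, hxT]
  have e' : x' (- -τ) = x' τ := by rw [neg_neg]
  obtain ⟨m2, Z, B, hZ1, hZ2⟩ := L.sol.reverse.exists_arc (P := -T) (Q := -τ)
    (by linarith [L.τ_lt]) (by simpa using hyT) (by simpa using L.y_τ)
    (fun t ht => by simpa using L.neg (-t) ⟨by linarith [ht.2], by linarith [ht.1]⟩)
  simp only [e, e'] at B hZ2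
  refine ⟨⟨x', y', τ, T, L, x' 0, x' τ, rfl, rfl, Y, Z, A, B, hY1, ?_, ?_, ?_, ?_⟩, hr⟩
  · intro t ht
    have := hZ1 (-t) ⟨by linarith [ht.2], by linarith [ht.1]⟩
    simpa using this
  · intro t
    obtain ⟨s, hs1, hs2⟩ := L.perX.exists_mem_Ico₀ (L.τ_pos.trans L.τ_lt) t
    rw [hs2]
    rcases le_total s τ with h1 | h1
    · exact ⟨m1.monotoneOn (left_mem_Icc.2 L.τ_pos.le) ⟨hs1.1, h1⟩ hs1.1,
        m1.monotoneOn ⟨hs1.1, h1⟩ (right_mem_Icc.2 L.τ_pos.le) h1⟩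
    · have hm : -s ∈ Icc (-T) (-τ) := ⟨by linarith [hs1.2], by linarith⟩
      have hl : -T ≤ -τ := by linarith [L.τ_lt]
      have h2 := m2.monotoneOn (left_mem_Icc.2 hl) hm hm.1
      have h3 := m2.monotoneOn hm (right_mem_Icc.2 hl) hm.2
      simp only [neg_neg, hxT] at h2 h3
      exact ⟨h2, h3⟩
  · intro ξ hξ
    obtain ⟨t, -, h1, h2⟩ := hY2 ξ hξ
    exact ⟨t, h1, h2.symm⟩
  · intro ξ hξ
    obtain ⟨t, -, h1, h2⟩ := hZ2 ξ hξ
    exact ⟨-t, h1, by rw [h2, neg_neg]⟩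

namespace Cycle

variable {ε a b : ℝ}

lemma set_eq_of_mem {C₁ C₂ : Cycle ε a b} {p : ℝ × ℝ} (h₁ : p ∈ C₁.set) (h₂ : p ∈ C₂.set) :
    C₁.set = C₂.set := by
  obtain ⟨t₁, rfl⟩ := h₁
  obtain ⟨t₂, h⟩ := h₂
  simp only [Prod.mk.injEq] at h
  have hu := C₁.loop.sol.unique C₂.loop.sol h.1.symm h.2.symm
  ext z
  constructor
  · rintro ⟨t, rfl⟩
    refine ⟨t₂ + (t - t₁), ?_⟩
    have := hu (t - t₁)
    rw [add_sub_cancel] at this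
    simp [this]
  · rintro ⟨t, rfl⟩
    refine ⟨t₁ + (t - t₂), ?_⟩
    have := hu (t - t₂)
    rw [add_sub_cancel t₂] at this
    simp [this]

lemma Y_ne {C₁ C₂ : Cycle ε a b} (h : C₁.set ≠ C₂.set) {ξ : ℝ} (h₁ : ξ ∈ Icc C₁.α C₁.β)
    (h₂ : ξ ∈ Icc C₂.α C₂.β) : C₁.Y ξ ≠ C₂.Y ξ := by
  intro heq
  obtain ⟨t₁, e₁, e₁'⟩ := C₁.exY ξ h₁
  obtain ⟨t₂, e₂, e₂'⟩ := C₂.exY ξ h₂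
  exact h (set_eq_of_mem ⟨t₁, rfl⟩ ⟨t₂, by simp [e₁, e₁', e₂, e₂', heq]⟩)

lemma Z_ne {C₁ C₂ : Cycle ε a b} (h : C₁.set ≠ C₂.set) {ξ : ℝ} (h₁ : ξ ∈ Icc C₁.α C₁.β)
    (h₂ : ξ ∈ Icc C₂.α C₂.β) : C₁.Z ξ ≠ C₂.Z ξ := by
  intro heq
  obtain ⟨t₁, e₁, e₁'⟩ := C₁.exZ ξ h₁
  obtain ⟨t₂, e₂, e₂'⟩ := C₂.exZ ξ h₂
  exact h (set_eq_of_mem ⟨t₁, rfl⟩ ⟨t₂, by simp [e₁, e₁', e₂, e₂', heq]⟩)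

end Cycle

lemma lt_of_continuous_ne {f g : ℝ → ℝ} (hf : Continuous f) (hg : Continuous g) {l r ξ₀ : ℝ}
    (h0 : ξ₀ ∈ Icc l r) (hlt : f ξ₀ < g ξ₀) (hne : ∀ ξ ∈ Icc l r, f ξ ≠ g ξ) :
    ∀ ξ ∈ Icc l r, f ξ < g ξ := by
  intro ξ hξ
  by_contra hle
  rw [not_lt] at hle
  obtain ⟨z, hz, hz'⟩ := isPreconnected_Icc.intermediate_value₂ h0 hξ hf.continuousOn
    hg.continuousOn hlt.le hle
  exact hne z hz hz'

/-- `C₁` lies inside `C₂`. -/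
structure Nested {ε a b : ℝ} (C₁ C₂ : Cycle ε a b) : Prop where
  left : C₂.α < C₁.α
  right : C₁.β < C₂.β
  Y_lt : ∀ ξ ∈ Icc C₁.α C₁.β, C₁.Y ξ < C₂.Y ξ
  Z_lt : ∀ ξ ∈ Icc C₁.α C₁.β, C₁.Z ξ < C₂.Z ξ

lemma Cycle.nested {ε a b : ℝ} {C₁ C₂ : Cycle ε a b} (h : C₁.set ≠ C₂.set) {ξ₀ : ℝ}
    (h₁ : ξ₀ ∈ Icc C₁.α C₁.β) (h₂ : ξ₀ ∈ Icc C₂.α C₂.β) (hlt : C₁.Y ξ₀ < C₂.Y ξ₀) :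
    Nested C₁ C₂ := by
  have key := lt_of_continuous_ne C₁.up.cont C₂.up.cont (l := max C₁.α C₂.α)
    (r := min C₁.β C₂.β) ⟨max_le h₁.1 h₂.1, le_min h₁.2 h₂.2⟩ hlt
    (fun ξ hξ => Cycle.Y_ne h ⟨(le_max_left _ _).trans hξ.1, hξ.2.trans (min_le_left _ _)⟩
      ⟨(le_max_right _ _).trans hξ.1, hξ.2.trans (min_le_right _ _)⟩)
  have hl : C₂.α < C₁.α := by
    by_contra hle
    rw [not_lt] at hle
    have := key C₂.α ⟨by rw [max_eq_right hle], le_min (h₂.1.trans h₁.2) C₂.lt.le⟩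
    rw [C₂.up.zero_left _ le_rfl] at this
    linarith [C₁.up.nonneg C₂.α]
  have hr : C₁.β < C₂.β := by
    by_contra hle
    rw [not_lt] at hle
    have := key C₂.β ⟨max_le (h₁.1.trans h₂.2) C₂.lt.le, by rw [min_eq_right hle]⟩
    rw [C₂.up.zero_right _ le_rfl] at this
    linarith [C₁.up.nonneg C₂.β]
  rw [max_eq_left hl.le, min_eq_left hr.le] at key
  refine ⟨hl, hr, key, lt_of_continuous_ne C₁.lo.cont C₂.lo.cont (left_mem_Icc.2 C₁.lt.le) ?_ ?_⟩
  · rw [C₁.lo.zero_left _ le_rfl]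
    exact C₂.lo.pos _ ⟨hl, C₁.lt.trans hr⟩
  · exact fun ξ hξ => Cycle.Z_ne h hξ ⟨hl.le.trans hξ.1, hξ.2.trans hr.le⟩

lemma Cycle.nested_or {ε a b : ℝ} {C₁ C₂ : Cycle ε a b} (h : C₁.set ≠ C₂.set) {ξ₀ : ℝ}
    (h₁ : ξ₀ ∈ Icc C₁.α C₁.β) (h₂ : ξ₀ ∈ Icc C₂.α C₂.β) : Nested C₁ C₂ ∨ Nested C₂ C₁ := by
  rcases lt_or_gt_of_ne (Cycle.Y_ne h h₁ h₂) with h3 | h3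
  · exact Or.inl (Cycle.nested h h₁ h₂ h3)
  · exact Or.inr (Cycle.nested h.symm h₂ h₁ h3)

lemma lt_of_deriv_pos_off_finset (S : Finset ℝ) {D D' : ℝ → ℝ} (hD : Continuous D) {l r : ℝ}
    (hlr : l < r) (hd : ∀ ξ ∈ Ioo l r, ξ ∉ S → HasDerivAt D (D' ξ) ξ ∧ 0 < D' ξ) :
    D l < D r := by
  induction S using Finset.induction_on generalizing l r with
  | empty =>
    have : StrictMonoOn D (Icc l r) := by
      apply strictMonoOn_of_deriv_pos (convex_Icc l r) hD.continuousOn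
      intro t ht
      rw [interior_Icc] at ht
      have := hd t ht (by simp)
      rw [this.1.deriv]
      exact this.2
    exact this (left_mem_Icc.2 hlr.le) (right_mem_Icc.2 hlr.le) hlr
  | insert s S hs ih =>
    by_cases hm : s ∈ Ioo l r
    · refine (ih hm.1 fun ξ hξ hξS => ?_).trans (ih hm.2 fun ξ hξ hξS => ?_)
      · exact hd ξ ⟨hξ.1, hξ.2.trans hm.2⟩ (by simp [hξ.2.ne, hξS])
      · exact hd ξ ⟨hm.1.trans hξ.1, hξ.2⟩ (by simp [hξ.1.ne', hξS])
    · refine ih hlr fun ξ hξ hξS => hd ξ hξ ?_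
      have : ξ ≠ s := fun h => hm (h ▸ hξ)
      simp [this, hξS]

/-- The derivative of `y²/2 + ε s y³/3` along the flow, as a function on the phase plane. -/
noncomputable def dulac (ε g v s s' y : ℝ) : ℝ := ε * s' * y ^ 3 / 3 + (1 + ε * y * s) * (g + ε * v * y)

lemma dulac_lt {ε g v s s' y₁ y₂ : ℝ} (hε : 0 < ε) (h : y₁ < y₂)
    (hpos : ∀ y ∈ Ioo y₁ y₂, 0 < v + y ^ 2 * s' + g * s + 2 * ε * y * s * v) :
    dulac ε g v s s' y₁ < dulac ε g v s s' y₂ := by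
  have hd : ∀ y, HasDerivAt (dulac ε g v s s')
      (ε * (v + y ^ 2 * s' + g * s + 2 * ε * y * s * v)) y := by
    intro y
    have h1 := (((hasDerivAt_id y).pow 3).const_mul (ε * s')).div_const 3
    have h2 := ((((hasDerivAt_id y).const_mul ε).mul_const s).const_add 1).mul
      (((hasDerivAt_id y).const_mul (ε * v)).const_add g)
    exact (h1.add h2).congr_deriv (by simp; ring)
  have := strictMonoOn_of_deriv_pos (convex_Icc y₁ y₂)
    (fun y _ => (hd y).continuousAt.continuousWithinAt) (by
      intro y hy
      rw [interior_Icc] at hy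
      rw [(hd y).deriv]
      exact mul_pos hε (hpos y hy))
  exact this (left_mem_Icc.2 h.le) (right_mem_Icc.2 h.le) h

lemma Arc.hasDerivAt_dulac {ε a b : ℝ} {Y : ℝ → ℝ} {p q : ℝ} (h : Arc ε a b Y p q) {s : ℝ → ℝ}
    {s' ξ : ℝ} (hs : HasDerivAt s s' ξ) (hξ : ξ ∈ Ioo p q) :
    HasDerivAt (fun ξ => Y ξ ^ 2 / 2 + ε * s ξ * Y ξ ^ 3 / 3)
      (dulac ε (ξ - ξ ^ 3) (a + b * ξ - ξ ^ 2) (s ξ) s' (Y ξ)) ξ := by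
  have hY := h.deriv ξ hξ
  have hp := (h.pos ξ hξ).ne'
  have h1 := ((hY.pow 2).div_const 2).add ((((hs.const_mul ε).mul (hY.pow 3))).div_const 3)
  refine h1.congr_deriv ?_
  unfold dulac
  simp
  field_simp
  ring

lemma Arc.eventually_zero {ε a b : ℝ} {Y : ℝ → ℝ} {p q : ℝ} (h : Arc ε a b Y p q) {ξ : ℝ}
    (hp : ξ ≠ p) (hq : ξ ≠ q) (hξ : ξ ∉ Ioo p q) : ∀ᶠ z in 𝓝 ξ, Y z = 0 := by
  rcases lt_or_gt_of_ne hp with h1 | h1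
  · filter_upwards [Iio_mem_nhds h1] with z hz using h.zero_left z hz.le
  rcases lt_or_gt_of_ne hq with h2 | h2
  · exact absurd ⟨h1, h2⟩ hξ
  · filter_upwards [Ioi_mem_nhds h2] with z hz using h.zero_right z hz.le

namespace Cycle

variable {ε a b : ℝ}

/-- The jump of `y²/2 + ε s y³/3` between the lower and the upper graph. -/
noncomputable def gap (C : Cycle ε a b) (s : ℝ → ℝ) (ξ : ℝ) : ℝ :=
  (C.Y ξ ^ 2 / 2 + ε * s ξ * C.Y ξ ^ 3 / 3) - (C.Z ξ ^ 2 / 2 + -ε * s ξ * C.Z ξ ^ 3 / 3)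

lemma gap_continuous (C : Cycle ε a b) {s : ℝ → ℝ} (hs : Continuous s) :
    Continuous (C.gap s) := by
  have := C.up.cont
  have := C.lo.cont
  unfold gap
  fun_prop

lemma gap_eq_zero (C : Cycle ε a b) (s : ℝ → ℝ) {ξ : ℝ} (h : ξ ∉ Ioo C.α C.β) :
    C.gap s ξ = 0 := by
  unfold gap
  rcases le_or_gt ξ C.α with h1 | h1
  · simp [C.up.zero_left ξ h1, C.lo.zero_left ξ h1]
  · have h2 : C.β ≤ ξ := not_lt.1 fun h2 => h ⟨h1, h2⟩
    simp [C.up.zero_right ξ h2, C.lo.zero_right ξ h2]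

lemma hasDerivAt_gap (C : Cycle ε a b) {s : ℝ → ℝ} {s' ξ : ℝ} (hs : HasDerivAt s s' ξ)
    (hα : ξ ≠ C.α) (hβ : ξ ≠ C.β) :
    HasDerivAt (C.gap s) (dulac ε (ξ - ξ ^ 3) (a + b * ξ - ξ ^ 2) (s ξ) s' (C.Y ξ) -
      dulac ε (ξ - ξ ^ 3) (a + b * ξ - ξ ^ 2) (s ξ) s' (-C.Z ξ)) ξ := by
  by_cases hξ : ξ ∈ Ioo C.α C.β
  · have h1 := C.up.hasDerivAt_dulac hs hξ
    have h2 := C.lo.hasDerivAt_dulac hs hξ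
    have e : dulac (-ε) (ξ - ξ ^ 3) (a + b * ξ - ξ ^ 2) (s ξ) s' (C.Z ξ) =
        dulac ε (ξ - ξ ^ 3) (a + b * ξ - ξ ^ 2) (s ξ) s' (-C.Z ξ) := by
      unfold dulac; ring
    rw [e] at h2
    exact h1.sub h2
  · have h1 := C.up.eventually_zero hα hβ hξ
    have h2 := C.lo.eventually_zero hα hβ hξ
    rw [h1.self_of_nhds, h2.self_of_nhds, neg_zero, sub_self]
    refine (hasDerivAt_const ξ (0 : ℝ)).congr_of_eventuallyEq ?_
    filter_upwards [h1, h2] with z hz1 hz2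
    simp [gap, hz1, hz2]

end Cycle

/-- Dulac's argument: an outer cycle and a family of inner curves cannot coexist if the
divergence, weighted by `1 + ε y s(x)`, has a sign between them. -/
lemma dulac_false {ε a b : ℝ} (hε : 0 < ε) (C : Cycle ε a b) {Y Z F s s' : ℝ → ℝ}
    (hs : Continuous s) (hF : Continuous F) (S : Finset ℝ)
    (hs' : ∀ ξ, ξ ∉ S → HasDerivAt s (s' ξ) ξ)
    (hFl : F C.α = 0) (hFr : F C.β = 0)
    (hFd : ∀ ξ, ξ ∉ S → HasDerivAt F
      (dulac ε (ξ - ξ ^ 3) (a + b * ξ - ξ ^ 2) (s ξ) (s' ξ) (Y ξ) -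
      dulac ε (ξ - ξ ^ 3) (a + b * ξ - ξ ^ 2) (s ξ) (s' ξ) (-Z ξ)) ξ)
    (hY : ∀ ξ ∈ Ioo C.α C.β, Y ξ < C.Y ξ) (hZ : ∀ ξ ∈ Ioo C.α C.β, Z ξ < C.Z ξ)
    {σ : ℝ} (hσ : σ = 1 ∨ σ = -1)
    (hpos : ∀ ξ ∈ Ioo C.α C.β, ξ ∉ S → ∀ y, (y ∈ Ioo (Y ξ) (C.Y ξ) ∨ y ∈ Ioo (-C.Z ξ) (-Z ξ)) →
      0 < σ * (a + b * ξ - ξ ^ 2 + y ^ 2 * s' ξ + (ξ - ξ ^ 3) * s ξ +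
        2 * ε * y * s ξ * (a + b * ξ - ξ ^ 2))) : False := by
  have key : σ * (C.gap s C.α - F C.α) < σ * (C.gap s C.β - F C.β) := by
    refine lt_of_deriv_pos_off_finset (D := fun ξ => σ * (C.gap s ξ - F ξ))
      (S ∪ {C.α, C.β}) (((C.gap_continuous hs).sub hF).const_mul σ) C.lt ?_
      (D' := fun ξ => σ * ((dulac ε (ξ - ξ ^ 3) (a + b * ξ - ξ ^ 2) (s ξ) (s' ξ) (C.Y ξ) -
      dulac ε (ξ - ξ ^ 3) (a + b * ξ - ξ ^ 2) (s ξ) (s' ξ) (-C.Z ξ)) -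
      (dulac ε (ξ - ξ ^ 3) (a + b * ξ - ξ ^ 2) (s ξ) (s' ξ) (Y ξ) -
      dulac ε (ξ - ξ ^ 3) (a + b * ξ - ξ ^ 2) (s ξ) (s' ξ) (-Z ξ))))
    intro ξ hξ hξS
    simp only [Finset.mem_union, Finset.mem_insert, Finset.mem_singleton, not_or] at hξS
    refine ⟨((C.hasDerivAt_gap (hs' ξ hξS.1) hξS.2.1 hξS.2.2).sub (hFd ξ hξS.1)).const_mul σ, ?_⟩
    have h3 := hpos ξ hξ hξS.1
    rcases hσ with rfl | rfl
    · have h1 := dulac_lt (s := s ξ) (s' := s' ξ) (g := ξ - ξ ^ 3) (v := a + b * ξ - ξ ^ 2)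
        hε (hY ξ hξ) (fun y hy => by simpa using h3 y (Or.inl hy))
      have h2 := dulac_lt (s := s ξ) (s' := s' ξ) (g := ξ - ξ ^ 3) (v := a + b * ξ - ξ ^ 2)
        hε (neg_lt_neg (hZ ξ hξ)) (fun y hy => by simpa using h3 y (Or.inr hy))
      linarith
    · have e : ∀ y, dulac ε (-(ξ - ξ ^ 3)) (-(a + b * ξ - ξ ^ 2)) (s ξ) (-s' ξ) y =
          - dulac ε (ξ - ξ ^ 3) (a + b * ξ - ξ ^ 2) (s ξ) (s' ξ) y := by
        intro y; unfold dulac; ring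
      have h1 := dulac_lt (s := s ξ) (s' := -s' ξ) (g := -(ξ - ξ ^ 3))
        (v := -(a + b * ξ - ξ ^ 2)) hε (hY ξ hξ) (fun y hy => by
          have := h3 y (Or.inl hy); linarith)
      have h2 := dulac_lt (s := s ξ) (s' := -s' ξ) (g := -(ξ - ξ ^ 3))
        (v := -(a + b * ξ - ξ ^ 2)) hε (neg_lt_neg (hZ ξ hξ)) (fun y hy => by
          have := h3 y (Or.inr hy); linarith)
      rw [e, e] at h1 h2
      linarith
  rw [C.gap_eq_zero s (by simp), C.gap_eq_zero s (by simp), hFl, hFr] at key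
  exact lt_irrefl _ key

/-- The potential energy. -/
noncomputable def pot (x : ℝ) : ℝ := x ^ 4 / 4 - x ^ 2 / 2

lemma hasDerivAt_pot (x : ℝ) : HasDerivAt pot (x ^ 3 - x) x := by
  have h := (((hasDerivAt_id x).pow 4).div_const 4).sub (((hasDerivAt_id x).pow 2).div_const 2)
  exact h.congr_deriv (by simp; try ring)

lemma continuous_pot : Continuous pot := by unfold pot; fun_prop

lemma Arc.hasDerivAt_energy {ε a b : ℝ} {Y : ℝ → ℝ} {p q : ℝ} (h : Arc ε a b Y p q) {ξ : ℝ}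
    (hξ : ξ ∈ Ioo p q) : HasDerivAt (fun ξ => Y ξ ^ 2 / 2 + pot ξ)
      (ε * (a + b * ξ - ξ ^ 2) * Y ξ) ξ := by
  have hp := (h.pos ξ hξ).ne'
  refine ((((h.deriv ξ hξ).pow 2).div_const 2).add (hasDerivAt_pot ξ)).congr_deriv ?_
  simp
  field_simp
  ring

lemma Arc.continuous_energy {ε a b : ℝ} {Y : ℝ → ℝ} {p q : ℝ} (h : Arc ε a b Y p q) :
    Continuous (fun ξ => Y ξ ^ 2 / 2 + pot ξ) :=
  ((h.cont.pow 2).div_const 2).add continuous_pot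

lemma Cycle.balance {ε a b : ℝ} (hε : 0 < ε) (C : Cycle ε a b) {l r : ℝ} (hl : l ≤ C.α)
    (hr : C.β ≤ r) : ∫ ξ in l..r, (a + b * ξ - ξ ^ 2) * (C.Y ξ + C.Z ξ) = 0 := by
  have hY := C.up.cont
  have hZ := C.lo.cont
  have hc : Continuous fun ξ => ε * ((a + b * ξ - ξ ^ 2) * (C.Y ξ + C.Z ξ)) := by fun_prop
  have := MeasureTheory.integral_eq_of_hasDerivAt_off_countable_of_le (C.gap fun _ => 0)
    (fun ξ => ε * ((a + b * ξ - ξ ^ 2) * (C.Y ξ + C.Z ξ))) (a := l) (b := r)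
    (by linarith [C.lt]) (s := {C.α, C.β}) (by simp)
    (C.gap_continuous continuous_const).continuousOn (fun ξ hξ => by
      have h2 := hξ.2
      simp only [mem_insert_iff, mem_singleton_iff, not_or] at h2
      refine (C.hasDerivAt_gap (hasDerivAt_const ξ (0 : ℝ)) h2.1 h2.2).congr_deriv ?_
      unfold dulac
      ring) (hc.intervalIntegrable _ _)
  rw [C.gap_eq_zero _ fun h => by linarith [h.2], C.gap_eq_zero _ fun h => by linarith [h.1],
    intervalIntegral.integral_const_mul, sub_zero] at this
  exact (mul_eq_zero.1 this).resolve_left hε.ne'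

lemma le_integral_of_le {g : ℝ → ℝ} (hg : Continuous g) {l r c : ℝ} (hlr : l ≤ r)
    (h : ∀ x ∈ Icc l r, c ≤ g x) : (r - l) * c ≤ ∫ x in l..r, g x := by
  have := intervalIntegral.integral_mono_on hlr
    ((continuous_const (y := c)).intervalIntegrable (μ := MeasureTheory.volume) l r)
    (hg.intervalIntegrable l r) h
  simpa using this

lemma Arc.root_bound {ε a b : ℝ} (hε : |ε| ≤ 1) {Y : ℝ → ℝ} {p q : ℝ} (h : Arc ε a b Y p q)
    {l r C : ℝ} (hC : ∀ ξ ∈ Icc l r, |ξ - ξ ^ 3| + |a + b * ξ - ξ ^ 2| < C) {ξ₁ ξ₂ : ℝ}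
    (h₁ : ξ₁ ∈ Icc l r) (h₂ : ξ₂ ∈ Icc l r) :
    √(1 + Y ξ₁ ^ 2) ≤ √(1 + Y ξ₂ ^ 2) + C * (r - l) := by
  have hder : ∀ ξ ∈ Icc l r, ξ ∉ ({p, q} : Finset ℝ) → ∃ d, |d| < C ∧
      HasDerivAt (fun ξ => √(1 + Y ξ ^ 2)) d ξ := by
    intro ξ hξ hS
    simp only [Finset.mem_insert, Finset.mem_singleton, not_or] at hS
    have hb := hC ξ hξ
    by_cases hm : ξ ∈ Ioo p q
    · have hp := h.pos ξ hm
      have hq : 0 < 1 + Y ξ ^ 2 := by positivity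
      have hr : 0 < √(1 + Y ξ ^ 2) := Real.sqrt_pos.2 hq
      refine ⟨((ξ - ξ ^ 3) + ε * (a + b * ξ - ξ ^ 2) * Y ξ) / √(1 + Y ξ ^ 2), ?_, ?_⟩
      · rw [abs_div, abs_of_pos hr, div_lt_iff₀ hr]
        have h1 : 1 ≤ √(1 + Y ξ ^ 2) := Real.one_le_sqrt.2 (by nlinarith)
        have h2 : Y ξ ≤ √(1 + Y ξ ^ 2) := Real.le_sqrt_of_sq_le (by linarith)
        calc |(ξ - ξ ^ 3) + ε * (a + b * ξ - ξ ^ 2) * Y ξ|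
            ≤ |ξ - ξ ^ 3| + |ε * (a + b * ξ - ξ ^ 2) * Y ξ| := abs_add_le _ _
          _ = |ξ - ξ ^ 3| + |ε| * |a + b * ξ - ξ ^ 2| * Y ξ := by
              rw [abs_mul, abs_mul, abs_of_pos hp]
          _ ≤ |ξ - ξ ^ 3| * √(1 + Y ξ ^ 2) + 1 * |a + b * ξ - ξ ^ 2| * √(1 + Y ξ ^ 2) := by
              gcongr
              exact le_mul_of_one_le_right (abs_nonneg _) h1
          _ = (|ξ - ξ ^ 3| + |a + b * ξ - ξ ^ 2|) * √(1 + Y ξ ^ 2) := by ring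
          _ < C * √(1 + Y ξ ^ 2) := mul_lt_mul_of_pos_right hb hr
      · refine ((((h.deriv ξ hm).pow 2).const_add 1).sqrt hq.ne').congr_deriv ?_
        simp
        field_simp
    · have hz := h.eventually_zero hS.1 hS.2 hm
      refine ⟨0, ?_, ?_⟩
      · rw [abs_zero]
        exact lt_of_le_of_lt (by positivity) hb
      · refine (hasDerivAt_const ξ (1 : ℝ)).congr_of_eventuallyEq ?_
        filter_upwards [hz] with z hz
        simp [hz]
  have cont : Continuous (fun ξ => √(1 + Y ξ ^ 2)) := by
    have := h.cont
    fun_prop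
  choose! d hd1 hd2 using hder
  have hCpos : 0 < C := lt_of_le_of_lt (by positivity) (hC ξ₁ h₁)
  have hlen : ∀ {u w : ℝ}, u ∈ Icc l r → w ∈ Icc l r → C * (w - u) ≤ C * (r - l) := by
    intro u w hu hw
    exact mul_le_mul_of_nonneg_left (by linarith [hu.1, hw.2]) hCpos.le
  rcases lt_trichotomy ξ₁ ξ₂ with h3 | h3 | h3
  · have := lt_of_deriv_pos_off_finset (D := fun ξ => C * ξ + √(1 + Y ξ ^ 2))
      (D' := fun ξ => C * 1 + d ξ) {p, q} (by fun_prop) h3 (fun ξ hξ hS => by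
        have hm : ξ ∈ Icc l r := ⟨h₁.1.trans hξ.1.le, hξ.2.le.trans h₂.2⟩
        exact ⟨((hasDerivAt_id ξ).const_mul C).add (hd2 ξ hm hS), by
          linarith [(abs_lt.1 (hd1 ξ hm hS)).1]⟩)
    linarith [hlen h₁ h₂]
  · rw [h3]
    have := hlen h₁ h₁
    linarith
  · have := lt_of_deriv_pos_off_finset (D := fun ξ => C * ξ - √(1 + Y ξ ^ 2))
      (D' := fun ξ => C * 1 - d ξ) {p, q} (by fun_prop) h3 (fun ξ hξ hS => by
        have hm : ξ ∈ Icc l r := ⟨h₂.1.trans hξ.1.le, hξ.2.le.trans h₁.2⟩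
        exact ⟨((hasDerivAt_id ξ).const_mul C).sub (hd2 ξ hm hS), by
          linarith [(abs_lt.1 (hd1 ξ hm hS)).2]⟩)
    linarith [hlen h₂ h₁]

lemma abs_sub_le_three {x X : ℝ} (h : |x| ≤ X) (a b : ℝ) :
    |x - x ^ 3| + |a + b * x - x ^ 2| < X + X ^ 3 + |a| + |b| * X + X ^ 2 + 1 := by
  have h0 := abs_nonneg x
  have h1 : |x| ^ 3 ≤ X ^ 3 := by gcongr
  have h2 : |x| ^ 2 ≤ X ^ 2 := by gcongr
  have h3 : |b| * |x| ≤ |b| * X := by gcongr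
  have h4 : |x - x ^ 3| ≤ |x| + |x| ^ 3 := by
    rw [← abs_pow]; exact abs_sub _ _
  have h5 : |a + b * x - x ^ 2| ≤ |a| + |b| * |x| + |x| ^ 2 := by
    rw [← abs_pow, ← abs_mul]
    exact (abs_sub _ _).trans (by gcongr; exact abs_add_le _ _)
  linarith

/-- A lower bound for the dissipation along one arc by its size in the inner region. -/
lemma Arc.dissipation {ε a b : ℝ} (hε : |ε| ≤ 1) {Y : ℝ → ℝ} {p q : ℝ} (h : Arc ε a b Y p q)
    {K X C : ℝ} (hK : 0 ≤ K) (hX : 0 < X) (hfK : ∀ ξ, -K ≤ -(a + b * ξ - ξ ^ 2))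
    (hfX : ∀ ξ, X ≤ |ξ| → K + 1 ≤ -(a + b * ξ - ξ ^ 2))
    (hC : ∀ ξ ∈ Icc (-(3 * X)) (3 * X), |ξ - ξ ^ 3| + |a + b * ξ - ξ ^ 2| < C)
    {L : ℝ} (hL : 3 * X ≤ L) {ξ₀ : ℝ} (h₀ : ξ₀ ∈ Icc (-(3 * X)) (3 * X)) :
    4 * X * Y ξ₀ - 4 * X * (K + 1) * (C * (6 * X) + 1) ≤
      ∫ ξ in (-L)..L, -(a + b * ξ - ξ ^ 2) * Y ξ := by
  obtain ⟨ξm, hm, hmax⟩ := isCompact_Icc.exists_isMaxOn (α := ℝ) (β := ℝ)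
    (nonempty_Icc.2 (by linarith : -(3 * X) ≤ 3 * X)) h.cont.continuousOn
  set m := Y ξm
  have hmax' : ∀ ξ ∈ Icc (-(3 * X)) (3 * X), Y ξ ≤ m := fun ξ hξ => hmax hξ
  have hmin : ∀ ξ ∈ Icc (-(3 * X)) (3 * X), m - (C * (6 * X) + 1) ≤ Y ξ := by
    intro ξ hξ
    have h1 := h.root_bound hε hC hm hξ
    have h2 : m ≤ √(1 + m ^ 2) := Real.le_sqrt_of_sq_le (by linarith)
    have h3 : √(1 + Y ξ ^ 2) ≤ 1 + Y ξ :=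
      Real.sqrt_le_iff.2 ⟨by linarith [h.nonneg ξ], by nlinarith [h.nonneg ξ]⟩
    have h4 : C * (3 * X - -(3 * X)) = C * (6 * X) := by ring
    rw [h4] at h1
    linarith
  have hc : Continuous fun ξ => -(a + b * ξ - ξ ^ 2) * Y ξ := by
    have := h.cont
    fun_prop
  have ii : ∀ u w : ℝ, IntervalIntegrable (fun ξ => -(a + b * ξ - ξ ^ 2) * Y ξ)
    MeasureTheory.volume u w := fun u w => hc.intervalIntegrable u w
  have far : ∀ ξ, X ≤ |ξ| → (K + 1) * Y ξ ≤ -(a + b * ξ - ξ ^ 2) * Y ξ := fun ξ hξ =>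
    mul_le_mul_of_nonneg_right (hfX ξ hξ) (h.nonneg ξ)
  have far0 : ∀ ξ, X ≤ |ξ| → 0 ≤ -(a + b * ξ - ξ ^ 2) * Y ξ := fun ξ hξ =>
    le_trans (mul_nonneg (by linarith) (h.nonneg ξ)) (far ξ hξ)
  have i1 := le_integral_of_le hc (c := 0) (show -L ≤ -(3 * X) by linarith) (fun ξ hξ =>
    far0 ξ (by rw [abs_of_neg (by linarith [hξ.2])]; linarith [hξ.2]))
  have i5 := le_integral_of_le hc (c := 0) (show 3 * X ≤ L by linarith) (fun ξ hξ =>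
    far0 ξ (by rw [abs_of_pos (by linarith [hξ.1])]; linarith [hξ.1]))
  have mid : ∀ ξ ∈ Icc (-(3 * X)) (3 * X), X ≤ |ξ| →
      (K + 1) * (m - (C * (6 * X) + 1)) ≤ -(a + b * ξ - ξ ^ 2) * Y ξ := fun ξ hξ hξ' =>
    le_trans (mul_le_mul_of_nonneg_left (hmin ξ hξ) (by linarith)) (far ξ hξ')
  have i2 := le_integral_of_le hc (show -(3 * X) ≤ -X by linarith) (fun ξ hξ =>
    mid ξ ⟨hξ.1, by linarith [hξ.2]⟩ (by rw [abs_of_neg (by linarith [hξ.2])]; linarith [hξ.2]))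
  have i4 := le_integral_of_le hc (show X ≤ 3 * X by linarith) (fun ξ hξ =>
    mid ξ ⟨by linarith [hξ.1], hξ.2⟩ (by rw [abs_of_pos (by linarith [hξ.1])]; linarith [hξ.1]))
  have i3 := le_integral_of_le hc (c := -(K * m)) (show -X ≤ X by linarith) (fun ξ hξ => by
    have h1 := hmax' ξ ⟨by linarith [hξ.1], by linarith [hξ.2]⟩
    have h2 := hfK ξ
    have h3 := h.nonneg ξ
    nlinarith)
  have hsum : ∫ ξ in (-L)..L, -(a + b * ξ - ξ ^ 2) * Y ξ =
      (∫ ξ in (-L)..(-(3 * X)), -(a + b * ξ - ξ ^ 2) * Y ξ) +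
      (∫ ξ in (-(3 * X))..(-X), -(a + b * ξ - ξ ^ 2) * Y ξ) +
      (∫ ξ in (-X)..X, -(a + b * ξ - ξ ^ 2) * Y ξ) +
      (∫ ξ in X..(3 * X), -(a + b * ξ - ξ ^ 2) * Y ξ) +
      (∫ ξ in (3 * X)..L, -(a + b * ξ - ξ ^ 2) * Y ξ) := by
    rw [intervalIntegral.integral_add_adjacent_intervals (ii _ _) (ii _ _),
      intervalIntegral.integral_add_adjacent_intervals (ii _ _) (ii _ _),
      intervalIntegral.integral_add_adjacent_intervals (ii _ _) (ii _ _),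
      intervalIntegral.integral_add_adjacent_intervals (ii _ _) (ii _ _)]
  have hm0 : 0 ≤ m := h.nonneg ξm
  have hYm : 4 * X * Y ξ₀ ≤ 4 * X * m :=
    mul_le_mul_of_nonneg_left (hmax' ξ₀ h₀) (by linarith)
  have hXK : 0 ≤ X * K * m := by positivity
  rw [hsum]
  nlinarith

lemma Arc.antitone_energy {ε a b : ℝ} {Y : ℝ → ℝ} {p q : ℝ} (h : Arc ε a b Y p q) (hε : 0 ≤ ε)
    {u w : ℝ} (hu : p ≤ u) (hw : w ≤ q) (hv : ∀ ξ ∈ Ioo u w, a + b * ξ - ξ ^ 2 ≤ 0) :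
    AntitoneOn (fun ξ => Y ξ ^ 2 / 2 + pot ξ) (Icc u w) := by
  have hd : ∀ ξ ∈ interior (Icc u w), HasDerivAt (fun ξ => Y ξ ^ 2 / 2 + pot ξ)
      (ε * (a + b * ξ - ξ ^ 2) * Y ξ) ξ := fun ξ hξ => by
    rw [interior_Icc] at hξ
    exact h.hasDerivAt_energy ⟨hu.trans_lt hξ.1, hξ.2.trans_le hw⟩
  refine antitoneOn_of_deriv_nonpos (convex_Icc u w) h.continuous_energy.continuousOn
    (fun ξ hξ => (hd ξ hξ).differentiableAt.differentiableWithinAt) fun ξ hξ => ?_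
  rw [(hd ξ hξ).deriv]
  rw [interior_Icc] at hξ
  exact mul_nonpos_of_nonpos_of_nonneg (mul_nonpos_of_nonneg_of_nonpos hε (hv ξ hξ)) (h.nonneg ξ)

lemma Arc.monotone_energy {ε a b : ℝ} {Y : ℝ → ℝ} {p q : ℝ} (h : Arc ε a b Y p q) (hε : ε ≤ 0)
    {u w : ℝ} (hu : p ≤ u) (hw : w ≤ q) (hv : ∀ ξ ∈ Ioo u w, a + b * ξ - ξ ^ 2 ≤ 0) :
    MonotoneOn (fun ξ => Y ξ ^ 2 / 2 + pot ξ) (Icc u w) := by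
  have hd : ∀ ξ ∈ interior (Icc u w), HasDerivAt (fun ξ => Y ξ ^ 2 / 2 + pot ξ)
      (ε * (a + b * ξ - ξ ^ 2) * Y ξ) ξ := fun ξ hξ => by
    rw [interior_Icc] at hξ
    exact h.hasDerivAt_energy ⟨hu.trans_lt hξ.1, hξ.2.trans_le hw⟩
  refine monotoneOn_of_deriv_nonneg (convex_Icc u w) h.continuous_energy.continuousOn
    (fun ξ hξ => (hd ξ hξ).differentiableAt.differentiableWithinAt) fun ξ hξ => ?_
  rw [(hd ξ hξ).deriv]
  rw [interior_Icc] at hξ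
  exact mul_nonneg (mul_nonneg_of_nonpos_of_nonpos hε (hv ξ hξ)) (h.nonneg ξ)

lemma exists_inner_bound (a b : ℝ) : ∃ X C₂ : ℝ, 2 ≤ X ∧ 0 < C₂ ∧
    (∀ ξ, X ≤ |ξ| → a + b * ξ - ξ ^ 2 ≤ 0) ∧ ∀ ε, 0 < ε → ε ≤ 1 → ∀ C : Cycle ε a b,
    ∀ ξ, |ξ| ≤ X → C.Y ξ ≤ C₂ ∧ C.Z ξ ≤ C₂ := by
  set K : ℝ := b ^ 2 + |a| with hKdef
  have hK : 0 ≤ K := by positivity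
  set X : ℝ := |b| + K + |a| + 2 with hXdef
  have hX2 : 2 ≤ X := by linarith [abs_nonneg b, abs_nonneg a]
  have hfK : ∀ ξ, -K ≤ -(a + b * ξ - ξ ^ 2) := by
    intro ξ
    nlinarith [sq_nonneg (ξ - b / 2), le_abs_self a, sq_nonneg b]
  have hfX : ∀ ξ, X ≤ |ξ| → K + 1 ≤ -(a + b * ξ - ξ ^ 2) := by
    intro ξ hξ
    have h1 : b * ξ ≤ |b| * |ξ| := by rw [← abs_mul]; exact le_abs_self _
    have h2 := le_abs_self a
    have h3 : |ξ| * 1 + 0 ≤ |ξ| * (|ξ| - |b|) := by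
      rw [add_zero]
      exact mul_le_mul_of_nonneg_left (by linarith [abs_nonneg a]) (abs_nonneg _)
    rw [← sq_abs ξ]
    have h4 := abs_nonneg b
    nlinarith
  set C₀ : ℝ := 3 * X + (3 * X) ^ 3 + |a| + |b| * (3 * X) + (3 * X) ^ 2 + 1
  have hC : ∀ ξ ∈ Icc (-(3 * X)) (3 * X), |ξ - ξ ^ 3| + |a + b * ξ - ξ ^ 2| < C₀ := fun ξ hξ =>
    abs_sub_le_three (abs_le.2 hξ) a b
  have hC₀ : 0 < C₀ := by positivity
  set C₂ : ℝ := 2 * ((K + 1) * (C₀ * (6 * X) + 1))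
  have hC₂ : 0 < C₂ := by positivity
  refine ⟨X, C₂, hX2, hC₂, fun ξ hξ => by linarith [hfX ξ hξ], fun ε hε hε1 C ξ hξX => ?_⟩
  have hξ : ξ ∈ Icc (-(3 * X)) (3 * X) :=
    ⟨by linarith [(abs_le.1 hξX).1], by linarith [(abs_le.1 hξX).2]⟩
  set L := max (3 * X) (max (-C.α) C.β)
  have hL1 : 3 * X ≤ L := le_max_left _ _
  have hL2 : -C.α ≤ L := (le_max_left _ _).trans (le_max_right _ _)
  have hL3 : C.β ≤ L := (le_max_right _ _).trans (le_max_right _ _)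
  have h1 := C.up.dissipation (by rwa [abs_of_pos hε]) hK (by linarith) hfK hfX hC hL1 hξ
  have h2 := C.lo.dissipation (by rwa [abs_neg, abs_of_pos hε]) hK (by linarith) hfK hfX hC hL1 hξ
  have h3 := C.balance hε (l := -L) (r := L) (by linarith) hL3
  have c1 := C.up.cont
  have c2 := C.lo.cont
  have h4 : (∫ ξ in (-L)..L, -(a + b * ξ - ξ ^ 2) * C.Y ξ) +
      (∫ ξ in (-L)..L, -(a + b * ξ - ξ ^ 2) * C.Z ξ) = 0 := by
    rw [← intervalIntegral.integral_add (Continuous.intervalIntegrable (by fun_prop) _ _)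
      (Continuous.intervalIntegrable (by fun_prop) _ _), ← neg_eq_zero,
      ← intervalIntegral.integral_neg, ← h3]
    congr 1
    ext z
    ring
  have h5 : 4 * X * (C.Y ξ + C.Z ξ) ≤ 4 * X * C₂ := by
    simp only [C₂]
    linarith
  have h6 : C.Y ξ + C.Z ξ ≤ C₂ := le_of_mul_le_mul_left h5 (by linarith)
  exact ⟨by linarith [C.lo.nonneg ξ], by linarith [C.up.nonneg ξ]⟩

/-- The closed orbits are uniformly bounded. -/
theorem exists_bound (a b : ℝ) : ∃ M : ℝ, 0 < M ∧ ∀ ε, 0 < ε → ε ≤ 1 → ∀ C : Cycle ε a b,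
    -M ≤ C.α ∧ C.β ≤ M ∧ ∀ ξ, C.Y ξ ≤ M ∧ C.Z ξ ≤ M := by
  obtain ⟨X, C₂, hX2, hC₂, hfX, hYZ⟩ := exists_inner_bound a b
  set C₃ : ℝ := C₂ ^ 2 / 2 + pot X
  have hpotX : ∀ ξ, |ξ| ≤ X → pot ξ ≤ pot X := by
    intro ξ hξ
    have : ξ ^ 2 ≤ X ^ 2 := sq_le_sq' (abs_le.1 hξ).1 (abs_le.1 hξ).2
    unfold pot
    have h4 : 4 ≤ X ^ 2 := by nlinarith
    nlinarith [mul_nonneg (sub_nonneg.2 this) (by nlinarith [sq_nonneg ξ] : 0 ≤ X ^ 2 + ξ ^ 2 - 2)]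
  have hpot0 : 0 < pot X := by
    unfold pot
    have h4 : 4 ≤ X ^ 2 := by nlinarith
    nlinarith [mul_nonneg (sub_nonneg.2 h4) (sq_nonneg X)]
  have hC₃ : 0 < C₃ := by positivity
  refine ⟨C₃ + 3, by linarith, fun ε hε hε1 C => ?_⟩
  have hα1 : C.α < 1 := by
    have := C.left
    by_contra hle
    nlinarith [not_lt.1 hle, sq_nonneg C.α]
  have hβ1 : -1 < C.β := by
    have := C.right
    by_contra hle
    nlinarith [not_lt.1 hle, sq_nonneg C.β]
  have inner : ∀ ξ, |ξ| ≤ X → C.Y ξ ^ 2 / 2 + pot ξ ≤ C₃ ∧ C.Z ξ ^ 2 / 2 + pot ξ ≤ C₃ := by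
    intro ξ hξ
    obtain ⟨h1, h2⟩ := hYZ ε hε hε1 C ξ hξ
    have h3 := hpotX ξ hξ
    have h4 : C.Y ξ ^ 2 ≤ C₂ ^ 2 := by gcongr; exact C.up.nonneg ξ
    have h5 : C.Z ξ ^ 2 ≤ C₂ ^ 2 := by gcongr; exact C.lo.nonneg ξ
    constructor <;> simp only [C₃] <;> linarith
  have anti : ∀ {u w : ℝ}, C.α ≤ u → w ≤ C.β → (∀ ξ ∈ Ioo u w, X ≤ |ξ|) →
      AntitoneOn (fun ξ => C.Y ξ ^ 2 / 2 + pot ξ) (Icc u w) ∧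
      MonotoneOn (fun ξ => C.Z ξ ^ 2 / 2 + pot ξ) (Icc u w) := fun hu hw hX' =>
    ⟨C.up.antitone_energy hε.le hu hw fun ξ hξ => hfX ξ (hX' ξ hξ),
      C.lo.monotone_energy (by linarith) hu hw fun ξ hξ => hfX ξ (hX' ξ hξ)⟩
  have endL : C.Y C.α ^ 2 / 2 + pot C.α = C.Z C.α ^ 2 / 2 + pot C.α := by
    rw [C.up.zero_left _ le_rfl, C.lo.zero_left _ le_rfl]
  have endR : C.Y C.β ^ 2 / 2 + pot C.β = C.Z C.β ^ 2 / 2 + pot C.β := by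
    rw [C.up.zero_right _ le_rfl, C.lo.zero_right _ le_rfl]
  have all : ∀ ξ ∈ Icc C.α C.β, C.Y ξ ^ 2 / 2 + pot ξ ≤ C₃ ∧ C.Z ξ ^ 2 / 2 + pot ξ ≤ C₃ := by
    intro ξ hξ
    rcases le_or_gt |ξ| X with h | h
    · exact inner ξ h
    rcases lt_abs.1 h with h' | h'
    · obtain ⟨m1, m2⟩ := anti (u := X) (w := C.β) (by linarith) le_rfl
        (fun z hz => by rw [abs_of_pos (by linarith [hz.1])]; exact hz.1.le)
      have hXm : X ∈ Icc X C.β := ⟨le_rfl, by linarith [hξ.2]⟩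
      have hβm : C.β ∈ Icc X C.β := ⟨by linarith [hξ.2], le_rfl⟩
      have hξm : ξ ∈ Icc X C.β := ⟨h'.le, hξ.2⟩
      have h1 := (inner X (by rw [abs_of_pos (by linarith)])).1
      have h2 := m1 hXm hξm h'.le
      have h3 := m1 hXm hβm hβm.1
      have h4 := m2 hξm hβm hξ.2
      simp only at h2 h3 h4
      exact ⟨by linarith, by linarith⟩
    · obtain ⟨m1, m2⟩ := anti (u := C.α) (w := -X) le_rfl (by linarith)
        (fun z hz => by rw [abs_of_neg (by linarith [hz.2])]; linarith [hz.2])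
      have hXm : -X ∈ Icc C.α (-X) := ⟨by linarith [hξ.1], le_rfl⟩
      have hαm : C.α ∈ Icc C.α (-X) := ⟨le_rfl, by linarith [hξ.1]⟩
      have hξm : ξ ∈ Icc C.α (-X) := ⟨hξ.1, by linarith⟩
      have h1 := (inner (-X) (by rw [abs_neg, abs_of_pos (by linarith)])).2
      have h2 := m2 hξm hXm hξm.2
      have h3 := m2 hαm hXm hαm.2
      have h4 := m1 hαm hξm hξ.1
      simp only at h2 h3 h4
      exact ⟨by linarith, by linarith⟩
  have xb : ∀ ξ, pot ξ ≤ C₃ → |ξ| ≤ C₃ + 3 := by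
    intro ξ hξ
    by_contra hlt
    rw [not_le] at hlt
    unfold pot at hξ
    have h1 : (C₃ + 3) ^ 2 ≤ ξ ^ 2 := by
      rw [← sq_abs ξ]; gcongr
    have h2 : 9 + 6 * C₃ ≤ ξ ^ 2 := by nlinarith
    have h3 := mul_nonneg (sq_nonneg ξ) (show 0 ≤ ξ ^ 2 - 9 by linarith)
    nlinarith
  have hαM := xb C.α (by
    have := (all C.α (left_mem_Icc.2 C.lt.le)).1
    rw [C.up.zero_left _ le_rfl] at this
    linarith)
  have hβM := xb C.β (by
    have := (all C.β (right_mem_Icc.2 C.lt.le)).1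
    rw [C.up.zero_right _ le_rfl] at this
    linarith)
  have hpm : ∀ ξ, -(1 / 4) ≤ pot ξ := by
    intro ξ; unfold pot; nlinarith [sq_nonneg (ξ ^ 2 - 1)]
  refine ⟨(abs_le.1 hαM).1, (abs_le.1 hβM).2, fun ξ => ?_⟩
  by_cases hξ : ξ ∈ Icc C.α C.β
  · obtain ⟨h1, h2⟩ := all ξ hξ
    have h3 := hpm ξ
    constructor
    · exact abs_le_of_sq_le_sq' (by nlinarith) (by linarith) |>.2
    · exact abs_le_of_sq_le_sq' (by nlinarith) (by linarith) |>.2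
  · rcases lt_or_ge ξ C.α with h1 | h1
    · rw [C.up.zero_left _ h1.le, C.lo.zero_left _ h1.le]
      exact ⟨by linarith, by linarith⟩
    · have h2 : C.β ≤ ξ := not_lt.1 fun h3 => hξ ⟨h1, h3.le⟩
      rw [C.up.zero_right _ h2, C.lo.zero_right _ h2]
      exact ⟨by linarith, by linarith⟩

lemma Arc.energy_sub_le {ε a b : ℝ} {Y : ℝ → ℝ} {p q : ℝ} (h : Arc ε a b Y p q) {B : ℝ}
    (hB : ∀ ξ ∈ Ioo p q, |ε * (a + b * ξ - ξ ^ 2) * Y ξ| ≤ B) {ξ : ℝ} (hξ : ξ ∈ Icc p q) :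
    |Y ξ ^ 2 / 2 + pot ξ - pot p| ≤ B * (ξ - p) := by
  have hd : ∀ z ∈ interior (Icc p q), HasDerivAt (fun ξ => Y ξ ^ 2 / 2 + pot ξ)
      (ε * (a + b * z - z ^ 2) * Y z) z := fun z hz => by
    rw [interior_Icc] at hz
    exact h.hasDerivAt_energy hz
  have hlin : ∀ z, HasDerivAt (fun z => B * z) (B * 1) z := fun z =>
    (hasDerivAt_id z).const_mul B
  have hB' : ∀ z ∈ interior (Icc p q), |ε * (a + b * z - z ^ 2) * Y z| ≤ B := by
    rw [interior_Icc]; exact hB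
  have m1 : MonotoneOn (fun z => B * z - (Y z ^ 2 / 2 + pot z)) (Icc p q) := by
    refine monotoneOn_of_deriv_nonneg (convex_Icc p q)
      ((continuous_const.mul continuous_id).sub h.continuous_energy).continuousOn
      (fun z hz => ((hlin z).sub (hd z hz)).differentiableAt.differentiableWithinAt) fun z hz => ?_
    have := ((hlin z).sub (hd z hz)).deriv
    simp only [Pi.sub_def] at this
    rw [this]
    linarith [(abs_le.1 (hB' z hz)).2]
  have m2 : MonotoneOn (fun z => B * z + (Y z ^ 2 / 2 + pot z)) (Icc p q) := by
    refine monotoneOn_of_deriv_nonneg (convex_Icc p q)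
      ((continuous_const.mul continuous_id).add h.continuous_energy).continuousOn
      (fun z hz => ((hlin z).add (hd z hz)).differentiableAt.differentiableWithinAt) fun z hz => ?_
    have := ((hlin z).add (hd z hz)).deriv
    simp only [Pi.add_def] at this
    rw [this]
    linarith [(abs_le.1 (hB' z hz)).1]
  have h1 := m1 (left_mem_Icc.2 h.lt.le) hξ hξ.1
  have h2 := m2 (left_mem_Icc.2 h.lt.le) hξ hξ.1
  simp only [h.zero_left p le_rfl] at h1 h2
  exact abs_le.2 ⟨by linarith, by linarith⟩

/-- The energy varies by `O(ε)` along a closed orbit. -/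
theorem exists_oscillation (a b : ℝ) : ∃ K : ℝ, 0 < K ∧ ∀ ε, 0 < ε → ε ≤ 1 → ∀ C : Cycle ε a b,
    ∀ ξ ∈ Icc C.α C.β, |C.Y ξ ^ 2 / 2 + pot ξ - pot C.α| ≤ K * ε ∧
      |C.Z ξ ^ 2 / 2 + pot ξ - pot C.α| ≤ K * ε := by
  obtain ⟨M, hM, hb⟩ := exists_bound a b
  set V : ℝ := M + M ^ 3 + |a| + |b| * M + M ^ 2 + 1
  have hV : 0 < V := by positivity
  refine ⟨V * M * (2 * M), by positivity, fun ε hε hε1 C ξ hξ => ?_⟩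
  obtain ⟨hα, hβ, hYZ⟩ := hb ε hε hε1 C
  have hv : ∀ ξ ∈ Ioo C.α C.β, |a + b * ξ - ξ ^ 2| ≤ V := by
    intro ξ hξ
    have := abs_sub_le_three (x := ξ) (X := M)
      (abs_le.2 ⟨by linarith [hξ.1], by linarith [hξ.2]⟩) a b
    linarith [abs_nonneg (ξ - ξ ^ 3)]
  have hlen : ε * V * M * (ξ - C.α) ≤ V * M * (2 * M) * ε := by
    have : ε * V * M * (ξ - C.α) ≤ ε * V * M * (2 * M) :=
      mul_le_mul_of_nonneg_left (by linarith [hξ.2]) (by positivity)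
    linarith
  constructor
  · refine (C.up.energy_sub_le (B := ε * V * M) (fun z hz => ?_) hξ).trans hlen
    rw [abs_mul, abs_mul, abs_of_pos hε, abs_of_nonneg (C.up.nonneg z)]
    gcongr
    exacts [C.up.nonneg z, hv z hz, (hYZ z).1]
  · refine (C.lo.energy_sub_le (B := ε * V * M) (fun z hz => ?_) hξ).trans hlen
    rw [abs_mul, abs_mul, abs_neg, abs_of_pos hε, abs_of_nonneg (C.lo.nonneg z)]
    gcongr
    exacts [C.lo.nonneg z, hv z hz, (hYZ z).2]

lemma hasDerivAt_integral_param {f f' : ℝ → ℝ → ℝ} {I : Set ℝ} (hI : IsOpen I) {l r : ℝ}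
    (hlr : l ≤ r) (hf : ∀ h ∈ I, ContinuousOn (f h) (Icc l r))
    (hf' : ContinuousOn (fun p : ℝ × ℝ => f' p.1 p.2) (I ×ˢ Icc l r))
    (hd : ∀ h ∈ I, ∀ θ ∈ Icc l r, HasDerivAt (fun h => f h θ) (f' h θ) h) {h₀ : ℝ} (h₀I : h₀ ∈ I) :
    HasDerivAt (fun h => ∫ θ in l..r, f h θ) (∫ θ in l..r, f' h₀ θ) h₀ := by
  obtain ⟨ρ, hρ, hsub⟩ := Metric.nhds_basis_closedBall.mem_iff.1 (hI.mem_nhds h₀I)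
  have hK : IsCompact (Metric.closedBall h₀ ρ ×ˢ Icc l r) :=
    (isCompact_closedBall h₀ ρ).prod isCompact_Icc
  obtain ⟨B, hB⟩ := hK.exists_bound_of_continuousOn (hf'.mono (prod_mono_left hsub))
  have hm : ∀ h ∈ I, MeasureTheory.AEStronglyMeasurable (f h)
      (MeasureTheory.volume.restrict (uIoc l r)) := fun h hh => by
    rw [uIoc_of_le hlr]
    exact ((hf h hh).mono Ioc_subset_Icc_self).aestronglyMeasurable measurableSet_Ioc
  have hI' : ∀ᶠ h in 𝓝 h₀, h ∈ I := hI.mem_nhds h₀I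
  refine (intervalIntegral.hasDerivAt_integral_of_dominated_loc_of_deriv_le
    (μ := MeasureTheory.volume) (F := f) (F' := f') (bound := fun _ => B)
    (Metric.closedBall_mem_nhds h₀ hρ) (hI'.mono fun h hh => hm h hh) ?_ ?_ ?_ ?_ ?_).2
  · exact ContinuousOn.intervalIntegrable (by rw [uIcc_of_le hlr]; exact hf h₀ h₀I)
  · rw [uIoc_of_le hlr]
    refine ContinuousOn.aestronglyMeasurable (ContinuousOn.mono (s := Icc l r) ?_
      Ioc_subset_Icc_self) measurableSet_Ioc
    exact hf'.comp (f := fun θ => (h₀, θ)) (by fun_prop) fun θ hθ => ⟨h₀I, hθ⟩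
  · refine Eventually.of_forall fun θ hθ h hh => hB (h, θ) ⟨hh, ?_⟩
    rw [uIoc_of_le hlr] at hθ
    exact Ioc_subset_Icc_self hθ
  · exact intervalIntegrable_const
  · refine Eventually.of_forall fun θ hθ h hh => hd h (hsub hh) θ ?_
    rw [uIoc_of_le hlr] at hθ
    exact Ioc_subset_Icc_self hθ

/-- The compact neighbourhood of `[0, 2π] × {h₀} × {0}` of size `ρ`. -/
def box (h₀ ρ : ℝ) : Set (ℝ × ℝ × ℝ) :=
  Icc 0 (2 * Real.pi) ×ˢ (Metric.closedBall h₀ ρ ×ˢ Metric.closedBall 0 ρ)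

lemma isCompact_box (h₀ ρ : ℝ) : IsCompact (box h₀ ρ) :=
  isCompact_Icc.prod ((isCompact_closedBall _ _).prod (isCompact_closedBall _ _))

lemma box_mono {h₀ ρ ρ' : ℝ} (h : ρ ≤ ρ') : box h₀ ρ ⊆ box h₀ ρ' :=
  prod_mono_right (prod_mono (Metric.closedBall_subset_closedBall h)
    (Metric.closedBall_subset_closedBall h))

/-- A right-hand side `F` with continuous derivatives `F₁`, `F₂` in `h` near the level `h₀`. -/
structure Regular (F F₁ F₂ : ℝ × ℝ × ℝ → ℝ) (h₀ ρ : ℝ) : Prop where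
  pos : 0 < ρ
  cont : ContinuousOn F (box h₀ ρ)
  cont₁ : ContinuousOn F₁ (box h₀ ρ)
  cont₂ : ContinuousOn F₂ (box h₀ ρ)
  deriv : ∀ θ h ε, (θ, h, ε) ∈ box h₀ ρ → HasDerivAt (fun h => F (θ, h, ε)) (F₁ (θ, h, ε)) h
  deriv₁ : ∀ θ h ε, (θ, h, ε) ∈ box h₀ ρ → HasDerivAt (fun h => F₁ (θ, h, ε)) (F₂ (θ, h, ε)) h

lemma exists_regular {F : ℝ × ℝ × ℝ → ℝ} {h₀ : ℝ}
    (hF : ∀ θ ∈ Icc 0 (2 * Real.pi), ContDiffAt ℝ 2 F (θ, h₀, 0)) :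
    ∃ F₁ F₂ ρ, Regular F F₁ F₂ h₀ ρ := by
  set F₁ : ℝ × ℝ × ℝ → ℝ := fun p => fderiv ℝ F p (0, 1, 0)
  set F₂ : ℝ × ℝ × ℝ → ℝ := fun p => fderiv ℝ F₁ p (0, 1, 0)
  set U : Set (ℝ × ℝ × ℝ) := {p | ContDiffAt ℝ 2 F p}
  have hU' : ∀ p ∈ U, ContDiffAt ℝ 2 F p := fun p hp => hp
  have hU : IsOpen U := isOpen_iff_mem_nhds.2 fun p hp => ContDiffAt.eventually hp (by simp)
  have c1 : ∀ p ∈ U, ContDiffAt ℝ 1 F₁ p := fun p hp =>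
    ((hU' p hp).fderiv_right (m := 1) (by norm_num)).clm_apply contDiffAt_const
  have c2 : ∀ p ∈ U, ContDiffAt ℝ 0 F₂ p := fun p hp =>
    ((c1 p hp).fderiv_right (m := 0) (by norm_num)).clm_apply contDiffAt_const
  have hcurve : ∀ θ h ε : ℝ, HasDerivAt (fun h : ℝ => ((θ, h, ε) : ℝ × ℝ × ℝ)) (0, 1, 0) h :=
    fun θ h ε => (hasDerivAt_const h θ).prodMk ((hasDerivAt_id h).prodMk (hasDerivAt_const h ε))
  obtain ⟨u, v, hu, hv, hsu, hsv, huv⟩ := generalized_tube_lemma (s := Icc 0 (2 * Real.pi))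
    isCompact_Icc (t := {((h₀, 0) : ℝ × ℝ)}) isCompact_singleton hU (by
      rintro ⟨θ, q⟩ ⟨h1, h2⟩
      obtain rfl : q = (h₀, 0) := h2
      exact hF θ h1)
  obtain ⟨ρ, hρ, hsub⟩ := Metric.nhds_basis_closedBall.mem_iff.1
    (hv.mem_nhds (hsv (mem_singleton _)))
  have hbox : box h₀ ρ ⊆ U := by
    rintro ⟨θ, q⟩ ⟨h1, h2⟩
    refine huv ⟨hsu h1, hsub ?_⟩
    rw [← closedBall_prod_same]
    exact h2
  refine ⟨F₁, F₂, ρ, hρ, fun p hp => (hU' p (hbox hp)).continuousAt.continuousWithinAt,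
    fun p hp => (c1 p (hbox hp)).continuousAt.continuousWithinAt,
    fun p hp => (c2 p (hbox hp)).continuousAt.continuousWithinAt, fun θ h ε hp => ?_,
    fun θ h ε hp => ?_⟩
  · exact (((hU' _ (hbox hp)).differentiableAt (by norm_num)).hasFDerivAt).comp_hasDerivAt h
      (hcurve θ h ε)
  · exact (((c1 _ (hbox hp)).differentiableAt (by norm_num)).hasFDerivAt).comp_hasDerivAt h
      (hcurve θ h ε)

lemma exists_close {G : ℝ × ℝ × ℝ → ℝ} {h₀ ρ : ℝ} (hρ : 0 < ρ) (hG : ContinuousOn G (box h₀ ρ))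
    {η : ℝ} (hη : 0 < η) : ∃ δ, 0 < δ ∧ δ ≤ ρ ∧ ∀ θ h ε, (θ, h, ε) ∈ box h₀ δ →
      |G (θ, h, ε) - G (θ, h₀, 0)| < η := by
  obtain ⟨d, hd, hu⟩ := Metric.uniformContinuousOn_iff.1
    ((isCompact_box h₀ ρ).uniformContinuousOn_of_continuous hG) η hη
  refine ⟨min ρ (d / 2), by positivity, min_le_left _ _, fun θ h ε hp => ?_⟩
  have hp' := box_mono (min_le_left ρ (d / 2)) hp
  have h1 := hu (θ, h, ε) hp' (θ, h₀, 0) ⟨hp'.1, Metric.mem_closedBall_self hρ.le,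
    Metric.mem_closedBall_self hρ.le⟩ ?_
  · rwa [Real.dist_eq] at h1
  · have h2 : dist h h₀ ≤ min ρ (d / 2) := hp.2.1
    have h3 : dist ε 0 ≤ min ρ (d / 2) := hp.2.2
    have h4 := min_le_right ρ (d / 2)
    simp only [Prod.dist_eq, dist_self]
    refine max_lt hd (max_lt ?_ ?_) <;> linarith

namespace Regular

variable {F F₁ F₂ : ℝ × ℝ × ℝ → ℝ} {h₀ ρ : ℝ}

lemma hasDerivAt_integral (H : Regular F F₁ F₂ h₀ ρ) {h : ℝ} (hh : h ∈ Metric.ball h₀ ρ) :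
    HasDerivAt (fun h => ∫ θ in (0 : ℝ)..(2 * Real.pi), F (θ, h, 0))
      (∫ θ in (0 : ℝ)..(2 * Real.pi), F₁ (θ, h, 0)) h := by
  have h0 : (0 : ℝ) ∈ Metric.closedBall (0 : ℝ) ρ := Metric.mem_closedBall_self H.pos.le
  refine hasDerivAt_integral_param (f := fun h θ => F (θ, h, 0)) (f' := fun h θ => F₁ (θ, h, 0))
    Metric.isOpen_ball (by positivity) (fun h hh => ?_) ?_ (fun h hh θ hθ => ?_) hh
  · exact H.cont.comp (f := fun θ => ((θ, h, 0) : ℝ × ℝ × ℝ)) (by fun_prop)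
      fun θ hθ => ⟨hθ, Metric.ball_subset_closedBall hh, h0⟩
  · exact H.cont₁.comp (f := fun p : ℝ × ℝ => ((p.2, p.1, 0) : ℝ × ℝ × ℝ)) (by fun_prop)
      fun p hp => ⟨hp.2, Metric.ball_subset_closedBall hp.1, h0⟩
  · exact H.deriv _ _ _ ⟨hθ, Metric.ball_subset_closedBall hh, h0⟩

lemma hasDerivAt_integral₁ (H : Regular F F₁ F₂ h₀ ρ) :
    HasDerivAt (fun h => ∫ θ in (0 : ℝ)..(2 * Real.pi), F₁ (θ, h, 0))
      (∫ θ in (0 : ℝ)..(2 * Real.pi), F₂ (θ, h₀, 0)) h₀ := by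
  have h0 : (0 : ℝ) ∈ Metric.closedBall (0 : ℝ) ρ := Metric.mem_closedBall_self H.pos.le
  refine hasDerivAt_integral_param (f := fun h θ => F₁ (θ, h, 0)) (f' := fun h θ => F₂ (θ, h, 0))
    Metric.isOpen_ball (by positivity) (fun h hh => ?_) ?_ (fun h hh θ hθ => ?_)
    (Metric.mem_ball_self H.pos)
  · exact H.cont₁.comp (f := fun θ => ((θ, h, 0) : ℝ × ℝ × ℝ)) (by fun_prop)
      fun θ hθ => ⟨hθ, Metric.ball_subset_closedBall hh, h0⟩
  · exact H.cont₂.comp (f := fun p : ℝ × ℝ => ((p.2, p.1, 0) : ℝ × ℝ × ℝ)) (by fun_prop)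
      fun p hp => ⟨hp.2, Metric.ball_subset_closedBall hp.1, h0⟩
  · exact H.deriv₁ _ _ _ ⟨hθ, Metric.ball_subset_closedBall hh, h0⟩

end Regular

/-- A closed orbit in polar form: a `2π`-periodic solution of `dh/dθ = ε F(θ, h, ε)`. -/
structure PolarSol (F : ℝ × ℝ × ℝ → ℝ) (ε : ℝ) (h : ℝ → ℝ) : Prop where
  cont : Continuous h
  deriv : ∀ θ ∈ Ioo 0 (2 * Real.pi), HasDerivAt h (ε * F (θ, h θ, ε)) θ
  per : h (2 * Real.pi) = h 0

lemma abs_integral_le_of_close {g k : ℝ → ℝ} {η : ℝ} (hg : ContinuousOn g (Icc 0 (2 * Real.pi)))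
    (hk : ContinuousOn k (Icc 0 (2 * Real.pi)))
    (h0 : ∫ θ in (0 : ℝ)..(2 * Real.pi), g θ = 0)
    (h : ∀ θ ∈ Icc 0 (2 * Real.pi), |g θ - k θ| ≤ η) :
    |∫ θ in (0 : ℝ)..(2 * Real.pi), k θ| ≤ η * (2 * Real.pi) := by
  have hpi : (0 : ℝ) ≤ 2 * Real.pi := by positivity
  have ig : IntervalIntegrable g MeasureTheory.volume 0 (2 * Real.pi) :=
    ContinuousOn.intervalIntegrable (by rwa [uIcc_of_le hpi])
  have ik : IntervalIntegrable k MeasureTheory.volume 0 (2 * Real.pi) :=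
    ContinuousOn.intervalIntegrable (by rwa [uIcc_of_le hpi])
  have h1 : ‖∫ θ in (0 : ℝ)..(2 * Real.pi), (g θ - k θ)‖ ≤ η * |2 * Real.pi - 0| := by
    refine intervalIntegral.norm_integral_le_of_norm_le_const fun θ hθ => h θ ?_
    rw [uIoc_of_le hpi] at hθ
    exact Ioc_subset_Icc_self hθ
  rwa [intervalIntegral.integral_sub ig ik, h0, zero_sub, norm_neg, sub_zero, abs_of_nonneg hpi]
    at h1

namespace Regular

variable {F F₁ F₂ : ℝ × ℝ × ℝ → ℝ} {h₀ ρ : ℝ}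

lemma mem_box {h : ℝ → ℝ} {θ ε δ : ℝ} (hθ : θ ∈ Icc 0 (2 * Real.pi)) (hδ : |h θ - h₀| ≤ δ)
    (hε : 0 < ε) (hεδ : ε ≤ δ) : (θ, h θ, ε) ∈ box h₀ δ :=
  ⟨hθ, by rwa [Metric.mem_closedBall, Real.dist_eq], by
    rw [Metric.mem_closedBall, Real.dist_eq, sub_zero, abs_of_pos hε]; exact hεδ⟩

lemma continuousOn_comp (H : Regular F F₁ F₂ h₀ ρ) {ε : ℝ} {h : ℝ → ℝ} (hε : 0 < ε) (hερ : ε ≤ ρ)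
    (hc : Continuous h) (hn : ∀ θ ∈ Icc 0 (2 * Real.pi), |h θ - h₀| ≤ ρ) :
    ContinuousOn (fun θ => F (θ, h θ, ε)) (Icc 0 (2 * Real.pi)) :=
  H.cont.comp (f := fun θ => ((θ, h θ, ε) : ℝ × ℝ × ℝ)) (by fun_prop)
    fun θ hθ => mem_box hθ (hn θ hθ) hε hερ

/-- The divided difference is a value of the derivative. -/
lemma exists_slope (H : Regular F F₁ F₂ h₀ ρ) {θ ε h₁ h₂ δ : ℝ} (hδ : δ ≤ ρ) (hlt : h₁ < h₂)
    (m1 : (θ, h₁, ε) ∈ box h₀ δ) (m2 : (θ, h₂, ε) ∈ box h₀ δ) :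
    ∃ ξ ∈ Ioo h₁ h₂, (θ, ξ, ε) ∈ box h₀ δ ∧
      F₁ (θ, ξ, ε) = (F (θ, h₂, ε) - F (θ, h₁, ε)) / (h₂ - h₁) := by
  have hm : ∀ ξ ∈ Icc h₁ h₂, (θ, ξ, ε) ∈ box h₀ δ := fun ξ hξ => by
    refine ⟨m1.1, ?_, m1.2.2⟩
    have h1 : h₁ ∈ Metric.closedBall h₀ δ := m1.2.1
    have h2 : h₂ ∈ Metric.closedBall h₀ δ := m2.2.1
    rw [Real.closedBall_eq_Icc] at h1 h2
    show ξ ∈ Metric.closedBall h₀ δ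
    rw [Real.closedBall_eq_Icc]
    exact ⟨h1.1.trans hξ.1, hξ.2.trans h2.2⟩
  obtain ⟨ξ, hξ, he⟩ := exists_hasDerivAt_eq_slope (fun h => F (θ, h, ε)) (fun h => F₁ (θ, h, ε)) hlt
    (fun h hh => (H.deriv θ h ε (box_mono hδ (hm h hh))).continuousAt.continuousWithinAt)
    (fun h hh => H.deriv θ h ε (box_mono hδ (hm h (Ioo_subset_Icc_self hh))))
  exact ⟨ξ, hξ, hm ξ (Ioo_subset_Icc_self hξ), he⟩

lemma no_polarSol (H : Regular F F₁ F₂ h₀ ρ)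
    (hM : ∫ θ in (0 : ℝ)..(2 * Real.pi), F (θ, h₀, 0) ≠ 0) :
    ∃ δ > 0, ∀ ε, 0 < ε → ε < δ → ∀ h, PolarSol F ε h →
      (∀ θ ∈ Icc 0 (2 * Real.pi), |h θ - h₀| < δ) → False := by
  have hpi : (0 : ℝ) < 2 * Real.pi := by positivity
  set c := |∫ θ in (0 : ℝ)..(2 * Real.pi), F (θ, h₀, 0)|
  have hc : 0 < c := abs_pos.2 hM
  obtain ⟨δ, hδ, hδρ, hcl⟩ := exists_close H.pos H.cont (η := c / 2 / (2 * Real.pi)) (by positivity)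
  refine ⟨δ, hδ, fun ε hε hεδ h S hn => ?_⟩
  have cF := H.continuousOn_comp hε (hεδ.le.trans hδρ) S.cont fun θ hθ => (hn θ hθ).le.trans hδρ
  have c0 : ContinuousOn (fun θ => F (θ, h₀, 0)) (Icc 0 (2 * Real.pi)) :=
    H.cont.comp (f := fun θ => ((θ, h₀, 0) : ℝ × ℝ × ℝ)) (by fun_prop)
      fun θ hθ => ⟨hθ, Metric.mem_closedBall_self H.pos.le, Metric.mem_closedBall_self H.pos.le⟩
  have h1 := intervalIntegral.integral_eq_sub_of_hasDerivAt_of_le hpi.le S.cont.continuousOn S.deriv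
    (ContinuousOn.intervalIntegrable (by rw [uIcc_of_le hpi.le]; exact continuousOn_const.mul cF))
  rw [S.per, sub_self, intervalIntegral.integral_const_mul] at h1
  have h2 := abs_integral_le_of_close cF c0 ((mul_eq_zero.1 h1).resolve_left hε.ne')
    (fun θ hθ => (hcl θ (h θ) ε (mem_box hθ (hn θ hθ).le hε hεδ.le)).le)
  rw [div_mul_cancel₀ _ hpi.ne'] at h2
  linarith

/-- The logarithmic derivative of the distance between two solutions has zero mean. -/
lemma integral_slope (H : Regular F F₁ F₂ h₀ ρ) {ε : ℝ} {h₁ h₂ : ℝ → ℝ} (hε : 0 < ε) (hερ : ε ≤ ρ)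
    (S₁ : PolarSol F ε h₁) (S₂ : PolarSol F ε h₂)
    (n₁ : ∀ θ ∈ Icc 0 (2 * Real.pi), |h₁ θ - h₀| ≤ ρ)
    (n₂ : ∀ θ ∈ Icc 0 (2 * Real.pi), |h₂ θ - h₀| ≤ ρ)
    (hlt : ∀ θ ∈ Icc 0 (2 * Real.pi), h₁ θ < h₂ θ) :
    ContinuousOn (fun θ => (F (θ, h₂ θ, ε) - F (θ, h₁ θ, ε)) / (h₂ θ - h₁ θ))
      (Icc 0 (2 * Real.pi)) ∧
    (∀ t ∈ Icc 0 (2 * Real.pi),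
      ∫ θ in (0 : ℝ)..t, ε * ((F (θ, h₂ θ, ε) - F (θ, h₁ θ, ε)) / (h₂ θ - h₁ θ)) =
        Real.log (h₂ t - h₁ t) - Real.log (h₂ 0 - h₁ 0)) ∧
    ∫ θ in (0 : ℝ)..(2 * Real.pi), (F (θ, h₂ θ, ε) - F (θ, h₁ θ, ε)) / (h₂ θ - h₁ θ) = 0 := by
  have hpi : (0 : ℝ) < 2 * Real.pi := by positivity
  have hne : ∀ θ ∈ Icc 0 (2 * Real.pi), h₂ θ - h₁ θ ≠ 0 := fun θ hθ =>
    (sub_pos.2 (hlt θ hθ)).ne'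
  have cq : ContinuousOn (fun θ => (F (θ, h₂ θ, ε) - F (θ, h₁ θ, ε)) / (h₂ θ - h₁ θ))
      (Icc 0 (2 * Real.pi)) :=
    ((H.continuousOn_comp hε hερ S₂.cont n₂).sub (H.continuousOn_comp hε hερ S₁.cont n₁)).div
      (S₂.cont.sub S₁.cont).continuousOn hne
  have hlog : ∀ t ∈ Icc 0 (2 * Real.pi),
      ∫ θ in (0 : ℝ)..t, ε * ((F (θ, h₂ θ, ε) - F (θ, h₁ θ, ε)) / (h₂ θ - h₁ θ)) =
        Real.log (h₂ t - h₁ t) - Real.log (h₂ 0 - h₁ 0) := by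
    intro t ht
    have hsub : Icc 0 t ⊆ Icc 0 (2 * Real.pi) := Icc_subset_Icc_right ht.2
    refine intervalIntegral.integral_eq_sub_of_hasDerivAt_of_le
      (f := fun θ => Real.log (h₂ θ - h₁ θ)) ht.1
      (((S₂.cont.sub S₁.cont).continuousOn).log fun θ hθ => hne θ (hsub hθ)) (fun θ hθ => ?_)
      (ContinuousOn.intervalIntegrable (by
        rw [uIcc_of_le ht.1]; exact continuousOn_const.mul (cq.mono hsub)))
    have hθ' : θ ∈ Ioo 0 (2 * Real.pi) := ⟨hθ.1, hθ.2.trans_le ht.2⟩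
    refine (((S₂.deriv θ hθ').sub (S₁.deriv θ hθ')).log
      (hne θ (Ioo_subset_Icc_self hθ'))).congr_deriv ?_
    simp only [Pi.sub_apply]
    ring
  refine ⟨cq, hlog, ?_⟩
  have h1 := hlog (2 * Real.pi) (right_mem_Icc.2 hpi.le)
  rw [S₁.per, S₂.per, sub_self, intervalIntegral.integral_const_mul] at h1
  exact (mul_eq_zero.1 h1).resolve_left hε.ne'

lemma no_two_polarSol (H : Regular F F₁ F₂ h₀ ρ)
    (hM : ∫ θ in (0 : ℝ)..(2 * Real.pi), F₁ (θ, h₀, 0) ≠ 0) :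
    ∃ δ > 0, ∀ ε, 0 < ε → ε < δ → ∀ h₁ h₂, PolarSol F ε h₁ → PolarSol F ε h₂ →
      (∀ θ ∈ Icc 0 (2 * Real.pi), |h₁ θ - h₀| < δ) →
      (∀ θ ∈ Icc 0 (2 * Real.pi), |h₂ θ - h₀| < δ) →
      (∀ θ ∈ Icc 0 (2 * Real.pi), h₁ θ < h₂ θ) → False := by
  have hpi : (0 : ℝ) < 2 * Real.pi := by positivity
  set c := |∫ θ in (0 : ℝ)..(2 * Real.pi), F₁ (θ, h₀, 0)|
  have hc : 0 < c := abs_pos.2 hM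
  obtain ⟨δ, hδ, hδρ, hcl⟩ := exists_close H.pos H.cont₁ (η := c / 2 / (2 * Real.pi))
    (by positivity)
  refine ⟨δ, hδ, fun ε hε hεδ h₁ h₂ S₁ S₂ n₁ n₂ hlt => ?_⟩
  obtain ⟨cq, -, hz⟩ := H.integral_slope hε (hεδ.le.trans hδρ) S₁ S₂
    (fun θ hθ => (n₁ θ hθ).le.trans hδρ) (fun θ hθ => (n₂ θ hθ).le.trans hδρ) hlt
  have c0 : ContinuousOn (fun θ => F₁ (θ, h₀, 0)) (Icc 0 (2 * Real.pi)) :=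
    H.cont₁.comp (f := fun θ => ((θ, h₀, 0) : ℝ × ℝ × ℝ)) (by fun_prop)
      fun θ hθ => ⟨hθ, Metric.mem_closedBall_self H.pos.le, Metric.mem_closedBall_self H.pos.le⟩
  have h2 := abs_integral_le_of_close cq c0 hz (η := c / 2 / (2 * Real.pi)) (fun θ hθ => by
    obtain ⟨ξ, -, hb, he⟩ := H.exists_slope hδρ (hlt θ hθ) (mem_box hθ (n₁ θ hθ).le hε hεδ.le)
      (mem_box hθ (n₂ θ hθ).le hε hεδ.le)
    rw [← he]
    exact (hcl _ _ _ hb).le)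
  rw [div_mul_cancel₀ _ hpi.ne'] at h2
  linarith

lemma abs_slope_sub_slope_le (H : Regular F F₁ F₂ h₀ ρ) {θ ε h₁ h₂ h₃ δ η : ℝ} (hδ : δ ≤ ρ)
    (hcl : ∀ θ h ε, (θ, h, ε) ∈ box h₀ δ → |F₂ (θ, h, ε) - F₂ (θ, h₀, 0)| < η)
    (h12 : h₁ < h₂) (h23 : h₂ < h₃) (m1 : (θ, h₁, ε) ∈ box h₀ δ)
    (m3 : (θ, h₃, ε) ∈ box h₀ δ) :
    |(F (θ, h₃, ε) - F (θ, h₂, ε)) / (h₃ - h₂) - (F (θ, h₂, ε) - F (θ, h₁, ε)) / (h₂ - h₁) -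
      F₂ (θ, h₀, 0) / 2 * (h₃ - h₁)| ≤ η * (h₃ - h₁) := by
  set k := F₂ (θ, h₀, 0)
  have hm : ∀ ξ ∈ Icc h₁ h₃, (θ, ξ, ε) ∈ box h₀ δ := fun ξ hξ => by
    refine ⟨m1.1, ?_, m1.2.2⟩
    have h1 : h₁ ∈ Metric.closedBall h₀ δ := m1.2.1
    have h2 : h₃ ∈ Metric.closedBall h₀ δ := m3.2.1
    rw [Real.closedBall_eq_Icc] at h1 h2
    show ξ ∈ Metric.closedBall h₀ δ
    rw [Real.closedBall_eq_Icc]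
    exact ⟨h1.1.trans hξ.1, hξ.2.trans h2.2⟩
  have hd : ∀ h ∈ Icc h₁ h₃, HasDerivAt (fun h => F (θ, h, ε) - k / 2 * h ^ 2)
      (F₁ (θ, h, ε) - k * h) h := fun h hh =>
    ((H.deriv θ h ε (box_mono hδ (hm h hh))).sub
      (((hasDerivAt_id h).pow 2).const_mul (k / 2))).congr_deriv (by simp; ring)
  have hd1 : ∀ h ∈ Icc h₁ h₃, HasDerivAt (fun h => F₁ (θ, h, ε) - k * h)
      (F₂ (θ, h, ε) - k * 1) h := fun h hh =>
    (H.deriv₁ θ h ε (box_mono hδ (hm h hh))).sub ((hasDerivAt_id h).const_mul k)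
  have mvt : ∀ {u w : ℝ}, h₁ ≤ u → w ≤ h₃ → u < w → ∃ ξ ∈ Ioo u w,
      F₁ (θ, ξ, ε) - k * ξ = (F (θ, w, ε) - F (θ, u, ε)) / (w - u) - k / 2 * (w + u) := by
    intro u w hu hw huw
    obtain ⟨ξ, hξ, he⟩ := exists_hasDerivAt_eq_slope (fun h => F (θ, h, ε) - k / 2 * h ^ 2)
      (fun h => F₁ (θ, h, ε) - k * h) huw
      (fun h hh => (hd h ⟨hu.trans hh.1, hh.2.trans hw⟩).continuousAt.continuousWithinAt)
      (fun h hh => hd h ⟨hu.trans hh.1.le, hh.2.le.trans hw⟩)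
    refine ⟨ξ, hξ, ?_⟩
    rw [he]
    have : w - u ≠ 0 := (sub_pos.2 huw).ne'
    field_simp
    ring
  obtain ⟨ξ₁, hξ₁, e₁⟩ := mvt le_rfl h23.le h12
  obtain ⟨ξ₂, hξ₂, e₂⟩ := mvt h12.le le_rfl h23
  obtain ⟨ζ, hζ, e₃⟩ := exists_hasDerivAt_eq_slope (fun h => F₁ (θ, h, ε) - k * h)
      (fun h => F₂ (θ, h, ε) - k * 1) (hξ₁.2.trans hξ₂.1)
      (fun h hh => (hd1 h ⟨hξ₁.1.le.trans hh.1, hh.2.trans hξ₂.2.le⟩).continuousAt.continuousWithinAt)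
      (fun h hh => hd1 h ⟨hξ₁.1.le.trans hh.1.le, hh.2.le.trans hξ₂.2.le⟩)
  have hpos : 0 < ξ₂ - ξ₁ := by linarith [hξ₁.2, hξ₂.1]
  have hη := hcl θ ζ ε (hm ζ ⟨hξ₁.1.le.trans hζ.1.le, hζ.2.le.trans hξ₂.2.le⟩)
  rw [eq_div_iff hpos.ne', e₁, e₂, mul_one] at e₃
  have e₄ : (F (θ, h₃, ε) - F (θ, h₂, ε)) / (h₃ - h₂) -
      (F (θ, h₂, ε) - F (θ, h₁, ε)) / (h₂ - h₁) - k / 2 * (h₃ - h₁) =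
      (F₂ (θ, ζ, ε) - k) * (ξ₂ - ξ₁) := by
    rw [e₃]; ring
  rw [e₄, abs_mul, abs_of_pos hpos]
  exact mul_le_mul hη.le (by linarith [hξ₁.1, hξ₂.2]) hpos.le ((abs_nonneg _).trans hη.le)

lemma no_three_polarSol (H : Regular F F₁ F₂ h₀ ρ)
    (hM : ∫ θ in (0 : ℝ)..(2 * Real.pi), F₂ (θ, h₀, 0) ≠ 0) :
    ∃ δ > 0, ∀ ε, 0 < ε → ε < δ → ∀ h₁ h₂ h₃, PolarSol F ε h₁ → PolarSol F ε h₂ →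
      PolarSol F ε h₃ →
      (∀ θ ∈ Icc 0 (2 * Real.pi), |h₁ θ - h₀| < δ) →
      (∀ θ ∈ Icc 0 (2 * Real.pi), |h₂ θ - h₀| < δ) →
      (∀ θ ∈ Icc 0 (2 * Real.pi), |h₃ θ - h₀| < δ) →
      (∀ θ ∈ Icc 0 (2 * Real.pi), h₁ θ < h₂ θ) →
      (∀ θ ∈ Icc 0 (2 * Real.pi), h₂ θ < h₃ θ) → False := by
  have hpi : (0 : ℝ) < 2 * Real.pi := by positivity
  set c := |∫ θ in (0 : ℝ)..(2 * Real.pi), F₂ (θ, h₀, 0)|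
  have hc : 0 < c := abs_pos.2 hM
  obtain ⟨Λ₀, hΛ₀⟩ := (isCompact_box h₀ ρ).exists_bound_of_continuousOn H.cont₁
  obtain ⟨B₀, hB₀⟩ := (isCompact_box h₀ ρ).exists_bound_of_continuousOn H.cont₂
  set Λ := |Λ₀| + 1
  set B := |B₀| + 1
  have hΛ : 0 < Λ := by positivity
  have hB : 0 < B := by positivity
  obtain ⟨δ₀, hδ₀, hδρ₀, hcl⟩ := exists_close H.pos H.cont₂ (η := c / 24 / (2 * Real.pi))
    (by positivity)
  set η := c / 24 / (2 * Real.pi)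
  have hη : 0 < η := by positivity
  set κ := min 1 (η / B)
  have hκ : 0 < κ := by positivity
  set δ := min δ₀ (κ / (Λ * (2 * Real.pi)))
  have hδ : 0 < δ := by positivity
  have hδδ₀ : δ ≤ δ₀ := min_le_left _ _
  have hδρ : δ ≤ ρ := hδδ₀.trans hδρ₀
  refine ⟨δ, hδ, fun ε hε hεδ h₁ h₂ h₃ S₁ S₂ S₃ n₁ n₂ n₃ h12 h23 => ?_⟩
  have h13 : ∀ θ ∈ Icc 0 (2 * Real.pi), h₁ θ < h₃ θ := fun θ hθ => (h12 θ hθ).trans (h23 θ hθ)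
  have hερ := hεδ.le.trans hδρ
  have n : ∀ {h : ℝ → ℝ}, (∀ θ ∈ Icc 0 (2 * Real.pi), |h θ - h₀| < δ) →
    ∀ θ ∈ Icc 0 (2 * Real.pi), |h θ - h₀| ≤ ρ := fun hn θ hθ => (hn θ hθ).le.trans hδρ
  obtain ⟨c12, -, z12⟩ := H.integral_slope hε hερ S₁ S₂ (n n₁) (n n₂) h12
  obtain ⟨c23, -, z23⟩ := H.integral_slope hε hερ S₂ S₃ (n n₂) (n n₃) h23
  obtain ⟨c13, l13, -⟩ := H.integral_slope hε hερ S₁ S₃ (n n₁) (n n₃) h13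
  have hκε : ε * Λ * (2 * Real.pi) ≤ κ := by
    have h1 : ε ≤ κ / (Λ * (2 * Real.pi)) := hεδ.le.trans (min_le_right _ _)
    rw [le_div_iff₀ (by positivity)] at h1
    linarith
  have D0 : 0 < h₃ 0 - h₁ 0 := sub_pos.2 (h13 0 (left_mem_Icc.2 hpi.le))
  have ratio : ∀ θ ∈ Icc 0 (2 * Real.pi), |(h₃ θ - h₁ θ) / (h₃ 0 - h₁ 0) - 1| ≤ 2 * κ := by
    intro t ht
    have hD : 0 < h₃ t - h₁ t := sub_pos.2 (h13 t ht)
    have hb : ‖∫ θ in (0 : ℝ)..t, ε * ((F (θ, h₃ θ, ε) - F (θ, h₁ θ, ε)) / (h₃ θ - h₁ θ))‖ ≤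
        ε * Λ * |t - 0| := by
      refine intervalIntegral.norm_integral_le_of_norm_le_const fun θ hθ => ?_
      rw [uIoc_of_le ht.1] at hθ
      have hθ' : θ ∈ Icc 0 (2 * Real.pi) := ⟨hθ.1.le, hθ.2.trans ht.2⟩
      obtain ⟨ξ, -, hb, he⟩ := H.exists_slope hδρ (h13 θ hθ')
        (mem_box hθ' (n₁ θ hθ').le hε hεδ.le) (mem_box hθ' (n₃ θ hθ').le hε hεδ.le)
      rw [← he, norm_mul, Real.norm_eq_abs, abs_of_pos hε]
      have h5 := hΛ₀ _ (box_mono hδρ hb)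
      exact mul_le_mul_of_nonneg_left (by linarith [le_abs_self Λ₀]) hε.le
    rw [l13 t ht, ← Real.log_div hD.ne' D0.ne', Real.norm_eq_abs, sub_zero, abs_of_nonneg ht.1] at hb
    have hb' : |Real.log ((h₃ t - h₁ t) / (h₃ 0 - h₁ 0))| ≤ κ :=
      hb.trans ((mul_le_mul_of_nonneg_left ht.2 (by positivity)).trans hκε)
    have h6 := Real.abs_exp_sub_one_le (x := Real.log ((h₃ t - h₁ t) / (h₃ 0 - h₁ 0)))
      (hb'.trans (min_le_left _ _))
    rw [Real.exp_log (by positivity)] at h6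
    linarith
  have c0 : ContinuousOn (fun θ => F₂ (θ, h₀, 0) / 2) (Icc 0 (2 * Real.pi)) :=
    (H.cont₂.comp (f := fun θ => ((θ, h₀, 0) : ℝ × ℝ × ℝ)) (by fun_prop)
      fun θ hθ => ⟨hθ, Metric.mem_closedBall_self H.pos.le,
        Metric.mem_closedBall_self H.pos.le⟩).div_const 2
  have ii : ∀ {g : ℝ → ℝ}, ContinuousOn g (Icc 0 (2 * Real.pi)) →
      IntervalIntegrable g MeasureTheory.volume 0 (2 * Real.pi) := fun hg =>
    ContinuousOn.intervalIntegrable (by rwa [uIcc_of_le hpi.le])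
  have h2 := abs_integral_le_of_close ((c23.sub c12).div_const (h₃ 0 - h₁ 0)) c0
    (by
      have h7 := intervalIntegral.integral_sub (ii c23) (ii c12)
      rw [z12, z23, sub_self] at h7
      rw [intervalIntegral.integral_div]
      simp only [Pi.sub_apply]
      rw [h7, zero_div]) (η := 5 * η) (fun θ hθ => by
    have h8 := H.abs_slope_sub_slope_le hδρ
      (fun θ h ε hp => hcl θ h ε (box_mono hδδ₀ hp)) (h12 θ hθ) (h23 θ hθ)
      (mem_box hθ (n₁ θ hθ).le hε hεδ.le) (mem_box hθ (n₃ θ hθ).le hε hεδ.le)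
    have h9 := ratio θ hθ
    have h10 : |F₂ (θ, h₀, 0)| ≤ B := by
      have := hB₀ (θ, h₀, 0) ⟨hθ, Metric.mem_closedBall_self H.pos.le,
        Metric.mem_closedBall_self H.pos.le⟩
      rw [Real.norm_eq_abs] at this
      linarith [le_abs_self B₀]
    have hκ1 : κ ≤ 1 := min_le_left _ _
    have hκB : B * κ ≤ η := by
      have := min_le_right 1 (η / B)
      rw [mul_comm, ← le_div_iff₀ hB]
      exact this
    simp only [Pi.sub_apply]
    set q := (F (θ, h₃ θ, ε) - F (θ, h₂ θ, ε)) / (h₃ θ - h₂ θ) -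
      (F (θ, h₂ θ, ε) - F (θ, h₁ θ, ε)) / (h₂ θ - h₁ θ)
    set k := F₂ (θ, h₀, 0)
    have e : q / (h₃ 0 - h₁ 0) - k / 2 = (q - k / 2 * (h₃ θ - h₁ θ)) / (h₃ 0 - h₁ 0) +
        k / 2 * ((h₃ θ - h₁ θ) / (h₃ 0 - h₁ 0) - 1) := by
      field_simp
      ring
    have e1 : |(q - k / 2 * (h₃ θ - h₁ θ)) / (h₃ 0 - h₁ 0)| ≤ 3 * η := by
      rw [abs_div, abs_of_pos D0]
      have : (h₃ θ - h₁ θ) / (h₃ 0 - h₁ 0) ≤ 3 := by linarith [(abs_le.1 h9).2]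
      rw [div_le_iff₀ D0] at this ⊢
      nlinarith
    have e2 : |k / 2 * ((h₃ θ - h₁ θ) / (h₃ 0 - h₁ 0) - 1)| ≤ η := by
      rw [abs_mul, abs_div, abs_of_pos (two_pos : (0 : ℝ) < 2)]
      calc |k| / 2 * |(h₃ θ - h₁ θ) / (h₃ 0 - h₁ 0) - 1| ≤ B / 2 * (2 * κ) := by gcongr
        _ = B * κ := by ring
        _ ≤ η := hκB
    rw [e]
    exact (abs_add_le _ _).trans (by linarith))
  rw [intervalIntegral.integral_div, abs_div, abs_of_pos (two_pos : (0 : ℝ) < 2)] at h2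
  have h11 : 5 * η * (2 * Real.pi) = 5 * c / 24 := by
    simp only [η]
    field_simp
  rw [h11] at h2
  linarith

end Regular

/-- Near a level where the averaged function has a zero of order at most two, the number of
disjoint closed orbits is bounded by that order. -/
theorem polarSol_count {F : ℝ × ℝ × ℝ → ℝ} {h₀ : ℝ}
    (hF : ∀ θ ∈ Icc 0 (2 * Real.pi), ContDiffAt ℝ 2 F (θ, h₀, 0)) {M : ℝ → ℝ}
    (hM : ∀ᶠ h in 𝓝 h₀, M h = ∫ θ in (0 : ℝ)..(2 * Real.pi), F (θ, h, 0)) :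
    (M h₀ ≠ 0 → ∃ δ > 0, ∀ ε, 0 < ε → ε < δ → ∀ h, PolarSol F ε h →
      (∀ θ ∈ Icc 0 (2 * Real.pi), |h θ - h₀| < δ) → False) ∧
    (∀ m, HasDerivAt M m h₀ → m ≠ 0 →
      ∃ δ > 0, ∀ ε, 0 < ε → ε < δ → ∀ h₁ h₂, PolarSol F ε h₁ → PolarSol F ε h₂ →
        (∀ θ ∈ Icc 0 (2 * Real.pi), |h₁ θ - h₀| < δ) →
        (∀ θ ∈ Icc 0 (2 * Real.pi), |h₂ θ - h₀| < δ) →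
        (∀ θ ∈ Icc 0 (2 * Real.pi), h₁ θ < h₂ θ) → False) ∧
    (∀ (M' : ℝ → ℝ) m, (∀ᶠ h in 𝓝 h₀, HasDerivAt M (M' h) h) → HasDerivAt M' m h₀ → m ≠ 0 →
      ∃ δ > 0, ∀ ε, 0 < ε → ε < δ → ∀ h₁ h₂ h₃, PolarSol F ε h₁ → PolarSol F ε h₂ →
        PolarSol F ε h₃ →
        (∀ θ ∈ Icc 0 (2 * Real.pi), |h₁ θ - h₀| < δ) →
        (∀ θ ∈ Icc 0 (2 * Real.pi), |h₂ θ - h₀| < δ) →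
        (∀ θ ∈ Icc 0 (2 * Real.pi), |h₃ θ - h₀| < δ) →
        (∀ θ ∈ Icc 0 (2 * Real.pi), h₁ θ < h₂ θ) →
        (∀ θ ∈ Icc 0 (2 * Real.pi), h₂ θ < h₃ θ) → False) := by
  obtain ⟨F₁, F₂, ρ, H⟩ := exists_regular hF
  have hball : ∀ᶠ h in 𝓝 h₀, h ∈ Metric.ball h₀ ρ := Metric.ball_mem_nhds h₀ H.pos
  refine ⟨fun h => H.no_polarSol (by rwa [← hM.self_of_nhds]), fun m hm hne => ?_,
    fun M' m hM' hm hne => ?_⟩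
  · refine H.no_two_polarSol ?_
    have := (H.hasDerivAt_integral hball.self_of_nhds).congr_of_eventuallyEq hM
    rwa [← hm.unique this]
  · refine H.no_three_polarSol ?_
    have h1 : M' =ᶠ[𝓝 h₀] fun h => ∫ θ in (0 : ℝ)..(2 * Real.pi), F₁ (θ, h, 0) := by
      filter_upwards [hM.eventually_nhds, hM', hball] with h e1 e2 e3
      exact e2.unique ((H.hasDerivAt_integral e3).congr_of_eventuallyEq e1)
    rwa [← hm.unique (H.hasDerivAt_integral₁.congr_of_eventuallyEq h1)]

/-! ### Angular variable along a loop -/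

lemma exists_angle {ε a b : ℝ} {x y : ℝ → ℝ} {τ T : ℝ} (L : Loop ε a b x y τ T) {u u' y' : ℝ → ℝ}
    (hu : ∀ t, HasDerivAt u (u' t) t) (hy : ∀ t, HasDerivAt y (y' t) t) (cu' : Continuous u')
    (cy' : Continuous y') (hu0 : u 0 < 0)
    (hr : ∀ t, 0 < u t ^ 2 + y t ^ 2) (hω : ∀ t, 0 < y t * u' t - u t * y' t) :
    ∃ φ : ℝ → ℝ, φ 0 = 0 ∧ φ T = 2 * Real.pi ∧
      (∀ t, HasDerivAt φ ((y t * u' t - u t * y' t) / (u t ^ 2 + y t ^ 2)) t) ∧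
      (∀ t, u t = -(√(u t ^ 2 + y t ^ 2) * Real.cos (φ t))) ∧
      ∀ t, y t = √(u t ^ 2 + y t ^ 2) * Real.sin (φ t) := by
  have cu : Continuous u := continuous_iff_continuousAt.2 fun t => (hu t).continuousAt
  have cy : Continuous y := continuous_iff_continuousAt.2 fun t => (hy t).continuousAt
  have cω : Continuous fun t => (y t * u' t - u t * y' t) / (u t ^ 2 + y t ^ 2) :=
    ((cy.mul cu').sub (cu.mul cy')).div ((cu.pow 2).add (cy.pow 2)) fun t => (hr t).ne'
  set ω : ℝ → ℝ := fun t => (y t * u' t - u t * y' t) / (u t ^ 2 + y t ^ 2) with hωd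
  have ωpos : ∀ t, 0 < ω t := fun t => div_pos (hω t) (hr t)
  set φ : ℝ → ℝ := fun t => ∫ s in (0 : ℝ)..t, ω s with hφd
  have hφ : ∀ t, HasDerivAt φ (ω t) t := fun t =>
    intervalIntegral.integral_hasDerivAt_right (cω.intervalIntegrable _ _)
      (cω.stronglyMeasurableAtFilter _ _) cω.continuousAt
  have φ0 : φ 0 = 0 := by simp [hφd]
  have hR : ∀ t, HasDerivAt (fun t => √(u t ^ 2 + y t ^ 2))
      ((u t * u' t + y t * y' t) / √(u t ^ 2 + y t ^ 2)) t := fun t =>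
    ((((hu t).pow 2).add ((hy t).pow 2)).sqrt (hr t).ne').congr_deriv (by
      have := Real.sqrt_pos.2 (hr t)
      simp; field_simp)
  have Rpos : ∀ t, 0 < √(u t ^ 2 + y t ^ 2) := fun t => Real.sqrt_pos.2 (hr t)
  have Rsq : ∀ t, √(u t ^ 2 + y t ^ 2) ^ 2 = u t ^ 2 + y t ^ 2 := fun t => Real.sq_sqrt (hr t).le
  set R : ℝ → ℝ := fun t => √(u t ^ 2 + y t ^ 2) with hRd
  have ωR : ∀ t, ω t * R t ^ 2 = y t * u' t - u t * y' t := fun t => by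
    rw [show R t ^ 2 = _ from Rsq t]; exact div_mul_cancel₀ _ (hr t).ne'
  have hA : ∀ t, HasDerivAt (fun t => (-u t * Real.cos (φ t) + y t * Real.sin (φ t)) / R t) 0 t := by
    intro t
    have := (((hu t).neg.mul (hφ t).cos).add ((hy t).mul (hφ t).sin)).div (hR t) (Rpos t).ne'
    refine this.congr_deriv ?_
    have h1 := Rpos t
    have h2 := Rsq t
    have h3 := ωR t
    simp only [Pi.add_apply, Pi.mul_apply, Pi.neg_apply]
    rw [div_eq_zero_iff]; left
    have h4 : ((-u' t * Real.cos (φ t) + -u t * (-Real.sin (φ t) * ω t) +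
        (y' t * Real.sin (φ t) + y t * (Real.cos (φ t) * ω t))) * R t -
        (-u t * Real.cos (φ t) + y t * Real.sin (φ t)) * ((u t * u' t + y t * y' t) / R t)) * R t = 0 := by
      have e : ((-u' t * Real.cos (φ t) + -u t * (-Real.sin (φ t) * ω t) +
        (y' t * Real.sin (φ t) + y t * (Real.cos (φ t) * ω t))) * R t -
        (-u t * Real.cos (φ t) + y t * Real.sin (φ t)) * ((u t * u' t + y t * y' t) / R t)) * R t =
        (-u' t * Real.cos (φ t) + y' t * Real.sin (φ t)) * R t ^ 2 +
          (u t * Real.sin (φ t) + y t * Real.cos (φ t)) * (ω t * R t ^ 2) -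
          (-u t * Real.cos (φ t) + y t * Real.sin (φ t)) * (u t * u' t + y t * y' t) := by
        have h1' : R t ≠ 0 := h1.ne'
        field_simp; ring
      rw [e, h3, show R t ^ 2 = _ from h2]; ring
    exact (mul_eq_zero.1 h4).resolve_right h1.ne'
  have hB : ∀ t, HasDerivAt (fun t => (u t * Real.sin (φ t) + y t * Real.cos (φ t)) / R t) 0 t := by
    intro t
    have := (((hu t).mul (hφ t).sin).add ((hy t).mul (hφ t).cos)).div (hR t) (Rpos t).ne'
    refine this.congr_deriv ?_
    have h1 := Rpos t
    have h2 := Rsq t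
    have h3 := ωR t
    simp only [Pi.add_apply, Pi.mul_apply]
    rw [div_eq_zero_iff]; left
    have h4 : ((u' t * Real.sin (φ t) + u t * (Real.cos (φ t) * ω t) +
        (y' t * Real.cos (φ t) + y t * (-Real.sin (φ t) * ω t))) * R t -
        (u t * Real.sin (φ t) + y t * Real.cos (φ t)) * ((u t * u' t + y t * y' t) / R t)) * R t = 0 := by
      have e : ((u' t * Real.sin (φ t) + u t * (Real.cos (φ t) * ω t) +
        (y' t * Real.cos (φ t) + y t * (-Real.sin (φ t) * ω t))) * R t -
        (u t * Real.sin (φ t) + y t * Real.cos (φ t)) * ((u t * u' t + y t * y' t) / R t)) * R t =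
        (u' t * Real.sin (φ t) + y' t * Real.cos (φ t)) * R t ^ 2 +
          (u t * Real.cos (φ t) - y t * Real.sin (φ t)) * (ω t * R t ^ 2) -
          (u t * Real.sin (φ t) + y t * Real.cos (φ t)) * (u t * u' t + y t * y' t) := by
        have h1' : R t ≠ 0 := h1.ne'
        field_simp; ring
      rw [e, h3, show R t ^ 2 = _ from h2]; ring
    exact (mul_eq_zero.1 h4).resolve_right h1.ne'
  have R0 : R 0 = -u 0 := by
    simp only [hRd, L.y_zero]
    rw [show u 0 ^ 2 + 0 ^ 2 = (-u 0) ^ 2 by ring]; exact Real.sqrt_sq (by linarith)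
  have A1 : ∀ t, -u t * Real.cos (φ t) + y t * Real.sin (φ t) = R t := by
    intro t
    have := is_const_of_deriv_eq_zero (fun t => (hA t).differentiableAt) (fun t => (hA t).deriv) t 0
    rw [φ0, L.y_zero, R0, Real.cos_zero, mul_one, zero_mul, add_zero, div_self (by linarith)] at this
    rwa [div_eq_one_iff_eq (Rpos t).ne'] at this
  have B0 : ∀ t, u t * Real.sin (φ t) + y t * Real.cos (φ t) = 0 := by
    intro t
    have := is_const_of_deriv_eq_zero (fun t => (hB t).differentiableAt) (fun t => (hB t).deriv) t 0
    rw [φ0, L.y_zero, Real.sin_zero, mul_zero, zero_mul, add_zero, zero_div] at this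
    exact (div_eq_zero_iff.1 this).resolve_right (Rpos t).ne'
  have hU : ∀ t, u t = -(R t * Real.cos (φ t)) := fun t => by
    have h1 := A1 t; have h2 := B0 t; have h3 := Real.sin_sq_add_cos_sq (φ t)
    linear_combination (-Real.cos (φ t)) * h1 + Real.sin (φ t) * h2 - u t * h3
  have hY : ∀ t, y t = R t * Real.sin (φ t) := fun t => by
    have h1 := A1 t; have h2 := B0 t; have h3 := Real.sin_sq_add_cos_sq (φ t)
    linear_combination Real.sin (φ t) * h1 + Real.cos (φ t) * h2 - y t * h3
  have mono : StrictMono φ := strictMono_of_deriv_pos fun t => by rw [(hφ t).deriv]; exact ωpos t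
  have cφ : Continuous φ := continuous_iff_continuousAt.2 fun t => (hφ t).continuousAt
  have sin_zero : ∀ t, y t = 0 → Real.sin (φ t) = 0 := fun t h => by
    rw [hY t] at h; exact (mul_eq_zero.1 h).resolve_left (Rpos t).ne'
  have φτ0 : 0 < φ τ := φ0 ▸ mono L.τ_pos
  have φτ : φ τ = Real.pi := by
    have le : φ τ ≤ Real.pi := by
      by_contra! hlt
      obtain ⟨t, ht, e⟩ := intermediate_value_Ioo L.τ_pos.le cφ.continuousOn
        (show Real.pi ∈ Ioo (φ 0) (φ τ) from ⟨by rw [φ0]; exact Real.pi_pos, hlt⟩)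
      have := L.pos t ht
      rw [hY t, e, Real.sin_pi, mul_zero] at this
      exact this.false
    rcases le.lt_or_eq with h | h
    · exact absurd (sin_zero τ L.y_τ) (Real.sin_pos_of_pos_of_lt_pi φτ0 h).ne'
    · exact h
  have φTτ : Real.pi < φ T := φτ ▸ mono L.τ_lt
  have φT : φ T = 2 * Real.pi := by
    have le : φ T ≤ 2 * Real.pi := by
      by_contra! hlt
      obtain ⟨t, ht, e⟩ := intermediate_value_Ioo L.τ_lt.le cφ.continuousOn
        (show 2 * Real.pi ∈ Ioo (φ τ) (φ T) from ⟨by rw [φτ]; linarith [Real.pi_pos], hlt⟩)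
      have := L.neg t ht
      rw [hY t, e, Real.sin_two_pi, mul_zero] at this
      exact this.false
    rcases le.lt_or_eq with h | h
    · have h1 := Real.sin_pos_of_pos_of_lt_pi (sub_pos.2 φTτ) (by linarith)
      have yT : y T = 0 := by have := L.perY 0; rwa [zero_add, L.y_zero] at this
      rw [Real.sin_sub_pi, sin_zero T yT] at h1
      simp at h1
    · exact h
  exact ⟨φ, φ0, φT, hφ, hU, hY⟩

lemma PolarSol.of_angle {F : ℝ × ℝ × ℝ → ℝ} {ε T : ℝ} {φ ω ρ ρ' : ℝ → ℝ} (hT : 0 < T)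
    (φ0 : φ 0 = 0) (φT : φ T = 2 * Real.pi) (hφ : ∀ t, HasDerivAt φ (ω t) t) (hω : ∀ t, 0 < ω t)
    (hρ : ∀ t, HasDerivAt ρ (ρ' t) t) (hper : ρ T = ρ 0)
    (hF : ∀ t, ρ' t = ε * F (φ t, ρ t, ε) * ω t) :
    ∃ g : ℝ → ℝ, PolarSol F ε (ρ ∘ g) ∧ ∀ θ ∈ Icc 0 (2 * Real.pi), φ (g θ) = θ := by
  obtain ⟨-, g, gc, -, gl, gr, -, -, gd⟩ := exists_inverse hT hφ fun t _ => hω t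
  rw [φ0, φT] at gr gd
  have cρ : Continuous ρ := continuous_iff_continuousAt.2 fun t => (hρ t).continuousAt
  refine ⟨g, ⟨cρ.comp gc, fun θ hθ => ?_, ?_⟩, gr⟩
  · have h1 := (hρ (g θ)).comp θ (gd θ hθ).2
    refine h1.congr_deriv ?_
    rw [hF, gr θ (Ioo_subset_Icc_self hθ)]
    have := (hω (g θ)).ne'
    simp only [Function.comp]
    field_simp
  · have h1 := gl T ⟨hT.le, le_rfl⟩
    have h2 := gl 0 ⟨le_rfl, hT.le⟩
    rw [φT] at h1; rw [φ0] at h2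
    simp [h1, h2, hper]

/-! ### Families of cycles -/

lemma encard_le_two_of {α : Type*} {s : Set α}
    (h : ∀ p ∈ s, ∀ q ∈ s, ∀ r ∈ s, p ≠ q → p ≠ r → q ≠ r → False) : s.encard ≤ 2 := by
  by_contra hlt
  have h3 : (3 : ℕ∞) ≤ s.encard := by
    have := Order.add_one_le_of_lt (not_le.1 hlt)
    rwa [two_add_one_eq_three] at this
  obtain ⟨t, ht, h4⟩ := exists_subset_encard_eq h3
  obtain ⟨p, q, r, h5, h6, h7, rfl⟩ := encard_eq_three.1 h4
  exact h p (ht (by simp)) q (ht (by simp)) r (ht (by simp)) h5 h6 h7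

/-- Images of the closed orbits whose extreme abscissas `(α, β)` belong to `A`. -/
def family (ε a b : ℝ) (A : Set (ℝ × ℝ)) : Set (Set (ℝ × ℝ)) :=
  {Γ | ∃ C : Cycle ε a b, (C.α, C.β) ∈ A ∧ C.set = Γ}

lemma family_mono {ε a b : ℝ} {A B : Set (ℝ × ℝ)} (h : A ⊆ B) : family ε a b A ⊆ family ε a b B :=
  fun _ ⟨C, hC, e⟩ => ⟨C, h hC, e⟩

/-- For small `ε` there are at most `n` closed orbits with `(α, β) ∈ A`. -/
def Few (n : ℕ∞) (a b : ℝ) (A : Set (ℝ × ℝ)) : Prop :=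
  ∃ δ > 0, ∀ ε, 0 < ε → ε < δ → (family ε a b A).encard ≤ n

lemma Few.mono {n m : ℕ∞} {a b : ℝ} {A B : Set (ℝ × ℝ)} (h : Few n a b B) (hn : n ≤ m)
    (hA : A ⊆ B) : Few m a b A := by
  obtain ⟨δ, hδ, h⟩ := h
  exact ⟨δ, hδ, fun ε h0 h1 => (encard_le_encard (family_mono hA)).trans ((h ε h0 h1).trans hn)⟩

lemma Few.union {n m : ℕ∞} {a b : ℝ} {A B : Set (ℝ × ℝ)} (h : Few n a b A) (h' : Few m a b B) :
    Few (n + m) a b (A ∪ B) := by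
  obtain ⟨δ, hδ, h⟩ := h
  obtain ⟨δ', hδ', h'⟩ := h'
  refine ⟨min δ δ', lt_min hδ hδ', fun ε h0 h1 => ?_⟩
  have : family ε a b (A ∪ B) ⊆ family ε a b A ∪ family ε a b B := by
    rintro _ ⟨C, hC | hC, rfl⟩
    · exact Or.inl ⟨C, hC, rfl⟩
    · exact Or.inr ⟨C, hC, rfl⟩
  exact (encard_le_encard this).trans ((encard_union_le _ _).trans
    (add_le_add (h ε h0 (h1.trans_le (min_le_left _ _))) (h' ε h0 (h1.trans_le (min_le_right _ _)))))

lemma Few.zero {a b : ℝ} {A : Set (ℝ × ℝ)}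
    (h : ∃ δ > 0, ∀ ε, 0 < ε → ε < δ → ∀ C : Cycle ε a b, (C.α, C.β) ∈ A → False) :
    Few 0 a b A := by
  obtain ⟨δ, hδ, h⟩ := h
  refine ⟨δ, hδ, fun ε h0 h1 => ?_⟩
  rw [nonpos_iff_eq_zero, encard_eq_zero, eq_empty_iff_forall_notMem]
  rintro _ ⟨C, hC, -⟩
  exact h ε h0 h1 C hC

lemma Few.one {a b : ℝ} {A : Set (ℝ × ℝ)}
    (h : ∃ δ > 0, ∀ ε, 0 < ε → ε < δ → ∀ C₁ C₂ : Cycle ε a b, (C₁.α, C₁.β) ∈ A →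
      (C₂.α, C₂.β) ∈ A → C₁.set = C₂.set) : Few 1 a b A := by
  obtain ⟨δ, hδ, h⟩ := h
  refine ⟨δ, hδ, fun ε h0 h1 => encard_le_one_iff.2 ?_⟩
  rintro _ _ ⟨C₁, hC₁, rfl⟩ ⟨C₂, hC₂, rfl⟩
  exact h ε h0 h1 C₁ C₂ hC₁ hC₂

/-- The part of `A` of energy close to `e`. -/
def near (A : Set (ℝ × ℝ)) (e δ : ℝ) : Set (ℝ × ℝ) := {p | p ∈ A ∧ |pot p.1 - e| < δ}

/-- At most `n` closed orbits of type `A` bifurcate from the energy level `e`. -/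
def NearFew (n : ℕ∞) (a b : ℝ) (A : Set (ℝ × ℝ)) (e : ℝ) : Prop := ∃ δ > 0, Few n a b (near A e δ)

lemma Few.of_compact {n : ℕ} {a b : ℝ} {A : Set (ℝ × ℝ)} {K : Set ℝ} (hK : IsCompact K)
    {m : ℝ → ℕ} (hm : ∀ e ∈ K, NearFew (m e) a b A e)
    (hn : ∀ S : Finset ℝ, (S : Set ℝ) ⊆ K → ∑ e ∈ S, m e ≤ n) :
    Few n a b {p | p ∈ A ∧ pot p.1 ∈ K} := by
  classical
  choose! δ hδ hf using hm
  obtain ⟨S, hS, hcov⟩ := hK.elim_nhds_subcover (fun e => Metric.ball e (δ e))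
    fun e he => Metric.ball_mem_nhds e (hδ e he)
  have key : ∀ S' : Finset ℝ, (∀ e ∈ S', e ∈ K) →
      Few ((∑ e ∈ S', m e : ℕ)) a b {p | p ∈ A ∧ ∃ e ∈ S', pot p.1 ∈ Metric.ball e (δ e)} := by
    intro S'
    induction S' using Finset.induction_on with
    | empty => exact fun _ => Few.zero ⟨1, one_pos, fun _ _ _ C h => by simp at h⟩
    | insert e S' he ih =>
      intro hS'
      have h1 := (hf e (hS' e (by simp))).union (ih fun e' h => hS' e' (by simp [h]))
      rw [Finset.sum_insert he]
      refine h1.mono (by push_cast; exact le_rfl) ?_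
      rintro p ⟨hA, e', he', hb⟩
      rcases Finset.mem_insert.1 he' with rfl | h
      · exact Or.inl ⟨hA, by rwa [Metric.mem_ball, Real.dist_eq] at hb⟩
      · exact Or.inr ⟨hA, e', h, hb⟩
  refine (key S hS).mono (by exact_mod_cast hn S hS) ?_
  rintro p ⟨hA, hp⟩
  obtain ⟨e, he, hb⟩ := mem_iUnion₂.1 (hcov hp)
  exact ⟨hA, e, he, hb⟩

/-- Closed orbits of type `A` of energy close to `e` are the graphs, through the polar
parametrization `Φ`, of solutions of `dh/dθ = ε F` close to `h₀`. -/
def Lift (a b : ℝ) (A : Set (ℝ × ℝ)) (e h₀ : ℝ) (F : ℝ × ℝ × ℝ → ℝ) (Φ : ℝ → ℝ → ℝ × ℝ) : Prop :=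
  ∀ δ > 0, ∃ δ' > 0, ∀ ε, 0 < ε → ε < δ' → ∀ C : Cycle ε a b, (C.α, C.β) ∈ A →
    |pot C.α - e| < δ' → ∃ h, PolarSol F ε h ∧ (∀ θ ∈ Icc 0 (2 * Real.pi), |h θ - h₀| < δ) ∧
      ∀ θ ∈ Icc 0 (2 * Real.pi), Φ θ (h θ) ∈ C.set

namespace Lift

variable {a b : ℝ} {A : Set (ℝ × ℝ)} {e h₀ : ℝ} {F : ℝ × ℝ × ℝ → ℝ} {Φ : ℝ → ℝ → ℝ × ℝ}

lemma lt_or_lt {ε : ℝ} {C₁ C₂ : Cycle ε a b} (hne : C₁.set ≠ C₂.set) {h₁ h₂ : ℝ → ℝ}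
    (H₁ : PolarSol F ε h₁) (H₂ : PolarSol F ε h₂)
    (m₁ : ∀ θ ∈ Icc 0 (2 * Real.pi), Φ θ (h₁ θ) ∈ C₁.set)
    (m₂ : ∀ θ ∈ Icc 0 (2 * Real.pi), Φ θ (h₂ θ) ∈ C₂.set) :
    (h₁ 0 < h₂ 0 ∨ h₂ 0 < h₁ 0) ∧
    (h₁ 0 < h₂ 0 → ∀ θ ∈ Icc 0 (2 * Real.pi), h₁ θ < h₂ θ) := by
  have n : ∀ θ ∈ Icc 0 (2 * Real.pi), h₁ θ ≠ h₂ θ := fun θ hθ h =>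
    hne (Cycle.set_eq_of_mem (m₁ θ hθ) (h ▸ m₂ θ hθ))
  have h0 : (0 : ℝ) ∈ Icc 0 (2 * Real.pi) := ⟨le_rfl, by positivity⟩
  exact ⟨lt_or_gt_of_ne (n 0 h0), fun h => lt_of_continuous_ne H₁.cont H₂.cont h0 h n⟩

theorem count (L : Lift a b A e h₀ F Φ) (hF : ∀ θ ∈ Icc 0 (2 * Real.pi), ContDiffAt ℝ 2 F (θ, h₀, 0))
    {M : ℝ → ℝ} (hM : ∀ᶠ h in 𝓝 h₀, M h = ∫ θ in (0 : ℝ)..(2 * Real.pi), F (θ, h, 0)) :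
    (M h₀ ≠ 0 → NearFew 0 a b A e) ∧
    (∀ m, HasDerivAt M m h₀ → m ≠ 0 → NearFew 1 a b A e) ∧
    (∀ (M' : ℝ → ℝ) m, (∀ᶠ h in 𝓝 h₀, HasDerivAt M (M' h) h) → HasDerivAt M' m h₀ → m ≠ 0 →
      NearFew 2 a b A e) := by
  obtain ⟨c0, c1, c2⟩ := polarSol_count hF hM
  refine ⟨fun h => ?_, fun m hm h => ?_, fun M' m hM' hm h => ?_⟩
  · obtain ⟨δ, hδ, c⟩ := c0 h
    obtain ⟨δ', hδ', l⟩ := L δ hδ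
    refine ⟨δ', hδ', Few.zero ⟨min δ δ', lt_min hδ hδ', fun ε h0 h1 C hC => ?_⟩⟩
    obtain ⟨k, k1, k2, -⟩ := l ε h0 (h1.trans_le (min_le_right _ _)) C hC.1 hC.2
    exact c ε h0 (h1.trans_le (min_le_left _ _)) k k1 k2
  · obtain ⟨δ, hδ, c⟩ := c1 m hm h
    obtain ⟨δ', hδ', l⟩ := L δ hδ
    refine ⟨δ', hδ', Few.one ⟨min δ δ', lt_min hδ hδ', fun ε h0 h1 C D hC hD => ?_⟩⟩
    obtain ⟨k, k1, k2, k3⟩ := l ε h0 (h1.trans_le (min_le_right _ _)) C hC.1 hC.2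
    obtain ⟨j, j1, j2, j3⟩ := l ε h0 (h1.trans_le (min_le_right _ _)) D hD.1 hD.2
    by_contra hne
    have h3 := h1.trans_le (min_le_left _ _)
    rcases (lt_or_lt hne k1 j1 k3 j3).1 with hlt | hlt
    · exact c ε h0 h3 k j k1 j1 k2 j2 ((lt_or_lt hne k1 j1 k3 j3).2 hlt)
    · exact c ε h0 h3 j k j1 k1 j2 k2 ((lt_or_lt (Ne.symm hne) j1 k1 j3 k3).2 hlt)
  · obtain ⟨δ, hδ, c⟩ := c2 M' m hM' hm h
    obtain ⟨δ', hδ', l⟩ := L δ hδ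
    refine ⟨δ', hδ', min δ δ', lt_min hδ hδ', fun ε h0 h1 => encard_le_two_of ?_⟩
    rintro _ ⟨C, hC, rfl⟩ _ ⟨D, hD, rfl⟩ _ ⟨E, hE, rfl⟩ n1 n2 n3
    obtain ⟨k, k1, k2, k3⟩ := l ε h0 (h1.trans_le (min_le_right _ _)) C hC.1 hC.2
    obtain ⟨j, j1, j2, j3⟩ := l ε h0 (h1.trans_le (min_le_right _ _)) D hD.1 hD.2
    obtain ⟨i, i1, i2, i3⟩ := l ε h0 (h1.trans_le (min_le_right _ _)) E hE.1 hE.2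
    have h3 := h1.trans_le (min_le_left _ _)
    have kj := lt_or_lt n1 k1 j1 k3 j3
    have jk := lt_or_lt n1.symm j1 k1 j3 k3
    have ki := lt_or_lt n2 k1 i1 k3 i3
    have ik := lt_or_lt n2.symm i1 k1 i3 k3
    have ji := lt_or_lt n3 j1 i1 j3 i3
    have ij := lt_or_lt n3.symm i1 j1 i3 j3
    rcases kj.1 with a1 | a1 <;> rcases ki.1 with a2 | a2 <;> rcases ji.1 with a3 | a3
    · exact c ε h0 h3 k j i k1 j1 i1 k2 j2 i2 (kj.2 a1) (ji.2 a3)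
    · exact c ε h0 h3 k i j k1 i1 j1 k2 i2 j2 (ki.2 a2) (ij.2 a3)
    · linarith
    · exact c ε h0 h3 i k j i1 k1 j1 i2 k2 j2 (ik.2 a2) (kj.2 a1)
    · exact c ε h0 h3 j k i j1 k1 i1 j2 k2 i2 (jk.2 a1) (ki.2 a2)
    · linarith
    · exact c ε h0 h3 j i k j1 i1 k1 j2 i2 k2 (ji.2 a3) (ik.2 a2)
    · exact c ε h0 h3 i j k i1 j1 k1 i2 j2 k2 (ij.2 a3) (jk.2 a1)

end Lift

/-! ### Polar coordinates around a focus and around the figure eight -/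

lemma exists_energy (a b : ℝ) : ∃ K M : ℝ, 0 < K ∧ 0 < M ∧ ∀ ε, 0 < ε → ε ≤ 1 → ∀ C : Cycle ε a b,
    ∀ t, |C.y t ^ 2 / 2 + pot (C.x t) - pot C.α| ≤ K * ε ∧ |C.x t| ≤ M ∧ |C.y t| ≤ M := by
  obtain ⟨K, hK, h⟩ := exists_oscillation a b
  obtain ⟨M, hM, hb⟩ := exists_bound a b
  refine ⟨K, M, hK, hM, fun ε h0 h1 C t => ?_⟩
  have hp : Function.Periodic (fun t => (C.x t, C.y t)) C.T := fun t => by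
    simp [C.loop.perX t, C.loop.perY t]
  obtain ⟨s, hs, e⟩ := hp.exists_mem_Ico₀ (C.loop.τ_pos.trans C.loop.τ_lt) t
  simp only [Prod.mk.injEq] at e
  rw [e.1, e.2]
  obtain ⟨b1, b2, b3⟩ := hb ε h0 h1 C
  have hm := C.memIcc s
  refine ⟨?_, abs_le.2 ⟨by linarith [hm.1], by linarith [hm.2]⟩, ?_⟩
  · rcases le_total s C.τ with hs' | hs'
    · have := (h ε h0 h1 C _ hm).1
      rwa [C.eqY s ⟨hs.1, hs'⟩] at this
    · have := (h ε h0 h1 C _ hm).2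
      rwa [C.eqZ s ⟨hs', hs.2.le⟩, neg_sq] at this
  · rcases le_total s C.τ with hs' | hs'
    · rw [← C.eqY s ⟨hs.1, hs'⟩, abs_of_nonneg (C.up.nonneg _)]
      exact (b3 _).1
    · rw [← abs_neg, ← C.eqZ s ⟨hs', hs.2.le⟩, abs_of_nonneg (C.lo.nonneg _)]
      exact (b3 _).2

/-- Closed orbits around the right focus. -/
def typeR : Set (ℝ × ℝ) := {p | 0 < p.1}

/-- Closed orbits around the left focus. -/
def typeL : Set (ℝ × ℝ) := {p | p.2 < 0}

/-- Closed orbits around all three equilibria. -/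
def typeE : Set (ℝ × ℝ) := {p | p.1 < 0 ∧ 0 < p.2}

/-- The abscissa in polar form inside the right loop. -/
noncomputable def absR (θ r : ℝ) : ℝ := √(1 - √2 * r * Real.cos θ)

/-- The polar equation inside the right loop. -/
noncomputable def polarR (a b : ℝ) (p : ℝ × ℝ × ℝ) : ℝ :=
  (a + b * absR p.1 p.2.1 - absR p.1 p.2.1 ^ 2) * p.2.1 * Real.sin p.1 ^ 2 /
    (√2 * absR p.1 p.2.1 + p.2.2 * (a + b * absR p.1 p.2.1 - absR p.1 p.2.1 ^ 2) *
      Real.sin p.1 * Real.cos p.1)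

lemma abs_damping_le {x M : ℝ} (hx : |x| ≤ M) (a b : ℝ) :
    |a + b * x - x ^ 2| ≤ |a| + |b| * M + M ^ 2 := by
  have h5 : |b * x| ≤ |b| * M := by rw [abs_mul]; gcongr
  have h6 : x ^ 2 ≤ M ^ 2 := by rw [← sq_abs]; gcongr
  have h7 := abs_le.1 (le_refl |a|)
  have h8 := abs_le.1 h5
  rw [abs_le]; constructor <;> nlinarith [sq_nonneg x]

lemma abs_mul_le_half (u y : ℝ) : |u * y| ≤ (u ^ 2 + y ^ 2) / 2 := by
  rw [abs_le]; constructor <;> nlinarith [sq_nonneg (u + y), sq_nonneg (u - y)]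

lemma Cycle.exists_polarR {ε a b : ℝ} (C : Cycle ε a b) (hx0 : 0 < C.α) {V : ℝ} (h0 : 0 ≤ ε)
    (hv : ∀ t, |a + b * C.x t - C.x t ^ 2| ≤ V) (hV : ε * V < C.α)
    (hH : ∀ t, -1 / 4 < C.y t ^ 2 / 2 + pot (C.x t)) :
    ∃ h, PolarSol (polarR a b) ε h ∧ ∀ θ ∈ Icc 0 (2 * Real.pi), ∃ t,
      h θ = √(2 * (C.y t ^ 2 / 2 + pot (C.x t)) + 1 / 2) ∧
      (absR θ (h θ), h θ * Real.sin θ) = (C.x t, C.y t) := by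
  have q2 : √2 ^ 2 = 2 := Real.sq_sqrt (by norm_num)
  have q1 : 1 < √2 := Real.lt_sqrt_of_sq_lt (by norm_num)
  have hα1 : C.α < 1 := by
    by_contra! h; nlinarith [C.left, mul_nonneg hx0.le (by nlinarith : 0 ≤ C.α ^ 2 - 1)]
  have hx : ∀ t, C.α ≤ C.x t := fun t => (C.memIcc t).1
  have hxp : ∀ t, 0 < C.x t := fun t => hx0.trans_le (hx t)
  have hsol := C.loop.sol
  set v : ℝ → ℝ := fun t => a + b * C.x t - C.x t ^ 2
  set u : ℝ → ℝ := fun t => (C.x t ^ 2 - 1) / √2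
  have qu : ∀ t, √2 * u t = C.x t ^ 2 - 1 := fun t => mul_div_cancel₀ _ (by positivity)
  set u' : ℝ → ℝ := fun t => √2 * C.x t * C.y t
  set y' : ℝ → ℝ := fun t => C.x t - C.x t ^ 3 + ε * v t * C.y t
  have hu : ∀ t, HasDerivAt u (u' t) t := fun t =>
    ((((hsol.hx t).pow 2).sub_const 1).div_const √2).congr_deriv (by
      simp only [u']; field_simp; rw [q2]; ring)
  have hy : ∀ t, HasDerivAt C.y (y' t) t := hsol.hy
  have hR : ∀ t, u t ^ 2 + C.y t ^ 2 = 2 * (C.y t ^ 2 / 2 + pot (C.x t)) + 1 / 2 := fun t => by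
    simp only [u]; unfold pot; rw [div_pow, q2]; ring
  have hRp : ∀ t, 0 < u t ^ 2 + C.y t ^ 2 := fun t => by
    rw [hR]; linarith [hH t]
  have hW : ∀ t, C.y t * u' t - u t * y' t =
      √2 * C.x t * (u t ^ 2 + C.y t ^ 2) - ε * v t * (u t * C.y t) := fun t => by
    simp only [y', u']
    linear_combination -(C.x t * u t) * qu t
  have hWp : ∀ t, 0 < C.y t * u' t - u t * y' t := fun t => by
    rw [hW]
    have h5 : |ε * v t * (u t * C.y t)| ≤ ε * V * ((u t ^ 2 + C.y t ^ 2) / 2) := by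
      rw [abs_mul, abs_mul, abs_of_nonneg h0]
      exact mul_le_mul (mul_le_mul_of_nonneg_left (hv t) h0) (abs_mul_le_half _ _) (abs_nonneg _)
        (mul_nonneg h0 ((abs_nonneg _).trans (hv t)))
    have h6 := hRp t
    have h7 : C.α ≤ √2 * C.x t := by nlinarith [hx t]
    nlinarith [(abs_le.1 h5).2, mul_le_mul_of_nonneg_right h7 h6.le, mul_lt_mul_of_pos_right hV h6]
  have cx := hsol.contX
  have cy := hsol.contY
  obtain ⟨φ, φ0, φT, hφ, hU, hY⟩ := exists_angle C.loop hu hy (by fun_prop) (by fun_prop)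
    (by simp only [u]; rw [C.α_eq]; exact div_neg_of_neg_of_pos (by nlinarith) (by positivity)) hRp hWp
  have hRpos : ∀ t, 0 < √(u t ^ 2 + C.y t ^ 2) := fun t => Real.sqrt_pos.2 (hRp t)
  have hX : ∀ t, absR (φ t) √(u t ^ 2 + C.y t ^ 2) = C.x t := fun t => by
    rw [absR, show 1 - √2 * √(u t ^ 2 + C.y t ^ 2) * Real.cos (φ t) = C.x t ^ 2 by
      linear_combination qu t - √2 * hU t]
    exact Real.sqrt_sq (hxp t).le
  have hTp : 0 < C.T := C.loop.τ_pos.trans C.loop.τ_lt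
  have hρ : ∀ t, HasDerivAt (fun t => √(u t ^ 2 + C.y t ^ 2))
      (ε * v t * (√(u t ^ 2 + C.y t ^ 2) * Real.sin (φ t) ^ 2)) t := fun t =>
    ((((hu t).pow 2).add ((hy t).pow 2)).sqrt (hRp t).ne').congr_deriv (by
      have h5 := hRpos t
      have e1 : (2 : ℝ) * u t * u' t + 2 * C.y t * y' t = 2 * ε * v t * C.y t ^ 2 := by
        simp only [y', u']
        linear_combination 2 * C.x t * C.y t * qu t
      simp only [Pi.add_apply, Pi.pow_apply, Nat.cast_ofNat]
      rw [div_eq_iff (by positivity)]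
      have h6 := hY t
      generalize √(u t ^ 2 + C.y t ^ 2) = R at *
      simp only [Nat.add_one_sub_one, pow_one]
      rw [e1, h6]; ring)
  obtain ⟨g, hg, hφg⟩ := PolarSol.of_angle (F := polarR a b) (ε := ε) hTp φ0 φT hφ
    (fun t => div_pos (hWp t) (hRp t)) hρ
    (by
      have h5 := C.loop.perX 0; have h6 := C.loop.perY 0
      rw [zero_add] at h5 h6
      simp only [u, h5, h6]) (fun t => by
      have h5 := hRpos t
      have h9 : √(u t ^ 2 + C.y t ^ 2) ^ 2 = u t ^ 2 + C.y t ^ 2 := Real.sq_sqrt (hRp t).le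
      have e2 : (C.y t * u' t - u t * y' t) / (u t ^ 2 + C.y t ^ 2) =
          √2 * C.x t + ε * v t * Real.sin (φ t) * Real.cos (φ t) := by
        rw [div_eq_iff (hRp t).ne', hW]
        have h6 := hY t; have h7 := hU t
        linear_combination (-ε * v t * C.y t) * h7 +
          ε * v t * √(u t ^ 2 + C.y t ^ 2) * Real.cos (φ t) * h6 +
          ε * v t * Real.sin (φ t) * Real.cos (φ t) * h9
      have h8 := div_pos (hWp t) (hRp t)
      rw [e2] at h8 ⊢
      simp only [polarR, hX]
      change _ = ε * (v t * _ * _ / (_ + ε * v t * _ * _)) * _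
      field_simp)
  refine ⟨_, hg, fun θ hθ => ⟨g θ, ?_, ?_⟩⟩
  · simp only [Function.comp]
    rw [hR]
  · have h5 := hX (g θ); have h6 := hY (g θ)
    rw [hφg θ hθ] at h5 h6
    simp only [Function.comp]
    rw [h5, ← h6]

lemma liftR (a b : ℝ) {e : ℝ} (he : -1 / 4 < e) (he' : e < 0) :
    Lift a b typeR e √(2 * e + 1 / 2) (polarR a b)
      (fun θ r => (absR θ r, r * Real.sin θ)) := by
  intro δ hδ
  obtain ⟨K, M, hK, hM, hE⟩ := exists_energy a b
  obtain ⟨η, hη, hc⟩ := Metric.continuousAt_iff.1 ((by fun_prop :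
    Continuous fun h : ℝ => √(2 * h + 1 / 2)).continuousAt (x := e)) δ hδ
  set V := |a| + |b| * M + M ^ 2 + 1
  have hV : 0 < V := by positivity
  set d := min η (min (e + 1 / 4) (-e / 2))
  have hd : 0 < d := lt_min hη (lt_min (by linarith) (by linarith))
  set x₀ := √(-e)
  have hx₀ : 0 < x₀ := Real.sqrt_pos.2 (by linarith)
  refine ⟨min (d / 2) (min 1 (min (d / (2 * K)) (x₀ / (2 * V)))), by positivity, fun ε h0 h1 C hC hCe => ?_⟩
  simp only [lt_min_iff] at h1 hCe
  obtain ⟨-, h1, h2, h3⟩ := h1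
  rw [lt_div_iff₀ (by positivity)] at h2 h3
  have hEt : ∀ t, |C.y t ^ 2 / 2 + pot (C.x t) - e| < d := fun t => by
    have := (hE ε h0 h1.le C t).1
    have h4 := hCe.1
    rw [abs_lt] at h4 ⊢; rw [abs_le] at this
    constructor <;> nlinarith
  have hdη : d ≤ η := min_le_left _ _
  have hd1 : d ≤ e + 1 / 4 := (min_le_right _ _).trans (min_le_left _ _)
  have hd2 : d ≤ -e / 2 := (min_le_right _ _).trans (min_le_right _ _)
  have hα : 0 < C.α := hC
  have hx0 : x₀ ≤ C.α := by
    rw [Real.sqrt_le_left hα.le]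
    have := (abs_lt.1 hCe.1).2
    unfold pot at this
    nlinarith [sq_nonneg (C.α ^ 2)]
  obtain ⟨h, hh, hp⟩ := C.exists_polarR hα h0.le (V := V)
    (fun t => (abs_damping_le (hE ε h0 h1.le C t).2.1 a b).trans (by simp [V]))
    (by nlinarith) (fun t => by linarith [(abs_lt.1 (hEt t)).1])
  refine ⟨h, hh, fun θ hθ => ?_, fun θ hθ => ?_⟩
  · obtain ⟨t, h4, -⟩ := hp θ hθ
    have := hc (show dist (C.y t ^ 2 / 2 + pot (C.x t)) e < η by
      rw [Real.dist_eq]; exact (hEt _).trans_le hdη)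
    rw [h4]
    rwa [Real.dist_eq] at this
  · obtain ⟨t, -, h4⟩ := hp θ hθ
    exact ⟨t, h4.symm⟩

/-- The factor `sin² θ - cos² θ`. -/
noncomputable def sigma (θ : ℝ) : ℝ := Real.sin θ ^ 2 - Real.cos θ ^ 2

/-- The discriminant of the equation for the squared radius outside the double loop. -/
noncomputable def SE (θ h : ℝ) : ℝ := √(sigma θ ^ 2 + 4 * h * Real.cos θ ^ 4)

/-- The squared radius of the level curve of energy `h`. -/
noncomputable def PE (θ h : ℝ) : ℝ := 4 * h / (SE θ h + sigma θ)

/-- The abscissa in polar form outside the double loop. -/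
noncomputable def XE (θ h : ℝ) : ℝ := -(√(PE θ h) * Real.cos θ)

/-- The polar equation outside the double loop. -/
noncomputable def polarE (a b : ℝ) (p : ℝ × ℝ × ℝ) : ℝ :=
  (a + b * XE p.1 p.2.1 - XE p.1 p.2.1 ^ 2) * PE p.1 p.2.1 * Real.sin p.1 ^ 2 /
    (SE p.1 p.2.1 + p.2.2 * (a + b * XE p.1 p.2.1 - XE p.1 p.2.1 ^ 2) *
      Real.sin p.1 * Real.cos p.1)

lemma polarE_aux {θ P H : ℝ} (hP : 0 < P) (hH : 0 < H)
    (hPH : 4 * H = 2 * P * sigma θ + P ^ 2 * Real.cos θ ^ 4) :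
    SE θ H = sigma θ + P * Real.cos θ ^ 4 ∧ PE θ H = P := by
  have h1 : 0 < sigma θ + P * Real.cos θ ^ 4 := by
    have : 0 < P * (sigma θ + P * Real.cos θ ^ 4) := by
      nlinarith [mul_nonneg (sq_nonneg P) (by positivity : 0 ≤ Real.cos θ ^ 4)]
    exact (mul_pos_iff_of_pos_left hP).1 this
  have h2 : SE θ H = sigma θ + P * Real.cos θ ^ 4 := by
    rw [SE, show sigma θ ^ 2 + 4 * H * Real.cos θ ^ 4 = (sigma θ + P * Real.cos θ ^ 4) ^ 2 by
      rw [hPH]; ring]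
    exact Real.sqrt_sq h1.le
  refine ⟨h2, ?_⟩
  have h3 : P * (SE θ H + sigma θ) = 4 * H := by rw [h2, hPH]; ring
  have h4 : SE θ H + sigma θ ≠ 0 := by
    intro h; rw [h] at h3; linarith
  rw [PE, div_eq_iff h4, h3]

lemma Cycle.exists_polarE {ε a b : ℝ} (C : Cycle ε a b) (hα : C.α < 0)
    (hH : ∀ t, 0 < C.y t ^ 2 / 2 + pot (C.x t))
    (hWp : ∀ t, 0 < C.y t ^ 2 - C.x t ^ 2 + C.x t ^ 4 -
      ε * (a + b * C.x t - C.x t ^ 2) * (C.x t * C.y t)) :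
    ∃ h, PolarSol (polarE a b) ε h ∧ ∀ θ ∈ Icc 0 (2 * Real.pi), ∃ t,
      h θ = C.y t ^ 2 / 2 + pot (C.x t) ∧
      (XE θ (h θ), √(PE θ (h θ)) * Real.sin θ) = (C.x t, C.y t) := by
  have hsol := C.loop.sol
  set v : ℝ → ℝ := fun t => a + b * C.x t - C.x t ^ 2
  set y' : ℝ → ℝ := fun t => C.x t - C.x t ^ 3 + ε * v t * C.y t
  have hy : ∀ t, HasDerivAt C.y (y' t) t := hsol.hy
  set H : ℝ → ℝ := fun t => C.y t ^ 2 / 2 + pot (C.x t)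
  have hRp : ∀ t, 0 < C.x t ^ 2 + C.y t ^ 2 := fun t => by
    by_contra! h
    have h1 : C.x t ^ 2 = 0 := le_antisymm (by nlinarith [sq_nonneg (C.y t)]) (sq_nonneg _)
    have h2 : C.y t ^ 2 = 0 := le_antisymm (by nlinarith [sq_nonneg (C.x t)]) (sq_nonneg _)
    have := hH t
    unfold pot at this
    nlinarith
  have hW : ∀ t, C.y t * C.y t - C.x t * y' t = C.y t ^ 2 - C.x t ^ 2 + C.x t ^ 4 -
      ε * v t * (C.x t * C.y t) := fun t => by simp only [y']; ring
  have hWp' : ∀ t, 0 < C.y t * C.y t - C.x t * y' t := fun t => by rw [hW]; exact hWp t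
  have cx := hsol.contX
  have cy := hsol.contY
  obtain ⟨φ, φ0, φT, hφ, hU, hY⟩ := exists_angle C.loop hsol.hx hy cy (by fun_prop)
    (by rw [C.α_eq]; exact hα) hRp hWp'
  have key : ∀ t, SE (φ t) (H t) = sigma (φ t) + (C.x t ^ 2 + C.y t ^ 2) * Real.cos (φ t) ^ 4 ∧
      PE (φ t) (H t) = C.x t ^ 2 + C.y t ^ 2 := fun t => by
    refine polarE_aux (hRp t) (hH t) ?_
    have h9 : √(C.x t ^ 2 + C.y t ^ 2) ^ 2 = C.x t ^ 2 + C.y t ^ 2 := Real.sq_sqrt (hRp t).le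
    have h6 := hY t; have h7 := hU t
    have h3 := Real.sin_sq_add_cos_sq (φ t)
    simp only [sigma, H, pot]
    generalize √(C.x t ^ 2 + C.y t ^ 2) = R at *
    rw [← h9, h6, h7]; linear_combination (0:ℝ) * h3
  have hX : ∀ t, XE (φ t) (H t) = C.x t := fun t => by rw [XE, (key t).2]; exact (hU t).symm
  have hTp : 0 < C.T := C.loop.τ_pos.trans C.loop.τ_lt
  have hρ : ∀ t, HasDerivAt H (ε * v t * C.y t ^ 2) t := fun t =>
    ((((hy t).pow 2).div_const 2).add ((hasDerivAt_pot (C.x t)).comp t (hsol.hx t))).congr_deriv (by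
      simp only [y']; simp; ring)
  obtain ⟨g, hg, hφg⟩ := PolarSol.of_angle (F := polarE a b) (ε := ε) hTp φ0 φT hφ
    (fun t => div_pos (hWp' t) (hRp t)) hρ
    (by
      have h5 := C.loop.perX 0; have h6 := C.loop.perY 0
      rw [zero_add] at h5 h6
      simp only [H, h5, h6]) (fun t => by
      have h9 : √(C.x t ^ 2 + C.y t ^ 2) ^ 2 = C.x t ^ 2 + C.y t ^ 2 := Real.sq_sqrt (hRp t).le
      have h6 := hY t; have h7 := hU t
      have e2 : (C.y t * C.y t - C.x t * y' t) / (C.x t ^ 2 + C.y t ^ 2) =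
          SE (φ t) (H t) + ε * v t * Real.sin (φ t) * Real.cos (φ t) := by
        rw [div_eq_iff (hRp t).ne', hW, (key t).1, sigma]
        generalize √(C.x t ^ 2 + C.y t ^ 2) = R at *
        rw [← h9, h6, h7]; ring
      have h8 := div_pos (hWp' t) (hRp t)
      rw [e2] at h8 ⊢
      simp only [polarE, hX, (key t).2]
      change _ = ε * (v t * _ * _ / (_ + ε * v t * _ * _)) * _
      rw [show ε * v t * C.y t ^ 2 = ε * v t * ((C.x t ^ 2 + C.y t ^ 2) * Real.sin (φ t) ^ 2) by
        rw [← h9, ← mul_pow, ← h6]]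
      field_simp)
  refine ⟨_, hg, fun θ hθ => ⟨g θ, rfl, ?_⟩⟩
  have h5 := hX (g θ); have h6 := hY (g θ); have h7 := (key (g θ)).2
  rw [hφg θ hθ] at h5 h6 h7
  simp only [Function.comp]
  rw [h5, h7, ← h6]

lemma liftE (a b : ℝ) {e : ℝ} (he : 0 < e) :
    Lift a b typeE e e (polarE a b) (fun θ h => (XE θ h, √(PE θ h) * Real.sin θ)) := by
  intro δ hδ
  obtain ⟨K, M, hK, hM, hE⟩ := exists_energy a b
  set V := |a| + |b| * M + M ^ 2 + 1
  have hV : 0 < V := by positivity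
  set d := min δ (e / 2)
  have hd : 0 < d := lt_min hδ (by linarith)
  refine ⟨min (d / 2) (min 1 (min (d / (2 * K)) (e / (V * M ^ 2)))), by positivity,
    fun ε h0 h1 C hC hCe => ?_⟩
  simp only [lt_min_iff] at h1 hCe
  obtain ⟨-, h1, h2, h3⟩ := h1
  rw [lt_div_iff₀ (by positivity)] at h2 h3
  have hEt : ∀ t, |C.y t ^ 2 / 2 + pot (C.x t) - e| < d := fun t => by
    have := (hE ε h0 h1.le C t).1
    have h4 := hCe.1
    rw [abs_lt] at h4 ⊢; rw [abs_le] at this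
    constructor <;> nlinarith
  have hd1 : d ≤ δ := min_le_left _ _
  have hd2 : d ≤ e / 2 := min_le_right _ _
  have hH : ∀ t, e / 2 < C.y t ^ 2 / 2 + pot (C.x t) := fun t => by
    linarith [(abs_lt.1 (hEt t)).1]
  obtain ⟨h, hh, hp⟩ := C.exists_polarE hC.1 (fun t => by linarith [hH t]) (fun t => by
    obtain ⟨-, h5, h6⟩ := hE ε h0 h1.le C t
    have h7 : |ε * (a + b * C.x t - C.x t ^ 2) * (C.x t * C.y t)| ≤ ε * V * (M * M) := by
      rw [abs_mul, abs_mul, abs_mul (C.x t), abs_of_pos h0]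
      gcongr
      exact (abs_damping_le h5 a b).trans (by simp [V])
    have h8 := hH t
    unfold pot at h8
    nlinarith [(abs_le.1 h7).2, sq_nonneg (C.x t ^ 2)])
  refine ⟨h, hh, fun θ hθ => ?_, fun θ hθ => ?_⟩
  · obtain ⟨t, h4, -⟩ := hp θ hθ
    rw [h4]
    exact (hEt t).trans_le hd1
  · obtain ⟨t, -, h4⟩ := hp θ hθ
    exact ⟨t, h4.symm⟩

/-! ### The Melnikov integrals inside the right loop -/

/-- The squared abscissa inside the right loop. -/
noncomputable def weight (r θ : ℝ) : ℝ := 1 - √2 * r * Real.cos θ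

lemma weight_pos {r : ℝ} (hr : |√2 * r| < 1) (θ : ℝ) : 0 < weight r θ := by
  have h1 : |√2 * r * Real.cos θ| < 1 := by
    rw [abs_mul]
    have := Real.abs_cos_le_one θ
    nlinarith [abs_nonneg (√2 * r)]
  have := (abs_lt.1 h1).2
  unfold weight; linarith

/-- Weighted moments of the sine. -/
noncomputable def moment (m : ℕ) (p r : ℝ) : ℝ :=
  ∫ θ in (0 : ℝ)..(2 * Real.pi), weight r θ ^ p * Real.sin θ ^ m

lemma isOpen_domain : IsOpen {r : ℝ | |√2 * r| < 1} :=
  isOpen_lt (by fun_prop) (by fun_prop)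

lemma continuousOn_weight_rpow (p : ℝ) :
    ContinuousOn (fun z : ℝ × ℝ => weight z.1 z.2 ^ p) ({r : ℝ | |√2 * r| < 1} ×ˢ univ) := by
  have : Continuous fun z : ℝ × ℝ => weight z.1 z.2 := by unfold weight; fun_prop
  exact this.continuousOn.rpow_const fun z hz => Or.inl (weight_pos hz.1 z.2).ne'

lemma continuous_weight_rpow {r : ℝ} (hr : |√2 * r| < 1) (p : ℝ) :
    Continuous fun θ => weight r θ ^ p := by
  have : Continuous fun θ => weight r θ := by unfold weight; fun_prop
  exact this.rpow_const fun θ => Or.inl (weight_pos hr θ).ne'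

lemma hasDerivAt_moment₀ {r : ℝ} (hr : |√2 * r| < 1) (m : ℕ) (p : ℝ) :
    HasDerivAt (moment m p) (∫ θ in (0 : ℝ)..(2 * Real.pi),
      -(√2 * Real.cos θ) * p * weight r θ ^ (p - 1) * Real.sin θ ^ m) r := by
  refine hasDerivAt_integral_param (f := fun r θ => weight r θ ^ p * Real.sin θ ^ m)
    (f' := fun r θ => -(√2 * Real.cos θ) * p * weight r θ ^ (p - 1) * Real.sin θ ^ m)
    isOpen_domain (by positivity) ?_ ?_ ?_ hr
  · exact fun h hh => ((continuous_weight_rpow hh p).mul (by fun_prop)).continuousOn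
  · have := (continuousOn_weight_rpow (p - 1)).mono
      (prod_mono_right (subset_univ (Icc 0 (2 * Real.pi))))
    exact (ContinuousOn.mul (by fun_prop) this).mul (by fun_prop)
  · intro h hh θ hθ
    have h1 : HasDerivAt (fun r => weight r θ) (-(√2 * Real.cos θ)) h := by
      unfold weight
      exact ((((hasDerivAt_id h).const_mul √2).mul_const (Real.cos θ)).const_sub 1).congr_deriv
        (by simp)
    exact (h1.rpow_const (Or.inl (weight_pos hh θ).ne')).mul_const _

lemma moment_deriv_eq {r : ℝ} (hr : |√2 * r| < 1) (m : ℕ) (p : ℝ) :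
    ∫ θ in (0 : ℝ)..(2 * Real.pi), -(√2 * Real.cos θ) * p * weight r θ ^ (p - 1) * Real.sin θ ^ m =
      2 * p * (p - 1) / (m + 1) * r * moment (m + 2) (p - 2) r := by
  have q2 : √2 ^ 2 = 2 := Real.sq_sqrt (by norm_num)
  have h0 : ∫ θ in (0 : ℝ)..(2 * Real.pi), (-(√2 * Real.cos θ) * p * weight r θ ^ (p - 1) *
      Real.sin θ ^ m - 2 * p * (p - 1) / (m + 1) * r *
        (weight r θ ^ (p - 2) * Real.sin θ ^ (m + 2))) = 0 := by
    have hd : ∀ θ, HasDerivAt (fun θ => -(√2 * p / (m + 1)) * (weight r θ ^ (p - 1) * Real.sin θ ^ (m + 1)))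
        (-(√2 * Real.cos θ) * p * weight r θ ^ (p - 1) *
      Real.sin θ ^ m - 2 * p * (p - 1) / (m + 1) * r *
        (weight r θ ^ (p - 2) * Real.sin θ ^ (m + 2))) θ := by
      intro θ
      have h1 : HasDerivAt (fun θ => weight r θ) (√2 * r * Real.sin θ) θ := by
        unfold weight
        exact (((Real.hasDerivAt_cos θ).const_mul (√2 * r)).const_sub 1).congr_deriv (by simp)
      have h2 := h1.rpow_const (p := p - 1) (Or.inl (weight_pos hr θ).ne')
      refine ((h2.mul ((Real.hasDerivAt_sin θ).pow (m + 1))).const_mul (-(√2 * p / (m + 1)))).congr_deriv ?_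
      have hm : (m + 1 : ℝ) ≠ 0 := by positivity
      rw [show p - 1 - 1 = p - 2 by ring]
      simp only [Nat.add_one_sub_one, Nat.cast_add, Nat.cast_one, Pi.pow_apply]
      field_simp
      linear_combination (-(p * r * (p - 1) * weight r θ ^ (p - 2) * Real.sin θ ^ (m + 2))) * q2
    have hc : Continuous fun θ => (-(√2 * Real.cos θ) * p * weight r θ ^ (p - 1) *
      Real.sin θ ^ m - 2 * p * (p - 1) / (m + 1) * r *
        (weight r θ ^ (p - 2) * Real.sin θ ^ (m + 2))) := by
      have := continuous_weight_rpow hr (p - 1)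
      have := continuous_weight_rpow hr (p - 2)
      fun_prop
    rw [intervalIntegral.integral_eq_sub_of_hasDerivAt (fun θ _ => hd θ) (hc.intervalIntegrable _ _)]
    simp
  rw [intervalIntegral.integral_sub, intervalIntegral.integral_const_mul] at h0
  · exact sub_eq_zero.1 h0
  · have := continuous_weight_rpow hr (p - 1)
    exact (by fun_prop : Continuous _).intervalIntegrable _ _
  · have := continuous_weight_rpow hr (p - 2)
    exact (by fun_prop : Continuous _).intervalIntegrable _ _

lemma hasDerivAt_moment {r : ℝ} (hr : |√2 * r| < 1) (m : ℕ) (p : ℝ) :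
    HasDerivAt (moment m p) (2 * p * (p - 1) / (m + 1) * r * moment (m + 2) (p - 2) r) r :=
  moment_deriv_eq hr m p ▸ hasDerivAt_moment₀ hr m p

/-- A contiguity relation between moments. -/
lemma moment_relation {r : ℝ} (hr : |√2 * r| < 1) (m : ℕ) (p : ℝ) :
    r * (2 * p * (p - 1) / (m + 1) * r * moment (m + 2) (p - 2) r) =
      p * (moment m p r - moment m (p - 1) r) := by
  rw [← moment_deriv_eq hr, moment, moment, ← intervalIntegral.integral_sub,
    ← intervalIntegral.integral_const_mul, ← intervalIntegral.integral_const_mul]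
  · refine intervalIntegral.integral_congr fun θ _ => ?_
    have h1 : weight r θ ^ p = weight r θ ^ (p - 1) * weight r θ := by
      rw [Real.rpow_sub_one (weight_pos hr θ).ne']; field_simp [(weight_pos hr θ).ne']
    simp only [h1]
    generalize weight r θ ^ (p - 1) = w
    unfold weight; ring
  · have := continuous_weight_rpow hr p
    exact (by fun_prop : Continuous _).intervalIntegrable _ _
  · have := continuous_weight_rpow hr (p - 1)
    exact (by fun_prop : Continuous _).intervalIntegrable _ _

lemma moment_pos {r : ℝ} (hr : |√2 * r| < 1) {m : ℕ} (hm : Even m) (p : ℝ) : 0 < moment m p r := by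
  have := continuous_weight_rpow hr p
  refine intervalIntegral.integral_pos (by positivity) (by fun_prop)
    (fun θ _ => mul_nonneg (Real.rpow_nonneg (weight_pos hr θ).le _) (hm.pow_nonneg _))
    ⟨Real.pi / 2, ⟨by positivity, by linarith [Real.pi_pos]⟩, ?_⟩
  simp only [Real.sin_pi_div_two, one_pow, mul_one]
  exact Real.rpow_pos_of_pos (weight_pos hr _) _

lemma moment_sq_le {r : ℝ} (hr : |√2 * r| < 1) {m : ℕ} (hm : Even m) (p : ℝ) :
    moment m (p - 1) r ^ 2 ≤ moment m p r * moment m (p - 2) r := by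
  have h2 := moment_pos hr hm (p - 2)
  have c0 := continuous_weight_rpow hr p
  have c1 := continuous_weight_rpow hr (p - 1)
  have c2 := continuous_weight_rpow hr (p - 2)
  set l := moment m (p - 1) r / moment m (p - 2) r with hl
  have key : 0 ≤ moment m p r - 2 * l * moment m (p - 1) r + l ^ 2 * moment m (p - 2) r := by
    have e : moment m p r - 2 * l * moment m (p - 1) r + l ^ 2 * moment m (p - 2) r =
        ∫ θ in (0 : ℝ)..(2 * Real.pi), (weight r θ ^ p * Real.sin θ ^ m -
          2 * l * (weight r θ ^ (p - 1) * Real.sin θ ^ m) +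
          l ^ 2 * (weight r θ ^ (p - 2) * Real.sin θ ^ m)) := by
      rw [intervalIntegral.integral_add, intervalIntegral.integral_sub,
        intervalIntegral.integral_const_mul, intervalIntegral.integral_const_mul]
      · rfl
      all_goals exact (by fun_prop : Continuous _).intervalIntegrable _ _
    rw [e]
    refine intervalIntegral.integral_nonneg (by positivity) fun θ _ => ?_
    have hw := weight_pos hr θ
    have e1 : weight r θ ^ (p - 1) = weight r θ ^ (p - 2) * weight r θ := by
      rw [← Real.rpow_add_one hw.ne']; congr 1; ring
    have e0 : weight r θ ^ p = weight r θ ^ (p - 2) * weight r θ ^ 2 := by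
      rw [← Real.rpow_natCast, ← Real.rpow_add hw]; congr 1; push_cast; ring
    rw [e0, e1]
    have : 0 ≤ weight r θ ^ (p - 2) * Real.sin θ ^ m * (weight r θ - l) ^ 2 :=
      mul_nonneg (mul_nonneg (Real.rpow_nonneg hw.le _) (hm.pow_nonneg _)) (sq_nonneg _)
    linarith
  have hl' : l * moment m (p - 2) r = moment m (p - 1) r := div_mul_cancel₀ _ h2.ne'
  nlinarith

/-! ### Counting zeros with multiplicity -/

/-- The multiplicity, truncated at two, of `e` as a zero of `f`. -/
noncomputable def mult (f f' : ℝ → ℝ) (e : ℝ) : ℕ :=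
  if f e = 0 then (if f' e = 0 then 2 else 1) else 0

lemma exists_deriv_zero {f f' : ℝ → ℝ} {I : Set ℝ} (hI : I.OrdConnected)
    (hf : ∀ e ∈ I, HasDerivAt f (f' e) e) {x y : ℝ} (hx : x ∈ I) (hy : y ∈ I) (hxy : x < y)
    (h : f x = f y) : ∃ z ∈ Ioo x y, f' z = 0 := by
  have hsub := hI.out hx hy
  exact exists_hasDerivAt_eq_zero hxy (fun z hz => (hf z (hsub hz)).continuousAt.continuousWithinAt)
    h fun z hz => hf z (hsub (Ioo_subset_Icc_self hz))

lemma card_le_one_of_zero {f : ℝ → ℝ} (S : Finset ℝ) (p : ℝ → Prop) [DecidablePred p]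
    (h : ∀ x ∈ S, ∀ y ∈ S, x < y → p x → p y → f x = 0 → f y = 0 → False) :
    ∑ e ∈ S, (if f e = 0 ∧ p e then 1 else 0) ≤ 1 := by
  classical
  rw [Finset.sum_boole, Nat.cast_id, Finset.card_le_one]
  intro x hx y hy
  simp only [Finset.mem_filter] at hx hy
  by_contra hne
  rcases lt_or_gt_of_ne hne with hlt | hlt
  · exact h x hx.1 y hy.1 hlt hx.2.2 hy.2.2 hx.2.1 hy.2.1
  · exact h y hy.1 x hx.1 hlt hy.2.2 hx.2.2 hy.2.1 hx.2.1

lemma sum_mult_le_one {f f' : ℝ → ℝ} {I : Set ℝ} (hI : I.OrdConnected)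
    (hf : ∀ e ∈ I, HasDerivAt f (f' e) e) (hne : ∀ e ∈ I, f' e ≠ 0) (S : Finset ℝ)
    (hS : (S : Set ℝ) ⊆ I) : ∑ e ∈ S, mult f f' e ≤ 1 := by
  classical
  refine le_trans (Finset.sum_le_sum fun e he => ?_) (card_le_one_of_zero S (fun _ => True)
    (f := f) fun x hx y hy hxy _ _ h1 h2 => ?_)
  · simp [mult, hne e (hS he)]
  · obtain ⟨z, hz, h0⟩ := exists_deriv_zero hI hf (hS hx) (hS hy) hxy (h1.trans h2.symm)
    exact hne z (hI.out (hS hx) (hS hy) (Ioo_subset_Icc_self hz)) h0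

lemma sum_mult_le_two {f f' : ℝ → ℝ} {I : Set ℝ} (hI : I.OrdConnected)
    (hf : ∀ e ∈ I, HasDerivAt f (f' e) e)
    (huniq : ∀ x ∈ I, ∀ y ∈ I, f' x = 0 → f' y = 0 → x = y) (S : Finset ℝ)
    (hS : (S : Set ℝ) ⊆ I) : ∑ e ∈ S, mult f f' e ≤ 2 := by
  classical
  by_cases hc : ∃ c ∈ I, f' c = 0
  · obtain ⟨c, hcI, hc⟩ := hc
    have key : ∀ e ∈ S, mult f f' e ≤
        (if f e = 0 ∧ e ≤ c then 1 else 0) + (if f e = 0 ∧ c ≤ e then 1 else 0) := by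
      intro e he
      by_cases h0 : f e = 0
      · by_cases h1 : f' e = 0
        · obtain rfl := huniq e (hS he) c hcI h1 hc
          simp [mult, h0, h1]
        · rcases le_total e c with h | h <;> simp [mult, h0, h1, h]
      · simp [mult, h0]
    refine (Finset.sum_le_sum key).trans ?_
    rw [Finset.sum_add_distrib]
    refine add_le_add (card_le_one_of_zero S (fun e => e ≤ c) ?_)
      (card_le_one_of_zero S (fun e => c ≤ e) ?_)
    · intro x hx y hy hxy h1 h2 h3 h4
      obtain ⟨z, hz, h0⟩ := exists_deriv_zero hI hf (hS hx) (hS hy) hxy (h3.trans h4.symm)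
      have := huniq z (hI.out (hS hx) (hS hy) (Ioo_subset_Icc_self hz)) c hcI h0 hc
      linarith [hz.2]
    · intro x hx y hy hxy h1 h2 h3 h4
      obtain ⟨z, hz, h0⟩ := exists_deriv_zero hI hf (hS hx) (hS hy) hxy (h3.trans h4.symm)
      have := huniq z (hI.out (hS hx) (hS hy) (Ioo_subset_Icc_self hz)) c hcI h0 hc
      linarith [hz.1]
  · push Not at hc
    exact (sum_mult_le_one hI hf hc S hS).trans one_le_two

/-! ### The Melnikov function inside the right loop -/

/-- The normalised Melnikov function inside the right loop. -/
noncomputable def GR (a b r : ℝ) : ℝ :=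
  a * moment 2 (-1 / 2) r + b * Real.pi - moment 2 (1 / 2) r

/-- A combination of moments governing the zeros of the derivative of the Melnikov function. -/
noncomputable def NR (a r : ℝ) : ℝ := moment 4 (-3 / 2) r + 3 * a * moment 4 (-5 / 2) r

lemma mem_domain {r : ℝ} (hr : r ∈ Ioo 0 (1 / √2)) : |√2 * r| < 1 := by
  have q : 0 < √2 := by positivity
  rw [abs_of_pos (mul_pos q hr.1)]
  have := hr.2
  rwa [lt_div_iff₀ q, mul_comm] at this

lemma hasDerivAt_GR (a b : ℝ) {r : ℝ} (hr : |√2 * r| < 1) :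
    HasDerivAt (GR a b) (r / 6 * NR a r) r := by
  have h1 := hasDerivAt_moment hr 2 (-1 / 2)
  have h2 := hasDerivAt_moment hr 2 (1 / 2)
  unfold GR NR
  refine (((h1.const_mul a).add_const (b * Real.pi)).sub h2).congr_deriv ?_
  norm_num
  ring

lemma moment_lt {r : ℝ} (hr : r ∈ Ioo 0 (1 / √2)) : moment 4 (-3 / 2) r < moment 4 (-5 / 2) r := by
  have h := moment_relation (mem_domain hr) 4 (-3 / 2)
  have h1 := moment_pos (mem_domain hr) (m := 6) (by decide) (-7 / 2)
  norm_num at h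
  nlinarith [mul_pos (mul_pos hr.1 hr.1) h1]

lemma exists_hasDerivAt_NR (a : ℝ) {r : ℝ} (hr : r ∈ Ioo 0 (1 / √2)) :
    ∃ k₃ k₅, HasDerivAt (moment 4 (-3 / 2)) k₃ r ∧ HasDerivAt (moment 4 (-5 / 2)) k₅ r ∧
      k₃ * moment 4 (-5 / 2) r < moment 4 (-3 / 2) r * k₅ ∧
      HasDerivAt (NR a) (k₃ + 3 * a * k₅) r := by
  have hd := mem_domain hr
  refine ⟨_, _, hasDerivAt_moment hd 4 (-3 / 2), hasDerivAt_moment hd 4 (-5 / 2), ?_,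
    (hasDerivAt_moment hd 4 (-3 / 2)).add ((hasDerivAt_moment hd 4 (-5 / 2)).const_mul _)⟩
  have h3 := moment_relation hd 4 (-3 / 2)
  have h5 := moment_relation hd 4 (-5 / 2)
  have hcs := moment_sq_le hd (m := 4) (by decide) (-3 / 2)
  have hlt := moment_lt hr
  have p3 := moment_pos hd (m := 4) (by decide) (-3 / 2)
  refine lt_of_mul_lt_mul_left ?_ hr.1.le
  rw [← mul_assoc r, h3, mul_left_comm r, h5]
  rw [show (-3 / 2 : ℝ) - 1 = -5 / 2 by norm_num, show (-3 / 2 : ℝ) - 2 = -7 / 2 by norm_num] at hcs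
  rw [show (-3 / 2 : ℝ) - 1 = -5 / 2 by norm_num, show (-5 / 2 : ℝ) - 1 = -7 / 2 by norm_num]
  nlinarith [mul_pos p3 (sub_pos.2 hlt), mul_pos (p3.trans hlt) (sub_pos.2 hlt)]

lemma NR_unique (a : ℝ) {r s : ℝ} (hr : r ∈ Ioo 0 (1 / √2)) (hs : s ∈ Ioo 0 (1 / √2))
    (h0 : NR a r = 0) (h1 : NR a s = 0) : r = s := by
  have anti : StrictAntiOn (fun r => moment 4 (-3 / 2) r / moment 4 (-5 / 2) r) (Ioo 0 (1 / √2)) := by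
    have hd : ∀ r ∈ Ioo 0 (1 / √2), ∃ k < 0,
        HasDerivAt (fun r => moment 4 (-3 / 2) r / moment 4 (-5 / 2) r) k r := fun r hr => by
      obtain ⟨k₃, k₅, h3, h5, h, -⟩ := exists_hasDerivAt_NR a hr
      have p5 := moment_pos (mem_domain hr) (m := 4) (by decide) (-5 / 2)
      exact ⟨_, div_neg_of_neg_of_pos (sub_neg.2 h) (by positivity), h3.div h5 p5.ne'⟩
    refine strictAntiOn_of_deriv_neg (convex_Ioo _ _) (fun r hr => ?_) fun r hr => ?_
    · obtain ⟨k, -, h⟩ := hd r hr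
      exact h.continuousAt.continuousWithinAt
    · rw [interior_Ioo] at hr
      obtain ⟨k, hk, h⟩ := hd r hr
      rwa [h.deriv]
  refine anti.injOn hr hs ?_
  have p := moment_pos (mem_domain hr) (m := 4) (by decide) (-5 / 2)
  have p' := moment_pos (mem_domain hs) (m := 4) (by decide) (-5 / 2)
  unfold NR at h0 h1
  change _ / _ = _ / _
  rw [div_eq_div_iff p.ne' p'.ne']
  linear_combination moment 4 (-5 / 2) s * h0 - moment 4 (-5 / 2) r * h1

lemma contDiffAt_polarR (a b θ : ℝ) {r : ℝ} (hr : |√2 * r| < 1) :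
    ContDiffAt ℝ 2 (polarR a b) (θ, r, 0) := by
  have hX : ContDiffAt ℝ 2 (fun p : ℝ × ℝ × ℝ => absR p.1 p.2.1) (θ, r, 0) := by
    unfold absR
    refine ContDiffAt.sqrt (by fun_prop) ?_
    exact (weight_pos hr θ).ne'
  have hX0 : 0 < absR θ r := Real.sqrt_pos.2 (weight_pos hr θ)
  unfold polarR
  refine ContDiffAt.div (by fun_prop) (by fun_prop) ?_
  simp only [zero_mul, add_zero]
  positivity

lemma integral_polarR (a b : ℝ) {r : ℝ} (hr : |√2 * r| < 1) :
    r / √2 * GR a b r = ∫ θ in (0 : ℝ)..(2 * Real.pi), polarR a b (θ, r, 0) := by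
  have c1 := continuous_weight_rpow hr (-1 / 2)
  have c2 := continuous_weight_rpow hr (1 / 2)
  have e : ∀ θ, polarR a b (θ, r, 0) = r / √2 * (a * (weight r θ ^ (-1 / 2 : ℝ) * Real.sin θ ^ 2) +
      b * Real.sin θ ^ 2 - weight r θ ^ (1 / 2 : ℝ) * Real.sin θ ^ 2) := by
    intro θ
    have hw := weight_pos hr θ
    have e1 : weight r θ ^ (1 / 2 : ℝ) = absR θ r := by rw [← Real.sqrt_eq_rpow]; rfl
    have e2 : weight r θ ^ (-1 / 2 : ℝ) = (absR θ r)⁻¹ := by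
      rw [← e1, ← Real.rpow_neg hw.le]; norm_num
    have hX0 : 0 < absR θ r := Real.sqrt_pos.2 hw
    rw [e1, e2]
    simp only [polarR, zero_mul, add_zero]
    field_simp
  simp only [e]
  rw [intervalIntegral.integral_const_mul, intervalIntegral.integral_sub,
    intervalIntegral.integral_add, intervalIntegral.integral_const_mul,
    intervalIntegral.integral_const_mul, integral_sin_sq]
  · simp only [GR, moment, Real.sin_zero, Real.sin_two_pi]; ring
  all_goals exact (by fun_prop : Continuous _).intervalIntegrable _ _

lemma nearFewR (a b : ℝ) {e : ℝ} (he : e ∈ Ioo (-1 / 4) 0) :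
    NearFew (mult (fun e => GR a b √(2 * e + 1 / 2)) (fun e => NR a √(2 * e + 1 / 2) / 6) e : ℕ)
      a b typeR e := by
  have q : 0 < √2 := by positivity
  have hr : √(2 * e + 1 / 2) ∈ Ioo 0 (1 / √2) := by
    refine ⟨Real.sqrt_pos.2 (by linarith [he.1]), ?_⟩
    rw [← Real.sqrt_one, ← Real.sqrt_div zero_le_one]
    exact Real.sqrt_lt_sqrt (by linarith [he.1]) (by linarith [he.2])
  set r := √(2 * e + 1 / 2) with hrd
  have hd := mem_domain hr
  have hdn : ∀ᶠ r in 𝓝 r, |√2 * r| < 1 := isOpen_domain.mem_nhds hd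
  obtain ⟨c0, c1, c2⟩ := (liftR a b he.1 he.2).count (fun θ _ => contDiffAt_polarR a b θ hd)
    (M := fun r => r / √2 * GR a b r) (hdn.mono fun r hr => integral_polarR a b hr)
  have hM : ∀ r, |√2 * r| < 1 → HasDerivAt (fun r => r / √2 * GR a b r)
      (1 / √2 * GR a b r + r / √2 * (r / 6 * NR a r)) r := fun r hr =>
    ((hasDerivAt_id r).div_const √2).mul (hasDerivAt_GR a b hr)
  have hr2 : 0 < r / √2 := div_pos hr.1 q
  unfold mult
  simp only [← hrd]
  split_ifs with h0 h1
  · obtain ⟨k₃, k₅, -, -, hk, hN⟩ := exists_hasDerivAt_NR a hr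
    refine c2 _ _ (hdn.mono hM) (((hasDerivAt_GR a b hd).const_mul (1 / √2)).add
      (((hasDerivAt_id r).div_const √2).mul (((hasDerivAt_id r).div_const 6).mul hN))) ?_
    have hN0 : NR a r = 0 := by linarith
    have p5 := moment_pos hd (m := 4) (by decide) (-5 / 2)
    have : k₃ + 3 * a * k₅ ≠ 0 := by
      intro h
      unfold NR at hN0
      have : k₃ * moment 4 (-5 / 2) r - moment 4 (-3 / 2) r * k₅ = 0 := by
        linear_combination moment 4 (-5 / 2) r * h - k₅ * hN0
      linarith
    have e1 : r / √2 * (r / 6 * (k₃ + 3 * a * k₅)) ≠ 0 :=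
      mul_ne_zero hr2.ne' (mul_ne_zero (by linarith [hr.1]) this)
    simpa [hN0] using e1
  · refine c1 _ (hM r hd) ?_
    rw [h0, mul_zero, zero_add]
    exact mul_ne_zero hr2.ne' (mul_ne_zero (by linarith [hr.1]) fun h => h1 (by rw [h, zero_div]))
  · exact c0 (mul_ne_zero hr2.ne' h0)

lemma fewR (a b : ℝ) {K : Set ℝ} (hK : IsCompact K) (hKs : K ⊆ Ioo (-1 / 4) 0) :
    Few 2 a b {p | p ∈ typeR ∧ pot p.1 ∈ K} ∧
    (0 ≤ a → Few 1 a b {p | p ∈ typeR ∧ pot p.1 ∈ K}) ∧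
    ((∀ r ∈ Ioo 0 (1 / √2), GR a b r ≠ 0) → Few 0 a b {p | p ∈ typeR ∧ pot p.1 ∈ K}) := by
  have hr : ∀ e ∈ Ioo (-1 / 4 : ℝ) 0, √(2 * e + 1 / 2) ∈ Ioo 0 (1 / √2) := fun e he => by
    refine ⟨Real.sqrt_pos.2 (by linarith [he.1]), ?_⟩
    rw [← Real.sqrt_one, ← Real.sqrt_div zero_le_one]
    exact Real.sqrt_lt_sqrt (by linarith [he.1]) (by linarith [he.2])
  have hf : ∀ e ∈ Ioo (-1 / 4 : ℝ) 0, HasDerivAt (fun e => GR a b √(2 * e + 1 / 2))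
      (NR a √(2 * e + 1 / 2) / 6) e := fun e he => by
    have h1 : HasDerivAt (fun e : ℝ => 2 * e + 1 / 2) 2 e :=
      (((hasDerivAt_id e).const_mul 2).add_const _).congr_deriv (by simp)
    have h2 := h1.sqrt (by linarith [he.1])
    refine ((hasDerivAt_GR a b (mem_domain (hr e he))).comp e h2).congr_deriv ?_
    have := (hr e he).1
    generalize √(2 * e + 1 / 2) = R at *
    field_simp
  have hm : ∀ e ∈ K, NearFew (mult (fun e => GR a b √(2 * e + 1 / 2))
      (fun e => NR a √(2 * e + 1 / 2) / 6) e : ℕ) a b typeR e := fun e he => nearFewR a b (hKs he)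
  refine ⟨Few.of_compact hK hm fun S hS => sum_mult_le_two ordConnected_Ioo hf ?_ S (hS.trans hKs),
    fun ha => Few.of_compact hK hm fun S hS => sum_mult_le_one ordConnected_Ioo hf ?_ S
      (hS.trans hKs), fun h => Few.of_compact hK hm fun S hS => ?_⟩
  · intro x hx y hy h0 h1
    have := NR_unique a (hr x hx) (hr y hy) (by linarith) (by linarith)
    rw [Real.sqrt_inj (by linarith [hx.1]) (by linarith [hy.1])] at this
    linarith
  · intro x hx
    have h3 := moment_pos (mem_domain (hr x hx)) (m := 4) (by decide) (-3 / 2)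
    have h5 := moment_pos (mem_domain (hr x hx)) (m := 4) (by decide) (-5 / 2)
    unfold NR
    positivity
  · refine (Finset.sum_eq_zero fun e he => ?_).le
    rw [mult, if_neg (h _ (hr e (hKs (hS he))))]

/-! ### The Melnikov integrals outside the double loop -/

lemma sigma_sq (θ : ℝ) : sigma θ ^ 2 + 4 * Real.sin θ ^ 2 * Real.cos θ ^ 2 = 1 := by
  have := Real.sin_sq_add_cos_sq θ
  unfold sigma
  linear_combination (Real.sin θ ^ 2 + Real.cos θ ^ 2 + 1) * this

lemma radicand_pos (θ : ℝ) {h : ℝ} (hh : 0 < h) : 0 < sigma θ ^ 2 + 4 * h * Real.cos θ ^ 4 := by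
  by_cases hc : Real.cos θ = 0
  · have := sigma_sq θ
    rw [hc] at this ⊢
    norm_num at this ⊢
    rcases this with h | h <;> rw [h] <;> norm_num
  · positivity

lemma SE_pos (θ : ℝ) {h : ℝ} (hh : 0 < h) : 0 < SE θ h := Real.sqrt_pos.2 (radicand_pos θ hh)

lemma SE_sq (θ : ℝ) {h : ℝ} (hh : 0 < h) : SE θ h ^ 2 = sigma θ ^ 2 + 4 * h * Real.cos θ ^ 4 :=
  Real.sq_sqrt (radicand_pos θ hh).le

lemma SE_add_pos (θ : ℝ) {h : ℝ} (hh : 0 < h) : 0 < SE θ h + sigma θ := by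
  have h1 := SE_pos θ hh
  have h2 := SE_sq θ hh
  by_contra! h3
  have hc : Real.cos θ ^ 4 = 0 := by
    have : 0 ≤ Real.cos θ ^ 4 := by positivity
    nlinarith
  have hc' : Real.cos θ = 0 := by simpa using hc
  have h4 := sigma_sq θ
  have : 0 ≤ sigma θ := by unfold sigma; rw [hc']; nlinarith [sq_nonneg (Real.sin θ)]
  linarith

lemma PE_pos (θ : ℝ) {h : ℝ} (hh : 0 < h) : 0 < PE θ h :=
  div_pos (by linarith) (SE_add_pos θ hh)

lemma SE_eq (θ : ℝ) {h : ℝ} (hh : 0 < h) : SE θ h = sigma θ + PE θ h * Real.cos θ ^ 4 := by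
  have h1 := SE_add_pos θ hh
  have h2 := SE_sq θ hh
  rw [PE]
  field_simp
  linear_combination h2

lemma PE_eq (θ : ℝ) {h : ℝ} (hh : 0 < h) :
    4 * h = 2 * PE θ h * sigma θ + PE θ h ^ 2 * Real.cos θ ^ 4 := by
  have h1 := SE_add_pos θ hh
  have h3 : PE θ h * (SE θ h + sigma θ) = 4 * h := by rw [PE]; field_simp
  rw [← h3, SE_eq θ hh]; ring

lemma contDiffAt_SE (θ : ℝ) {h : ℝ} (hh : 0 < h) :
    ContDiffAt ℝ 2 (fun p : ℝ × ℝ => SE p.1 p.2) (θ, h) := by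
  unfold SE
  refine ContDiffAt.sqrt (by unfold sigma; fun_prop) (radicand_pos θ hh).ne'

lemma contDiffAt_PE (θ : ℝ) {h : ℝ} (hh : 0 < h) :
    ContDiffAt ℝ 2 (fun p : ℝ × ℝ => PE p.1 p.2) (θ, h) := by
  unfold PE
  exact ContDiffAt.div (by fun_prop) ((contDiffAt_SE θ hh).add (by unfold sigma; fun_prop))
    (SE_add_pos θ hh).ne'

lemma contDiffAt_SE_comp (θ : ℝ) {h : ℝ} (hh : 0 < h) :
    ContDiffAt ℝ 2 (fun p : ℝ × ℝ × ℝ => SE p.1 p.2.1) (θ, h, 0) := by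
  unfold SE
  exact ContDiffAt.sqrt (by unfold sigma; fun_prop) (radicand_pos θ hh).ne'

lemma contDiffAt_PE_comp (θ : ℝ) {h : ℝ} (hh : 0 < h) :
    ContDiffAt ℝ 2 (fun p : ℝ × ℝ × ℝ => PE p.1 p.2.1) (θ, h, 0) := by
  unfold PE
  exact ContDiffAt.div (by fun_prop) ((contDiffAt_SE_comp θ hh).add (by unfold sigma; fun_prop))
    (SE_add_pos θ hh).ne'

lemma contDiffAt_XE_comp (θ : ℝ) {h : ℝ} (hh : 0 < h) :
    ContDiffAt ℝ 2 (fun p : ℝ × ℝ × ℝ => XE p.1 p.2.1) (θ, h, 0) := by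
  unfold XE
  exact (((contDiffAt_PE_comp θ hh).sqrt (PE_pos θ hh).ne').mul (by fun_prop)).neg

lemma contDiffAt_polarE (a b θ : ℝ) {h : ℝ} (hh : 0 < h) :
    ContDiffAt ℝ 2 (polarE a b) (θ, h, 0) := by
  have hS := contDiffAt_SE_comp θ hh
  have hP := contDiffAt_PE_comp θ hh
  have hX := contDiffAt_XE_comp θ hh
  have hv : ContDiffAt ℝ 2 (fun p : ℝ × ℝ × ℝ => a + b * XE p.1 p.2.1 - XE p.1 p.2.1 ^ 2)
      (θ, h, 0) := by fun_prop
  unfold polarE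
  refine ContDiffAt.div (by fun_prop) (by fun_prop) ?_
  simp only [zero_mul, add_zero]
  exact (SE_pos θ hh).ne'

lemma continuous_SE (h : ℝ) : Continuous fun θ => SE θ h := by
  unfold SE sigma; fun_prop

lemma continuous_PE {h : ℝ} (hh : 0 < h) : Continuous fun θ => PE θ h := by
  unfold PE
  exact continuous_const.div₀ ((continuous_SE h).add (by unfold sigma; fun_prop))
    fun θ => (SE_add_pos θ hh).ne'

lemma continuousOn_SE : ContinuousOn (fun p : ℝ × ℝ => SE p.2 p.1)
    (Ioi 0 ×ˢ Icc 0 (2 * Real.pi)) := by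
  unfold SE sigma; fun_prop

lemma continuousOn_PE : ContinuousOn (fun p : ℝ × ℝ => PE p.2 p.1)
    (Ioi 0 ×ˢ Icc 0 (2 * Real.pi)) := by
  unfold PE
  exact ContinuousOn.div (by fun_prop) (continuousOn_SE.add (by unfold sigma; fun_prop))
    fun p hp => (SE_add_pos p.2 hp.1).ne'

lemma hasDerivAt_PE (θ : ℝ) {h : ℝ} (hh : 0 < h) :
    HasDerivAt (fun h => PE θ h) (2 / SE θ h) h := by
  have hd : DifferentiableAt ℝ (fun h => PE θ h) h :=
    ((contDiffAt_PE θ hh).differentiableAt (by norm_num)).comp h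
      (f := fun h : ℝ => (θ, h)) (by fun_prop)
  have h1 := hd.hasDerivAt
  have h2 : HasDerivAt (fun h => 4 * h) (2 * deriv (fun h => PE θ h) h * sigma θ +
      2 * PE θ h * deriv (fun h => PE θ h) h * Real.cos θ ^ 4) h := by
    refine HasDerivAt.congr_of_eventuallyEq (f := fun h => 2 * PE θ h * sigma θ +
      PE θ h ^ 2 * Real.cos θ ^ 4) ?_ ?_
    · exact (((h1.const_mul 2).mul_const _).add ((h1.pow 2).mul_const _)).congr_deriv (by simp)
    · filter_upwards [Ioi_mem_nhds hh] with k hk using PE_eq θ hk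
  have h3 := h2.unique ((hasDerivAt_id h).const_mul 4)
  have hS := SE_pos θ hh
  have e : deriv (fun h => PE θ h) h = 2 / SE θ h := by
    rw [eq_div_iff hS.ne', SE_eq θ hh]
    linear_combination h3 / 2
  rwa [e] at h1

lemma hasDerivAt_PE_angle (θ : ℝ) {h : ℝ} (hh : 0 < h) :
    HasDerivAt (fun θ => PE θ h)
      (2 * PE θ h * Real.sin θ * Real.cos θ * (PE θ h * Real.cos θ ^ 2 - 2) / SE θ h) θ := by
  have hd : DifferentiableAt ℝ (fun θ => PE θ h) θ :=
    ((contDiffAt_PE θ hh).differentiableAt (by norm_num)).comp θ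
      (f := fun θ : ℝ => (θ, h)) (by fun_prop)
  have h1 := hd.hasDerivAt
  set D := deriv (fun θ => PE θ h) θ
  have hσ : HasDerivAt sigma (4 * Real.sin θ * Real.cos θ) θ :=
    (((Real.hasDerivAt_sin θ).pow 2).sub ((Real.hasDerivAt_cos θ).pow 2)).congr_deriv (by
      simp; ring)
  have h2 : HasDerivAt (fun _ => 4 * h) (2 * D * sigma θ + 2 * PE θ h * (4 * Real.sin θ * Real.cos θ)
      + (2 * PE θ h * D * Real.cos θ ^ 4 - PE θ h ^ 2 * (4 * Real.cos θ ^ 3 * Real.sin θ))) θ := by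
    refine HasDerivAt.congr_of_eventuallyEq (f := fun θ => 2 * PE θ h * sigma θ +
      PE θ h ^ 2 * Real.cos θ ^ 4) ?_ ?_
    · exact (((h1.const_mul 2).mul hσ).add ((h1.pow 2).mul
        ((Real.hasDerivAt_cos θ).pow 4))).congr_deriv (by simp; ring)
    · exact Eventually.of_forall fun k => PE_eq k hh
  have h3 := h2.unique (hasDerivAt_const θ _)
  have hS := SE_pos θ hh
  have e : D = 2 * PE θ h * Real.sin θ * Real.cos θ * (PE θ h * Real.cos θ ^ 2 - 2) / SE θ h := by
    rw [eq_div_iff hS.ne', SE_eq θ hh]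
    linear_combination h3 / 2
  rwa [e] at h1

/-- The area enclosed by the level curve. -/
noncomputable def area (h : ℝ) : ℝ := ∫ θ in (0 : ℝ)..(2 * Real.pi), PE θ h / 2

/-- The moment of inertia of the enclosed region. -/
noncomputable def inertia (h : ℝ) : ℝ :=
  ∫ θ in (0 : ℝ)..(2 * Real.pi), PE θ h ^ 2 * Real.cos θ ^ 2 / 4

/-- The period of the level curve, in the polar normalisation. -/
noncomputable def period (h : ℝ) : ℝ := ∫ θ in (0 : ℝ)..(2 * Real.pi), 1 / SE θ h

/-- The derivative of the moment of inertia in the energy. -/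
noncomputable def inertiaDeriv (h : ℝ) : ℝ :=
  ∫ θ in (0 : ℝ)..(2 * Real.pi), PE θ h * Real.cos θ ^ 2 / SE θ h

lemma hasDerivAt_area {h : ℝ} (hh : 0 < h) : HasDerivAt area (period h) h := by
  refine hasDerivAt_integral_param (f := fun h θ => PE θ h / 2) (f' := fun h θ => 1 / SE θ h)
    isOpen_Ioi (by positivity) ?_ ?_ ?_ (mem_Ioi.2 hh)
  · exact fun h hh => ((continuous_PE hh).div_const 2).continuousOn
  · exact continuousOn_const.div continuousOn_SE fun p hp => (SE_pos p.2 hp.1).ne'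
  · exact fun h hh θ _ => ((hasDerivAt_PE θ hh).div_const 2).congr_deriv (by ring)

lemma hasDerivAt_inertia {h : ℝ} (hh : 0 < h) : HasDerivAt inertia (inertiaDeriv h) h := by
  refine hasDerivAt_integral_param (f := fun h θ => PE θ h ^ 2 * Real.cos θ ^ 2 / 4)
    (f' := fun h θ => PE θ h * Real.cos θ ^ 2 / SE θ h)
    isOpen_Ioi (by positivity) ?_ ?_ ?_ (mem_Ioi.2 hh)
  · exact fun h hh => ((((continuous_PE hh).pow 2).mul (by fun_prop)).div_const 4).continuousOn
  · exact (continuousOn_PE.mul (by fun_prop)).div continuousOn_SE fun p hp => (SE_pos p.2 hp.1).ne'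
  · exact fun h hh θ _ => ((((hasDerivAt_PE θ hh).pow 2).mul_const _).div_const 4).congr_deriv (by
      simp; ring)

lemma integral_total_derivative {f g : ℝ → ℝ} (hf : ∀ θ, HasDerivAt f (g θ) θ) (hg : Continuous g)
    (h : f 0 = f (2 * Real.pi)) : ∫ θ in (0 : ℝ)..(2 * Real.pi), g θ = 0 := by
  rw [intervalIntegral.integral_eq_sub_of_hasDerivAt (fun θ _ => hf θ) (hg.intervalIntegrable _ _),
    h, sub_self]

lemma hasDerivAt_first (θ : ℝ) {h : ℝ} (hh : 0 < h) :
    HasDerivAt (fun θ => PE θ h * (Real.sin θ * Real.cos θ))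
      (PE θ h * (PE θ h * Real.cos θ ^ 4 - 1) / SE θ h) θ := by
  refine ((hasDerivAt_PE_angle θ hh).mul
    ((Real.hasDerivAt_sin θ).mul (Real.hasDerivAt_cos θ))).congr_deriv ?_
  have hS := SE_pos θ hh
  have h1 := SE_eq θ hh
  have h3 : Real.sin θ ^ 2 = 1 - Real.cos θ ^ 2 := by linarith [Real.sin_sq_add_cos_sq θ]
  simp only [Pi.mul_apply]
  field_simp
  rw [h1]
  unfold sigma
  have h4 : Real.sin θ ^ 4 = (1 - Real.cos θ ^ 2) ^ 2 := by rw [← h3]; ring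
  ring_nf
  simp only [h3, h4]
  ring

lemma hasDerivAt_second (θ : ℝ) {h : ℝ} (hh : 0 < h) :
    HasDerivAt (fun θ => PE θ h ^ 2 * (Real.sin θ * Real.cos θ ^ 3))
      (PE θ h ^ 2 * Real.cos θ ^ 2 * (PE θ h * Real.cos θ ^ 4 - 1 - 2 * Real.sin θ ^ 2) / SE θ h)
      θ := by
  refine (((hasDerivAt_PE_angle θ hh).pow 2).mul
    ((Real.hasDerivAt_sin θ).mul ((Real.hasDerivAt_cos θ).pow 3))).congr_deriv ?_
  have hS := SE_pos θ hh
  have h1 := SE_eq θ hh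
  have h3 : Real.sin θ ^ 2 = 1 - Real.cos θ ^ 2 := by linarith [Real.sin_sq_add_cos_sq θ]
  simp only [Pi.pow_apply, Pi.mul_apply, Nat.cast_ofNat, pow_one, Nat.add_one_sub_one]
  field_simp
  rw [h1]
  unfold sigma
  have h4 : Real.sin θ ^ 4 = (1 - Real.cos θ ^ 2) ^ 2 := by rw [← h3]; ring
  ring_nf
  simp only [h3, h4]
  ring

lemma three_area {h : ℝ} (hh : 0 < h) : 3 * area h = 4 * h * period h + inertiaDeriv h := by
  have cP := continuous_PE hh
  have cS := continuous_SE h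
  have nS : ∀ θ, SE θ h ≠ 0 := fun θ => (SE_pos θ hh).ne'
  have c1 : Continuous fun θ => PE θ h * (PE θ h * Real.cos θ ^ 4 - 1) / SE θ h :=
    (by fun_prop : Continuous _).div₀ cS nS
  have h0 := integral_total_derivative (hasDerivAt_first · hh) c1 (by simp)
  have c2 : Continuous fun θ => 1 / SE θ h := continuous_const.div₀ cS nS
  have c3 : Continuous fun θ => PE θ h * Real.cos θ ^ 2 / SE θ h :=
    (by fun_prop : Continuous _).div₀ cS nS
  have e : ∀ θ, PE θ h * (PE θ h * Real.cos θ ^ 4 - 1) / SE θ h =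
      2 * (3 * (PE θ h / 2) - (4 * h * (1 / SE θ h) + PE θ h * Real.cos θ ^ 2 / SE θ h)) := by
    intro θ
    have := nS θ
    have h1 := SE_eq θ hh
    have h2 := Real.sin_sq_add_cos_sq θ
    have h3 := PE_eq θ hh
    field_simp
    rw [h1, h3]
    unfold sigma
    linear_combination (PE θ h) * h2
  simp only [e] at h0
  rw [intervalIntegral.integral_const_mul, intervalIntegral.integral_sub,
    intervalIntegral.integral_add, intervalIntegral.integral_const_mul,
    intervalIntegral.integral_const_mul] at h0
  · simp only [area, period, inertiaDeriv]
    linarith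
  all_goals exact (by fun_prop : Continuous _).intervalIntegrable _ _

lemma five_inertia {h : ℝ} (hh : 0 < h) :
    5 * inertia h = (4 * h + 1) * inertiaDeriv h + area h := by
  have cP := continuous_PE hh
  have cS := continuous_SE h
  have nS : ∀ θ, SE θ h ≠ 0 := fun θ => (SE_pos θ hh).ne'
  have c1 : Continuous fun θ => PE θ h * (PE θ h * Real.cos θ ^ 4 - 1) / SE θ h :=
    (by fun_prop : Continuous _).div₀ cS nS
  have c2 : Continuous fun θ => PE θ h ^ 2 * Real.cos θ ^ 2 *
      (PE θ h * Real.cos θ ^ 4 - 1 - 2 * Real.sin θ ^ 2) / SE θ h :=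
    (by fun_prop : Continuous _).div₀ cS nS
  have h0 := integral_total_derivative (hasDerivAt_first · hh) c1 (by simp)
  have h0' := integral_total_derivative (hasDerivAt_second · hh) c2 (by simp)
  have c3 : Continuous fun θ => PE θ h * Real.cos θ ^ 2 / SE θ h :=
    (by fun_prop : Continuous _).div₀ cS nS
  have e : ∀ θ, PE θ h ^ 2 * Real.cos θ ^ 2 *
      (PE θ h * Real.cos θ ^ 4 - 1 - 2 * Real.sin θ ^ 2) / SE θ h =
      4 * (5 * (PE θ h ^ 2 * Real.cos θ ^ 2 / 4) -
        ((4 * h + 1) * (PE θ h * Real.cos θ ^ 2 / SE θ h) + PE θ h / 2)) -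
      2 * (PE θ h * (PE θ h * Real.cos θ ^ 4 - 1) / SE θ h) := by
    intro θ
    have := nS θ
    have h1 := SE_eq θ hh
    have h2 : Real.sin θ ^ 2 = 1 - Real.cos θ ^ 2 := by linarith [Real.sin_sq_add_cos_sq θ]
    have h3 := PE_eq θ hh
    field_simp
    rw [h1, h3]
    unfold sigma
    rw [h2]
    ring
  simp only [e] at h0'
  rw [intervalIntegral.integral_sub, intervalIntegral.integral_const_mul,
    intervalIntegral.integral_const_mul, intervalIntegral.integral_sub,
    intervalIntegral.integral_add, intervalIntegral.integral_const_mul,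
    intervalIntegral.integral_const_mul, h0] at h0'
  · simp only [area, inertia, inertiaDeriv]
    linarith
  all_goals exact (by fun_prop : Continuous _).intervalIntegrable _ _

lemma integral_odd {f : ℝ → ℝ} (hf : Continuous f) (h : ∀ θ, f (θ + Real.pi) = -f θ) :
    ∫ θ in (0 : ℝ)..(2 * Real.pi), f θ = 0 := by
  rw [← intervalIntegral.integral_add_adjacent_intervals (b := Real.pi)
    (hf.intervalIntegrable _ _) (hf.intervalIntegrable _ _)]
  have := intervalIntegral.integral_comp_add_right (a := 0) (b := Real.pi) f Real.pi
  rw [zero_add, ← two_mul] at this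
  rw [← this]
  simp [h]

lemma integral_polarE (a b : ℝ) {h : ℝ} (hh : 0 < h) :
    a * area h - inertia h = ∫ θ in (0 : ℝ)..(2 * Real.pi), polarE a b (θ, h, 0) := by
  have cP := continuous_PE hh
  have cS := continuous_SE h
  have nS : ∀ θ, SE θ h ≠ 0 := fun θ => (SE_pos θ hh).ne'
  have c1 : Continuous fun θ => PE θ h * (PE θ h * Real.cos θ ^ 4 - 1) / SE θ h :=
    (by fun_prop : Continuous _).div₀ cS nS
  have c2 : Continuous fun θ => PE θ h ^ 2 * Real.cos θ ^ 2 *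
      (PE θ h * Real.cos θ ^ 4 - 1 - 2 * Real.sin θ ^ 2) / SE θ h :=
    (by fun_prop : Continuous _).div₀ cS nS
  have c3 : Continuous fun θ => XE θ h * PE θ h * Real.sin θ ^ 2 / SE θ h := by
    unfold XE
    exact (by fun_prop : Continuous _).div₀ cS nS
  have h0 := integral_total_derivative (hasDerivAt_first · hh) c1 (by simp)
  have h0' := integral_total_derivative (hasDerivAt_second · hh) c2 (by simp)
  have h1 := integral_odd c3 fun θ => by
    simp only [XE, PE, SE, sigma, Real.cos_add_pi, Real.sin_add_pi, neg_sq,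
      Even.neg_pow (by decide : Even 4)]
    ring
  have e : ∀ θ, polarE a b (θ, h, 0) = a * (PE θ h / 2) - PE θ h ^ 2 * Real.cos θ ^ 2 / 4 +
      b * (XE θ h * PE θ h * Real.sin θ ^ 2 / SE θ h) -
      a / 2 * (PE θ h * (PE θ h * Real.cos θ ^ 4 - 1) / SE θ h) +
      1 / 4 * (PE θ h ^ 2 * Real.cos θ ^ 2 *
      (PE θ h * Real.cos θ ^ 4 - 1 - 2 * Real.sin θ ^ 2) / SE θ h) := by
    intro θ
    have := nS θ
    have h1 := SE_eq θ hh
    have h2 : Real.sin θ ^ 2 = 1 - Real.cos θ ^ 2 := by linarith [Real.sin_sq_add_cos_sq θ]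
    have h4 : XE θ h ^ 2 = PE θ h * Real.cos θ ^ 2 := by
      rw [XE, neg_sq, mul_pow, Real.sq_sqrt (PE_pos θ hh).le]
    simp only [polarE, h4, zero_mul, add_zero]
    field_simp
    rw [h1]
    unfold sigma
    rw [h2]
    ring
  simp only [e]
  rw [intervalIntegral.integral_add, intervalIntegral.integral_sub, intervalIntegral.integral_add,
    intervalIntegral.integral_sub, intervalIntegral.integral_const_mul,
    intervalIntegral.integral_const_mul, intervalIntegral.integral_const_mul,
    intervalIntegral.integral_const_mul, h0, h0', h1]
  · simp [area, inertia]
  all_goals exact (by fun_prop : Continuous _).intervalIntegrable _ _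

lemma area_pos {h : ℝ} (hh : 0 < h) : 0 < area h :=
  intervalIntegral.intervalIntegral_pos_of_pos
    (((continuous_PE hh).div_const 2).intervalIntegrable _ _) (fun θ => by
      have := PE_pos θ hh; positivity) (by positivity)

lemma inertia_pos {h : ℝ} (hh : 0 < h) : 0 < inertia h := by
  refine intervalIntegral.integral_pos (by positivity)
    ((((continuous_PE hh).pow 2).mul (by fun_prop)).div_const 4).continuousOn
    (fun θ _ => by positivity) ⟨0, ⟨le_rfl, by positivity⟩, ?_⟩
  have := PE_pos 0 hh
  rw [Real.cos_zero]
  positivity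

lemma hasDerivAt_melnikovE (a : ℝ) {h : ℝ} (hh : 0 < h) :
    HasDerivAt (fun h => a * area h - inertia h)
      ((5 * (a + 4 * h) * (a * area h - inertia h) -
        area h * ((8 * a - 4) * h - 4 * a + 5 * a ^ 2)) / (4 * h * (4 * h + 1))) h := by
  refine (((hasDerivAt_area hh).const_mul a).sub (hasDerivAt_inertia hh)).congr_deriv ?_
  rw [eq_div_iff (by positivity)]
  linear_combination (-(a * (4 * h + 1))) * three_area hh + (a + 4 * h) * five_inertia hh

/-- An integrating factor for the Melnikov function outside the double loop. -/
noncomputable def factorE (a h : ℝ) : ℝ :=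
  h ^ (-(5 * a / 4)) * (4 * h + 1) ^ (-(5 * (1 - a) / 4))

lemma factorE_pos (a : ℝ) {h : ℝ} (hh : 0 < h) : 0 < factorE a h := by
  unfold factorE; positivity

lemma hasDerivAt_factorE (a : ℝ) {h : ℝ} (hh : 0 < h) :
    HasDerivAt (factorE a) (-(5 * (a + 4 * h) / (4 * h * (4 * h + 1))) * factorE a h) h := by
  have h4 : 0 < 4 * h + 1 := by linarith
  have h1 := (hasDerivAt_id h).rpow_const (p := -(5 * a / 4)) (Or.inl hh.ne')
  have h2 := (((hasDerivAt_id h).const_mul 4).add_const 1).rpow_const (p := -(5 * (1 - a) / 4))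
    (Or.inl h4.ne')
  refine (h1.mul h2).congr_deriv ?_
  simp only [id, factorE, Real.rpow_sub_one hh.ne', Real.rpow_sub_one h4.ne']
  field_simp
  ring

lemma hasDerivAt_scaledE (a : ℝ) {h : ℝ} (hh : 0 < h) :
    HasDerivAt (fun h => factorE a h * (a * area h - inertia h))
      (-(factorE a h * area h * ((8 * a - 4) * h - 4 * a + 5 * a ^ 2) / (4 * h * (4 * h + 1)))) h := by
  refine ((hasDerivAt_factorE a hh).mul (hasDerivAt_melnikovE a hh)).congr_deriv ?_
  field_simp
  ring

lemma nearFewE (a b : ℝ) {e : ℝ} (he : 0 < e) :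
    NearFew (mult (fun h => factorE a h * (a * area h - inertia h))
      (fun h => -(factorE a h * area h * ((8 * a - 4) * h - 4 * a + 5 * a ^ 2) /
        (4 * h * (4 * h + 1)))) e : ℕ) a b typeE e := by
  have hn : ∀ᶠ h in 𝓝 e, 0 < h := Ioi_mem_nhds he
  obtain ⟨c0, c1, c2⟩ := (liftE a b he).count (fun θ _ => contDiffAt_polarE a b θ he)
    (M := fun h => a * area h - inertia h) (hn.mono fun h hh => integral_polarE a b hh)
  have hφ := factorE_pos a he
  have hA := area_pos he
  unfold mult
  split_ifs with h0 h1
  · have hM : a * area e - inertia e = 0 := by simpa [hφ.ne'] using h0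
    have hg : (8 * a - 4) * e - 4 * a + 5 * a ^ 2 = 0 := by
      have : 4 * e * (4 * e + 1) ≠ 0 := by positivity
      rw [neg_eq_zero, div_eq_zero_iff, or_iff_left this] at h1
      simpa [hφ.ne', hA.ne'] using h1
    have hM' := hasDerivAt_melnikovE a he
    rw [hM, hg, mul_zero, mul_zero, sub_zero, zero_div] at hM'
    have d1 : HasDerivAt (fun h : ℝ => 5 * (a + 4 * h)) 20 e :=
      ((((hasDerivAt_id e).const_mul 4).const_add a).const_mul 5).congr_deriv (by norm_num)
    have d2 : HasDerivAt (fun h : ℝ => (8 * a - 4) * h - 4 * a + 5 * a ^ 2) (8 * a - 4) e :=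
      ((((hasDerivAt_id e).const_mul (8 * a - 4)).sub_const _).add_const _).congr_deriv (by simp)
    have d3 : HasDerivAt (fun h : ℝ => 4 * h * (4 * h + 1)) (32 * e + 4) e :=
      (((hasDerivAt_id e).const_mul 4).mul
        (((hasDerivAt_id e).const_mul 4).add_const 1)).congr_deriv (by simp; ring)
    refine c2 _ _ (hn.mono fun h hh => hasDerivAt_melnikovE a hh)
      (((d1.mul hM').sub ((hasDerivAt_area he).mul d2)).div d3 (by positivity)) ?_
    simp only [Pi.mul_apply, Pi.sub_apply, hM, hg, mul_zero, zero_mul, sub_zero, zero_add, add_zero,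
      zero_sub]
    refine div_ne_zero (mul_ne_zero (neg_ne_zero.2 (mul_ne_zero hA.ne' fun h => ?_))
      (by positivity)) (by positivity)
    have : a = 1 / 2 := by linarith
    rw [this] at hg
    norm_num at hg
  · have hM : a * area e - inertia e = 0 := by simpa [hφ.ne'] using h0
    refine c1 _ (hasDerivAt_melnikovE a he) fun h => h1 ?_
    rw [hM, mul_zero, zero_sub, neg_div, neg_eq_zero] at h
    simp only [mul_assoc, mul_div_assoc] at h ⊢
    rw [h, mul_zero, neg_zero]
  · exact c0 fun h => h0 (by simp only [h, mul_zero])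

lemma fewE (a b : ℝ) {K : Set ℝ} (hK : IsCompact K) (hKs : K ⊆ Ioi 0) :
    Few 2 a b {p | p ∈ typeE ∧ pot p.1 ∈ K} ∧
    (4 / 5 ≤ a → Few 1 a b {p | p ∈ typeE ∧ pot p.1 ∈ K}) ∧
    (a ≤ 0 → Few 0 a b {p | p ∈ typeE ∧ pot p.1 ∈ K}) := by
  have hm : ∀ e ∈ K, NearFew _ a b typeE e := fun e he => nearFewE a b (hKs he)
  have hf : ∀ e ∈ Ioi (0 : ℝ), HasDerivAt _ _ e := fun e he => hasDerivAt_scaledE a he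
  have hz : ∀ e ∈ Ioi (0 : ℝ), -(factorE a e * area e * ((8 * a - 4) * e - 4 * a + 5 * a ^ 2) /
      (4 * e * (4 * e + 1))) = 0 → (8 * a - 4) * e - 4 * a + 5 * a ^ 2 = 0 := fun e he h => by
    have he : 0 < e := he
    have h1 : 4 * e * (4 * e + 1) ≠ 0 := by positivity
    rw [neg_eq_zero, div_eq_zero_iff, or_iff_left h1] at h
    simpa [(factorE_pos a he).ne', (area_pos he).ne'] using h
  refine ⟨Few.of_compact hK hm fun S hS => sum_mult_le_two ordConnected_Ioi hf ?_ S (hS.trans hKs),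
    fun ha => Few.of_compact hK hm fun S hS => sum_mult_le_one ordConnected_Ioi hf ?_ S
      (hS.trans hKs), fun h => Few.of_compact hK hm fun S hS => ?_⟩
  · intro x hx y hy h0 h1
    have h0 := hz x hx h0
    have h1 := hz y hy h1
    have h2 : (8 * a - 4) * (x - y) = 0 := by linarith
    rcases mul_eq_zero.1 h2 with h | h
    · have : a = 1 / 2 := by linarith
      rw [this] at h0
      norm_num at h0
    · linarith
  · intro x hx h
    have h := hz x hx h
    have hx : 0 < x := hx
    nlinarith
  · refine (Finset.sum_eq_zero fun e he => ?_).le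
    have he : 0 < e := hKs (hS he)
    have hI := inertia_pos he
    rw [mult, if_neg]
    refine mul_ne_zero (factorE_pos a he).ne' ?_
    have := area_pos he
    nlinarith

/-! ### The limit of the Melnikov function at the loop -/

lemma weight_half_angle (u : ℝ) : weight (1 / √2) (2 * u) = 2 * Real.sin u ^ 2 := by
  have q : √2 ≠ 0 := by positivity
  rw [weight, mul_one_div_cancel q, Real.cos_two_mul]
  linear_combination (-2 : ℝ) * Real.sin_sq_add_cos_sq u

lemma sin_sq_le_weight {r : ℝ} (hr : r ∈ Ioo 0 (1 / √2)) (θ : ℝ) :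
    Real.sin θ ^ 2 ≤ 2 * weight r θ := by
  have h1 := Real.sin_sq_add_cos_sq θ
  have h2 := Real.cos_le_one θ
  have h3 := Real.neg_one_le_cos θ
  have h4 := (abs_lt.1 (mem_domain hr)).2
  have h5 : 0 < √2 * r := mul_pos (by positivity) hr.1
  unfold weight
  rcases le_total 0 (Real.cos θ) with h | h <;> nlinarith

lemma weight_le_two {r : ℝ} (hr : r ∈ Ioo 0 (1 / √2)) (θ : ℝ) : weight r θ ≤ 2 := by
  have h2 := Real.cos_le_one θ
  have h3 := Real.neg_one_le_cos θ
  have h4 := (abs_lt.1 (mem_domain hr)).2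
  have h5 : 0 < √2 * r := mul_pos (by positivity) hr.1
  unfold weight
  nlinarith

lemma tendsto_moment {p : ℝ}
    (hB : ∀ r ∈ Ioo 0 (1 / √2), ∀ θ, weight r θ ^ p * Real.sin θ ^ 2 ≤ 4) :
    Tendsto (moment 2 p) (𝓝[<] (1 / √2)) (𝓝 (moment 2 p (1 / √2))) := by
  have hn : ∀ᶠ r in 𝓝[<] (1 / √2), r ∈ Ioo 0 (1 / √2) :=
    Ioo_mem_nhdsLT (by positivity)
  refine intervalIntegral.tendsto_integral_filter_of_dominated_convergence (fun _ => 4)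
    (hn.mono fun r hr => ?_) (hn.mono fun r hr => Eventually.of_forall fun θ _ => ?_)
    (by simp) (Eventually.of_forall fun θ _ => ?_)
  · exact ((continuous_weight_rpow (mem_domain hr) p).mul (by fun_prop)).aestronglyMeasurable
  · have := (weight_pos (mem_domain hr) θ).le
    rw [Real.norm_of_nonneg (by positivity)]
    exact hB r hr θ
  · by_cases h : weight (1 / √2) θ = 0
    · have q : √2 ≠ 0 := by positivity
      have h1 := Real.sin_sq_add_cos_sq θ
      have hc : Real.cos θ = 1 := by
        rw [weight, mul_one_div_cancel q] at h
        linarith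
      have hs : Real.sin θ ^ 2 = 0 := by rw [hc] at h1; linarith
      simp [hs]
    · refine Tendsto.mul_const _ (Tendsto.rpow_const ?_ (Or.inl h))
      have : Continuous fun r => weight r θ := by unfold weight; fun_prop
      exact this.continuousAt.tendsto.mono_left nhdsWithin_le_nhds

lemma moment_half_angle (p : ℝ) :
    moment 2 p (1 / √2) =
      2 * ∫ u in (0 : ℝ)..Real.pi, (2 * Real.sin u ^ 2) ^ p * Real.sin (2 * u) ^ 2 := by
  rw [moment]
  have := intervalIntegral.integral_comp_mul_left (a := 0) (b := Real.pi) (c := 2)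
    (fun θ => weight (1 / √2) θ ^ p * Real.sin θ ^ 2) (by norm_num)
  simp only [weight_half_angle, mul_zero] at this
  rw [this, smul_eq_mul]
  ring

lemma moment_sqrt_limit : moment 2 (1 / 2) (1 / √2) = 32 * √2 / 15 := by
  rw [moment_half_angle]
  have hd : ∀ u ∈ uIcc 0 Real.pi, HasDerivAt
      (fun u => 4 * √2 * (Real.cos u ^ 5 / 5 - Real.cos u ^ 3 / 3))
      ((2 * Real.sin u ^ 2) ^ (1 / 2 : ℝ) * Real.sin (2 * u) ^ 2) u := by
    intro u hu
    rw [uIcc_of_le Real.pi_nonneg] at hu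
    have hs := Real.sin_nonneg_of_nonneg_of_le_pi hu.1 hu.2
    have h := Real.hasDerivAt_cos u
    refine ((((h.pow 5).div_const 5).sub ((h.pow 3).div_const 3)).const_mul (4 * √2)).congr_deriv ?_
    rw [← Real.sqrt_eq_rpow, Real.sqrt_mul (by norm_num), Real.sqrt_sq hs, Real.sin_two_mul]
    have h3 := Real.sin_sq_add_cos_sq u
    norm_num
    linear_combination (-4 * √2 * Real.cos u ^ 2 * Real.sin u) * h3
  rw [intervalIntegral.integral_eq_sub_of_hasDerivAt hd]
  · norm_num; ring
  · exact ContinuousOn.intervalIntegrable (by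
      have : Continuous fun u => (2 * Real.sin u ^ 2) ^ (1 / 2 : ℝ) :=
        Continuous.rpow_const (by fun_prop) fun _ => Or.inr (by norm_num)
      fun_prop)

lemma moment_inv_sqrt_limit : moment 2 (-1 / 2) (1 / √2) = 8 * √2 / 3 := by
  rw [moment_half_angle]
  have he : ∀ u ∈ uIcc 0 Real.pi, (2 * Real.sin u ^ 2) ^ (-1 / 2 : ℝ) * Real.sin (2 * u) ^ 2 =
      2 * √2 * Real.cos u ^ 2 * Real.sin u := by
    intro u hu
    rw [uIcc_of_le Real.pi_nonneg] at hu
    have hs := Real.sin_nonneg_of_nonneg_of_le_pi hu.1 hu.2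
    rw [neg_div, Real.rpow_neg (by positivity), ← Real.sqrt_eq_rpow, Real.sqrt_mul (by norm_num),
      Real.sqrt_sq hs, Real.sin_two_mul]
    rcases hs.eq_or_lt with h | h
    · simp [← h]
    · field_simp
      rw [Real.sq_sqrt (by norm_num)]
  rw [intervalIntegral.integral_congr he]
  have hd : ∀ u ∈ uIcc 0 Real.pi, HasDerivAt
      (fun u => 2 * √2 * (-Real.cos u ^ 3 / 3)) (2 * √2 * Real.cos u ^ 2 * Real.sin u) u := by
    intro u _
    have h := Real.hasDerivAt_cos u
    refine ((((h.pow 3).neg).div_const 3).const_mul (2 * √2)).congr_deriv ?_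
    norm_num
    ring
  rw [intervalIntegral.integral_eq_sub_of_hasDerivAt hd]
  · norm_num; ring
  · exact (by fun_prop : Continuous _).intervalIntegrable _ _

lemma tendsto_GR (a b : ℝ) : Tendsto (GR a b) (𝓝[<] (1 / √2))
    (𝓝 (a * (8 * √2 / 3) + b * Real.pi - 32 * √2 / 15)) := by
  rw [← moment_sqrt_limit, ← moment_inv_sqrt_limit]
  refine (((tendsto_moment fun r hr θ => ?_).const_mul a).add_const _).sub
    (tendsto_moment fun r hr θ => ?_)
  · have hw := weight_pos (mem_domain hr) θ
    have h2 := weight_le_two hr θ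
    have h3 := sin_sq_le_weight hr θ
    rw [neg_div, Real.rpow_neg hw.le, ← Real.sqrt_eq_rpow, inv_mul_le_iff₀ (Real.sqrt_pos.2 hw)]
    have h4 := Real.sq_sqrt hw.le
    have h5 : 0 < √(weight r θ) := Real.sqrt_pos.2 hw
    nlinarith
  · have hw := weight_pos (mem_domain hr) θ
    have h2 := weight_le_two hr θ
    have h3 := Real.sin_sq_le_one θ
    rw [← Real.sqrt_eq_rpow]
    have h4 := Real.sq_sqrt hw.le
    have h5 : 0 < √(weight r θ) := Real.sqrt_pos.2 hw
    have h6 : √(weight r θ) ≤ 4 := by nlinarith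
    nlinarith [sq_nonneg (Real.sin θ)]

lemma GR_lt {a : ℝ} (ha : 0 ≤ a) (b : ℝ) {r : ℝ} (hr : r ∈ Ioo 0 (1 / √2)) :
    GR a b r < a * (8 * √2 / 3) + b * Real.pi - 32 * √2 / 15 := by
  have hm : StrictMonoOn (GR a b) (Ioo 0 (1 / √2)) := by
    refine strictMonoOn_of_deriv_pos (convex_Ioo _ _)
      (fun r hr => (hasDerivAt_GR a b (mem_domain hr)).continuousAt.continuousWithinAt)
      fun r hr => ?_
    rw [interior_Ioo] at hr
    rw [(hasDerivAt_GR a b (mem_domain hr)).deriv]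
    have h3 := moment_pos (mem_domain hr) (m := 4) (by decide) (-3 / 2)
    have h5 := moment_pos (mem_domain hr) (m := 4) (by decide) (-5 / 2)
    have := hr.1
    unfold NR
    positivity
  obtain ⟨s, hs⟩ := exists_between hr.2
  have hs' : s ∈ Ioo 0 (1 / √2) := ⟨hr.1.trans hs.1, hs.2⟩
  refine (hm hr hs' hs.1).trans_le (ge_of_tendsto (tendsto_GR a b) ?_)
  filter_upwards [Ioo_mem_nhdsLT hs.2] with t ht
  exact (hm hs' ⟨hs'.1.trans ht.1, ht.2⟩ ht.1).le

lemma GR_ne_zero {a b : ℝ} (h : (a ≤ 0 ∧ b ≤ 0) ∨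
    (0 ≤ a ∧ a * (8 * √2 / 3) + b * Real.pi - 32 * √2 / 15 ≤ 0)) {r : ℝ}
    (hr : r ∈ Ioo 0 (1 / √2)) : GR a b r ≠ 0 := by
  rcases h with ⟨ha, hb⟩ | ⟨ha, h⟩
  · have h1 := moment_pos (mem_domain hr) (m := 2) (by decide) (-1 / 2)
    have h2 := moment_pos (mem_domain hr) (m := 2) (by decide) (1 / 2)
    have h3 := Real.pi_pos
    unfold GR
    nlinarith
  · exact ((GR_lt ha b hr).trans_le h).ne

/-! ### The neighbourhood of the double homoclinic loop: Melnikov integrals -/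

lemma abs_sub_sqrt_le {y p c : ℝ} (hy : 0 ≤ y) (h : |y ^ 2 - p| ≤ c) : |y - √p| ≤ √c := by
  refine Real.abs_le_sqrt ?_
  have h1 := abs_le.1 h
  rcases le_total 0 p with hp | hp
  · have h2 := Real.sq_sqrt hp
    have h3 := Real.sqrt_nonneg p
    rcases le_total y √p with h4 | h4 <;> nlinarith
  · rw [Real.sqrt_eq_zero_of_nonpos hp, sub_zero]
    linarith

/-- The upper half of the double loop `y² = x² - x⁴/2`. -/
noncomputable def loopY (ξ : ℝ) : ℝ := √(-2 * pot ξ)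

lemma continuous_loopY : Continuous loopY := by
  have := continuous_pot
  unfold loopY; fun_prop

lemma Cycle.integral_loopY_le {ε a b : ℝ} (hε : 0 < ε) (C : Cycle ε a b) {l r c V : ℝ}
    (hl : l ≤ C.α) (hr : C.β ≤ r) (hc : 0 ≤ c) (hV : ∀ ξ ∈ Icc l r, |a + b * ξ - ξ ^ 2| ≤ V)
    (hin : ∀ ξ ∈ Icc C.α C.β, |C.Y ξ ^ 2 / 2 + pot ξ| ≤ c ^ 2 / 2 ∧
      |C.Z ξ ^ 2 / 2 + pot ξ| ≤ c ^ 2 / 2)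
    (hout : ∀ ξ ∈ Icc l r, ξ ∉ Icc C.α C.β → -(c ^ 2 / 2) ≤ pot ξ) :
    |∫ ξ in l..r, (a + b * ξ - ξ ^ 2) * loopY ξ| ≤ V * c * (r - l) := by
  have hlr : l ≤ r := hl.trans (C.lt.le.trans hr)
  have key : ∀ ξ ∈ Icc l r, |C.Y ξ - loopY ξ| ≤ c ∧ |C.Z ξ - loopY ξ| ≤ c := by
    intro ξ hξ
    have e : c = √(c ^ 2) := (Real.sqrt_sq hc).symm
    by_cases h : ξ ∈ Icc C.α C.β
    · obtain ⟨h1, h2⟩ := hin ξ h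
      rw [e]
      rw [abs_le] at h1 h2
      exact ⟨abs_sub_sqrt_le (C.up.nonneg ξ) (abs_le.2 ⟨by linarith, by linarith⟩),
        abs_sub_sqrt_le (C.lo.nonneg ξ) (abs_le.2 ⟨by linarith, by linarith⟩)⟩
    · have h0 : C.Y ξ = 0 ∧ C.Z ξ = 0 := by
        rcases le_or_gt ξ C.α with h1 | h1
        · exact ⟨C.up.zero_left ξ h1, C.lo.zero_left ξ h1⟩
        · have h2 : C.β ≤ ξ := not_lt.1 fun h2 => h ⟨h1.le, h2.le⟩
          exact ⟨C.up.zero_right ξ h2, C.lo.zero_right ξ h2⟩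
      have h3 := hout ξ hξ h
      rw [h0.1, h0.2, zero_sub, abs_neg, loopY, abs_of_nonneg (Real.sqrt_nonneg _)]
      have : √(-2 * pot ξ) ≤ c := by
        rw [e]; exact Real.sqrt_le_sqrt (by linarith)
      exact ⟨this, this⟩
  have cY := C.up.cont
  have cZ := C.lo.cont
  have cL := continuous_loopY
  have h2 : 2 * ∫ ξ in l..r, (a + b * ξ - ξ ^ 2) * loopY ξ =
      ∫ ξ in l..r, (a + b * ξ - ξ ^ 2) * (2 * loopY ξ - (C.Y ξ + C.Z ξ)) := by
    have h3 := C.balance hε hl hr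
    simp only [mul_sub, mul_left_comm _ (2 : ℝ)]
    rw [intervalIntegral.integral_sub, h3, intervalIntegral.integral_const_mul, sub_zero]
    all_goals exact (by fun_prop : Continuous _).intervalIntegrable _ _
  have h4 := intervalIntegral.norm_integral_le_of_norm_le_const (a := l) (b := r) (C := V * (2 * c))
    (f := fun ξ => (a + b * ξ - ξ ^ 2) * (2 * loopY ξ - (C.Y ξ + C.Z ξ))) (fun ξ hξ => by
      rw [uIoc_of_le hlr] at hξ
      have hξ := Ioc_subset_Icc_self hξ
      obtain ⟨k1, k2⟩ := key ξ hξ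
      rw [Real.norm_eq_abs, abs_mul]
      refine mul_le_mul (hV ξ hξ) ?_ (abs_nonneg _) ((abs_nonneg _).trans (hV ξ hξ))
      rw [abs_le] at k1 k2 ⊢
      constructor <;> linarith)
  rw [← h2, Real.norm_eq_abs, abs_mul, abs_two, abs_of_nonneg (sub_nonneg.2 hlr)] at h4
  linarith

lemma pot_anti_right {x y : ℝ} (hx : 0 ≤ x) (hxy : x ≤ y) (hy : y ≤ 1) : pot y ≤ pot x := by
  unfold pot
  have h1 : x ^ 2 ≤ y ^ 2 := pow_le_pow_left₀ hx hxy 2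
  have h2 : y ^ 2 ≤ 1 := pow_le_one₀ (hx.trans hxy) hy
  nlinarith [mul_nonneg (sub_nonneg.2 h1) (by linarith : 0 ≤ 2 - (x ^ 2 + y ^ 2))]

lemma pot_mono_right {x y : ℝ} (hx : 1 ≤ x) (hxy : x ≤ y) : pot x ≤ pot y := by
  unfold pot
  have h1 : x ^ 2 ≤ y ^ 2 := pow_le_pow_left₀ (by linarith) hxy 2
  have h2 : 1 ≤ x ^ 2 := one_le_pow₀ hx
  nlinarith [mul_nonneg (sub_nonneg.2 h1) (by linarith : 0 ≤ x ^ 2 + y ^ 2 - 2)]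

lemma pot_neg (x : ℝ) : pot (-x) = pot x := by unfold pot; ring

lemma Cycle.one_lt_β {ε a b : ℝ} (C : Cycle ε a b) (h : 0 < C.β) : 1 < C.β := by
  have := C.right
  by_contra! h1
  nlinarith [mul_nonneg h.le (mul_nonneg (sub_nonneg.2 h1) (by linarith : 0 ≤ 1 + C.β))]

lemma Cycle.α_lt_neg_one {ε a b : ℝ} (C : Cycle ε a b) (h : C.α < 0) : C.α < -1 := by
  have := C.left
  by_contra! h1
  nlinarith [mul_nonneg (neg_nonneg.2 h.le) (mul_nonneg (by linarith : 0 ≤ 1 - C.α)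
    (by linarith : 0 ≤ 1 + C.α))]

lemma Cycle.α_lt_one {ε a b : ℝ} (C : Cycle ε a b) : C.α < 1 := by
  have := C.left
  by_contra! h1
  nlinarith [mul_nonneg (by linarith : 0 ≤ C.α) (mul_nonneg (by linarith : 0 ≤ C.α - 1)
    (by linarith : 0 ≤ 1 + C.α))]

lemma Cycle.neg_one_lt_β {ε a b : ℝ} (C : Cycle ε a b) : -1 < C.β := by
  have := C.right
  by_contra! h1
  nlinarith [mul_nonneg (by linarith : 0 ≤ -C.β) (mul_nonneg (by linarith : 0 ≤ 1 - C.β)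
    (by linarith : 0 ≤ -C.β - 1))]

/-- Closed orbits near the loop do not exist when the Melnikov integral does not vanish. -/
lemma nearFew_zero_of_integral {a b : ℝ} {A : Set (ℝ × ℝ)} {m : ℝ} (hm : m ≠ 0)
    (h : ∃ R : ℝ, ∀ M ≥ R, ∃ l, -M ≤ l ∧ l ≤ M ∧
      (∀ ε (C : Cycle ε a b), (C.α, C.β) ∈ A → -M ≤ C.α → l ≤ C.α ∧ 0 < C.β) ∧
      (∀ ε (C : Cycle ε a b), (C.α, C.β) ∈ A → ∀ ξ, l ≤ ξ → ξ ≤ C.α → pot C.α ≤ pot ξ) ∧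
      ∫ ξ in l..M, (a + b * ξ - ξ ^ 2) * loopY ξ = m) : NearFew 0 a b A 0 := by
  obtain ⟨R, hR⟩ := h
  obtain ⟨M₀, hM₀, hM⟩ := exists_bound a b
  obtain ⟨K, hK, hosc⟩ := exists_oscillation a b
  obtain ⟨l, h1, h2, h3, h4, h5⟩ := hR (max R M₀) (le_max_left _ _)
  set M := max R M₀
  have hMp : 0 < M := hM₀.trans_le (le_max_right _ _)
  set V := |a| + |b| * M + M ^ 2
  set c := |m| / (V * (2 * M) + 1)
  have hV : 0 ≤ V := by positivity
  have hc : 0 < c := by have := abs_pos.2 hm; positivity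
  refine ⟨c ^ 2 / 4, by positivity, Few.zero ⟨min 1 (c ^ 2 / 4 / K), by positivity,
    fun ε h0 hε C hC => ?_⟩⟩
  rw [lt_min_iff, lt_div_iff₀ hK] at hε
  obtain ⟨hCA, hCe⟩ := hC
  rw [sub_zero, abs_lt] at hCe
  obtain ⟨b1, b2, -⟩ := hM ε h0 hε.1.le C
  have b1 : -M ≤ C.α := (neg_le_neg (le_max_right _ _)).trans b1
  have b2 : C.β ≤ M := b2.trans (le_max_right _ _)
  obtain ⟨c1, c2⟩ := h3 ε C hCA b1
  have hin : ∀ ξ ∈ Icc C.α C.β, |C.Y ξ ^ 2 / 2 + pot ξ| ≤ c ^ 2 / 2 ∧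
      |C.Z ξ ^ 2 / 2 + pot ξ| ≤ c ^ 2 / 2 := fun ξ hξ => by
    obtain ⟨o1, o2⟩ := hosc ε h0 hε.1.le C ξ hξ
    rw [abs_le] at o1 o2
    constructor <;> rw [abs_le] <;> constructor <;> nlinarith
  have key := C.integral_loopY_le h0 c1 b2 hc.le (V := V) (fun ξ hξ => ?_) hin fun ξ hξ hn => ?_
  · rw [h5] at key
    have e : |m| = c * (V * (2 * M) + 1) := by
      simp only [c]; field_simp
    have : V * c * (M - l) ≤ V * c * (2 * M) := by
      refine mul_le_mul_of_nonneg_left ?_ (by positivity)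
      linarith
    nlinarith
  · have hξ' : |ξ| ≤ M := abs_le.2 ⟨h1.trans hξ.1, hξ.2⟩
    calc |a + b * ξ - ξ ^ 2| ≤ |a| + |b * ξ| + |ξ ^ 2| :=
          (abs_sub _ _).trans (add_le_add (abs_add_le _ _) le_rfl)
      _ ≤ _ := by
          rw [abs_mul, abs_pow]
          show _ ≤ |a| + |b| * M + M ^ 2
          gcongr
  · rcases lt_or_ge ξ C.α with h6 | h6
    · have := h4 ε C hCA ξ hξ.1 h6.le
      nlinarith
    · have h7 : C.β < ξ := not_le.1 fun h7 => hn ⟨h6, h7⟩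
      have h8 := pot_mono_right (C.one_lt_β c2).le h7.le
      have h9 := (abs_le.1 (hin C.β (right_mem_Icc.2 C.lt.le)).1).1
      rw [C.up.zero_right _ le_rfl] at h9
      nlinarith

lemma integral_loopY_sqrt_two (a b : ℝ) :
    ∫ ξ in (0 : ℝ)..√2, (a + b * ξ - ξ ^ 2) * loopY ξ =
      2 / 3 * a + b * (√2 * Real.pi / 8) - 8 / 15 := by
  have q2 : √2 ^ 2 = 2 := Real.sq_sqrt (by norm_num)
  have cL := continuous_loopY
  have h := intervalIntegral.integral_comp_mul_deriv (a := 0) (b := Real.pi / 2)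
    (f := fun φ => √2 * Real.sin φ) (f' := fun φ => √2 * Real.cos φ)
    (g := fun ξ => (a + b * ξ - ξ ^ 2) * loopY ξ)
    (fun φ _ => (Real.hasDerivAt_sin φ).const_mul √2) (by fun_prop) (by fun_prop)
  simp only [Real.sin_zero, mul_zero, Real.sin_pi_div_two, mul_one, Function.comp_def] at h
  rw [← h]
  have hd : ∀ φ ∈ uIcc 0 (Real.pi / 2), HasDerivAt (fun φ => -(2 / 3 * a) * Real.cos φ ^ 3 +
      b * √2 / 4 * (φ - Real.sin φ * Real.cos φ * (Real.cos φ ^ 2 - Real.sin φ ^ 2)) +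
      4 * (Real.cos φ ^ 3 / 3 - Real.cos φ ^ 5 / 5))
      ((a + b * (√2 * Real.sin φ) - (√2 * Real.sin φ) ^ 2) * loopY (√2 * Real.sin φ) *
        (√2 * Real.cos φ)) φ := by
    intro φ hφ
    rw [uIcc_of_le (by positivity)] at hφ
    have hs := Real.sin_nonneg_of_nonneg_of_le_pi hφ.1 (by linarith [hφ.2, Real.pi_pos])
    have hc := Real.cos_nonneg_of_neg_pi_div_two_le_of_le (by linarith [hφ.1, Real.pi_pos]) hφ.2
    have h3 := Real.sin_sq_add_cos_sq φ
    have e : loopY (√2 * Real.sin φ) = √2 * (Real.sin φ * Real.cos φ) := by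
      rw [loopY, ← Real.sqrt_sq (by positivity : 0 ≤ √2 * (Real.sin φ * Real.cos φ))]
      congr 1
      unfold pot
      rw [mul_pow, mul_pow, mul_pow, mul_pow, show √2 ^ 4 = (√2 ^ 2) ^ 2 by ring, q2]
      linear_combination (-2 * Real.sin φ ^ 2) * h3
    have dc := Real.hasDerivAt_cos φ
    have ds := Real.hasDerivAt_sin φ
    refine ((((dc.pow 3).const_mul (-(2 / 3 * a))).add (((hasDerivAt_id φ).sub
      ((ds.mul dc).mul ((dc.pow 2).sub (ds.pow 2)))).const_mul (b * √2 / 4))).add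
      ((((dc.pow 3).div_const 3).sub ((dc.pow 5).div_const 5)).const_mul 4)).congr_deriv ?_
    rw [e]
    have h4 : Real.sin φ ^ 2 = 1 - Real.cos φ ^ 2 := by linarith
    have h5 : Real.sin φ ^ 4 = (1 - Real.cos φ ^ 2) ^ 2 := by rw [← h4]; ring
    have h6 : Real.sin φ ^ 3 = (1 - Real.cos φ ^ 2) * Real.sin φ := by rw [← h4]; ring
    have q3 : √2 ^ 3 = 2 * √2 := by rw [pow_succ, q2]
    have q4 : √2 ^ 4 = 4 := by rw [show √2 ^ 4 = (√2 ^ 2) ^ 2 by ring, q2]; norm_num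
    simp only [Pi.mul_apply, Pi.pow_apply, Pi.sub_apply]
    norm_num
    ring_nf
    simp only [h4, h5, h6, q2, q3, q4]
    ring
  rw [intervalIntegral.integral_eq_sub_of_hasDerivAt hd]
  · norm_num
    ring
  · exact (by fun_prop : Continuous _).intervalIntegrable _ _

lemma integral_loopY (a b : ℝ) {M : ℝ} (hM : √2 ≤ M) :
    ∫ ξ in (0 : ℝ)..M, (a + b * ξ - ξ ^ 2) * loopY ξ =
      2 / 3 * a + b * (√2 * Real.pi / 8) - 8 / 15 := by
  have cL := continuous_loopY
  have c : Continuous fun ξ => (a + b * ξ - ξ ^ 2) * loopY ξ := by fun_prop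
  rw [← intervalIntegral.integral_add_adjacent_intervals (b := √2)
    (c.intervalIntegrable _ _) (c.intervalIntegrable _ _), integral_loopY_sqrt_two]
  have h0 : ∀ ξ ∈ uIcc √2 M, (a + b * ξ - ξ ^ 2) * loopY ξ = 0 := by
    intro ξ hξ
    rw [uIcc_of_le hM] at hξ
    have q2 : √2 ^ 2 = 2 := Real.sq_sqrt (by norm_num)
    have : 2 ≤ ξ ^ 2 := by rw [← q2]; exact pow_le_pow_left₀ (by positivity) hξ.1 2
    rw [loopY, Real.sqrt_eq_zero_of_nonpos, mul_zero]
    unfold pot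
    nlinarith
  rw [intervalIntegral.integral_congr h0]
  simp

lemma nearFewR_loop {a b : ℝ} (h : 2 / 3 * a + b * (√2 * Real.pi / 8) - 8 / 15 ≠ 0) :
    NearFew 0 a b typeR 0 := by
  refine nearFew_zero_of_integral h ⟨√2, fun M hM => ⟨0, ?_, ?_, fun ε C hC _ => ?_,
    fun ε C hC ξ h1 h2 => ?_, integral_loopY a b hM⟩⟩
  · have : 0 ≤ √2 := by positivity
    linarith
  · exact (Real.sqrt_nonneg 2).trans hM
  · have h1 : 0 < C.α := hC
    exact ⟨h1.le, h1.trans C.lt⟩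
  · exact pot_anti_right h1 h2 C.α_lt_one.le

lemma nearFewE_loop {a b : ℝ} (h : a ≠ 4 / 5) : NearFew 0 a b typeE 0 := by
  refine nearFew_zero_of_integral (m := 2 * (2 / 3 * a - 8 / 15)) (fun h1 => h (by linarith))
    ⟨√2, fun M hM => ⟨-M, le_rfl, ?_, fun ε C hC h1 => ⟨h1, hC.2⟩, fun ε C hC ξ h1 h2 => ?_, ?_⟩⟩
  · have : 0 ≤ √2 := by positivity
    linarith
  · have := C.α_lt_neg_one hC.1
    have := pot_mono_right (x := -C.α) (y := -ξ) (by linarith) (by linarith)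
    rwa [pot_neg, pot_neg] at this
  · have cL := continuous_loopY
    have c : Continuous fun ξ => (a + b * ξ - ξ ^ 2) * loopY ξ := by fun_prop
    rw [← intervalIntegral.integral_add_adjacent_intervals (b := 0)
      (c.intervalIntegrable _ _) (c.intervalIntegrable _ _), integral_loopY a b hM]
    have h1 := intervalIntegral.integral_comp_neg (a := 0) (b := M)
      (fun ξ => (a + b * ξ - ξ ^ 2) * loopY ξ)
    have h2 := integral_loopY a (-b) hM
    rw [neg_zero] at h1
    rw [← h1]
    have e : ∀ ξ, (a + b * -ξ - (-ξ) ^ 2) * loopY (-ξ) = (a + -b * ξ - ξ ^ 2) * loopY ξ := by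
      intro ξ
      rw [loopY, loopY, pot_neg]; ring
    simp only [e]
    rw [h2]
    ring

/-! ### The neighbourhood of the double homoclinic loop: Dulac weights -/

/-- There are Dulac weights which are effective on thin neighbourhoods of the double loop, over
the abscissas in `J`. -/
def HasWeight (a b : ℝ) (J : Set ℝ) : Prop :=
  ∀ M, 0 < M → ∃ s s' : ℝ → ℝ, ∃ σ : ℝ, Continuous s ∧
    (∀ ξ, ξ ∉ ({0} : Finset ℝ) → HasDerivAt s (s' ξ) ξ) ∧ (σ = 1 ∨ σ = -1) ∧
    ∃ δ > 0, ∀ ε, 0 < ε → ε < δ → ∀ ξ ∈ J, ∀ y, ξ ≠ 0 → |ξ| ≤ M → |y| ≤ M →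
      |y ^ 2 / 2 + pot ξ| < δ →
      0 < σ * (a + b * ξ - ξ ^ 2 + y ^ 2 * s' ξ + (ξ - ξ ^ 3) * s ξ +
        2 * ε * y * s ξ * (a + b * ξ - ξ ^ 2))

lemma HasWeight.mono {a b : ℝ} {J J' : Set ℝ} (h : HasWeight a b J) (hJ : J' ⊆ J) :
    HasWeight a b J' := by
  intro M hM
  obtain ⟨s, s', σ, h1, h2, h3, δ, hδ, h4⟩ := h M hM
  exact ⟨s, s', σ, h1, h2, h3, δ, hδ, fun ε h0 h1 ξ hξ => h4 ε h0 h1 ξ (hJ hξ)⟩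

/-- The function `log (1 + ξ² / m) / ξ` and its derivative. -/
lemma hasDerivAt_log_div {m ξ : ℝ} (hm : 0 < m) (hξ : ξ ≠ 0) :
    HasDerivAt (fun ξ => Real.log (1 + ξ ^ 2 / m) / ξ)
      (2 / (ξ ^ 2 + m) - Real.log (1 + ξ ^ 2 / m) / ξ ^ 2) ξ := by
  have h1 : 0 < 1 + ξ ^ 2 / m := by positivity
  have h2 : HasDerivAt (fun ξ : ℝ => 1 + ξ ^ 2 / m) (2 * ξ / m) ξ :=
    (((hasDerivAt_pow 2 ξ).div_const m).const_add 1).congr_deriv (by simp)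
  refine ((h2.log h1.ne').div (hasDerivAt_id ξ) hξ).congr_deriv ?_
  have h3 : ξ ^ 2 + m ≠ 0 := by positivity
  have h4 : m + ξ ^ 2 ≠ 0 := by positivity
  simp only [id]
  generalize Real.log (1 + ξ ^ 2 / m) = L
  field_simp
  ring

lemma log_one_add_mem {m : ℝ} (hm : 0 < m) (ξ : ℝ) :
    0 ≤ Real.log (1 + ξ ^ 2 / m) ∧ Real.log (1 + ξ ^ 2 / m) ≤ ξ ^ 2 / m := by
  have h : 0 ≤ ξ ^ 2 / m := by positivity
  refine ⟨Real.log_nonneg (by linarith), ?_⟩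
  have := Real.log_le_sub_one_of_pos (x := 1 + ξ ^ 2 / m) (by linarith)
  linarith

lemma abs_log_div_le {m : ℝ} (hm : 0 < m) (ξ : ℝ) :
    |Real.log (1 + ξ ^ 2 / m) / ξ| ≤ |ξ| / m := by
  rcases eq_or_ne ξ 0 with rfl | hξ
  · simp
  · have h := log_one_add_mem hm ξ
    rw [abs_div, abs_of_nonneg h.1, div_le_iff₀ (abs_pos.2 hξ)]
    refine h.2.trans (le_of_eq ?_)
    rw [div_mul_eq_mul_div, abs_mul_abs_self, sq]

lemma continuous_log_div {m : ℝ} (hm : 0 < m) :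
    Continuous fun ξ : ℝ => Real.log (1 + ξ ^ 2 / m) / ξ := by
  rw [continuous_iff_continuousAt]
  intro ξ
  rcases eq_or_ne ξ 0 with rfl | hξ
  · rw [ContinuousAt, div_zero]
    refine squeeze_zero_norm (fun ξ => abs_log_div_le hm ξ) ?_
    have : Continuous fun ξ : ℝ => |ξ| / m := by fun_prop
    simpa using this.tendsto 0
  · exact (hasDerivAt_log_div hm hξ).continuousAt

lemma exists_log_large (κ B M : ℝ) (hκ : 0 < κ) (hB : 0 ≤ B) (hM : 0 < M) : ∃ m : ℝ, 0 < m ∧ ∀ ξ,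
    |ξ| ≤ M → κ / 4 ≤ κ / 2 + κ / 8 * (ξ ^ 2 * Real.log (1 + ξ ^ 2 / m)) - B * |ξ| - ξ ^ 2 := by
  set ρ : ℝ := κ / (4 * (B + M))
  have hρ : 0 < ρ := by positivity
  set L : ℝ := (B * M + M ^ 2) / (κ / 8 * ρ ^ 2)
  refine ⟨ρ ^ 2 / Real.exp L, by positivity, fun ξ hξ => ?_⟩
  have h0 := abs_nonneg ξ
  have e : ξ ^ 2 = |ξ| ^ 2 := (sq_abs ξ).symm
  have hm : 0 < ρ ^ 2 / Real.exp L := by positivity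
  have h1 := (log_one_add_mem hm ξ).1
  rcases le_total |ξ| ρ with h2 | h2
  · have h3 : B * |ξ| + ξ ^ 2 ≤ ρ * (B + M) := by rw [e]; nlinarith
    have h4 : ρ * (B + M) = κ / 4 := by simp only [ρ]; field_simp
    have : 0 ≤ κ / 8 * (ξ ^ 2 * Real.log (1 + ξ ^ 2 / (ρ ^ 2 / Real.exp L))) := by positivity
    linarith
  · have h3 : L ≤ Real.log (1 + ξ ^ 2 / (ρ ^ 2 / Real.exp L)) := by
      rw [Real.le_log_iff_exp_le (by positivity)]
      have : Real.exp L ≤ ξ ^ 2 / (ρ ^ 2 / Real.exp L) := by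
        rw [le_div_iff₀ hm, mul_div_cancel₀ _ (Real.exp_pos L).ne', e]
        exact pow_le_pow_left₀ hρ.le h2 2
      linarith
    have h4 : κ / 8 * ρ ^ 2 * L = B * M + M ^ 2 := by
      simp only [L]; field_simp
    have hL : 0 ≤ L := by positivity
    have h5 : ρ ^ 2 * L ≤ ξ ^ 2 * Real.log (1 + ξ ^ 2 / (ρ ^ 2 / Real.exp L)) := by
      refine mul_le_mul ?_ h3 hL (sq_nonneg _)
      rw [e]; exact pow_le_pow_left₀ hρ.le h2 2
    have h6 : B * |ξ| + ξ ^ 2 ≤ B * M + M ^ 2 := by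
      rw [e]; gcongr
    nlinarith

lemma log_weight_eq {m ξ y : ℝ} (hm : 0 < m) (hξ : ξ ≠ 0) :
    y ^ 2 * (2 / (ξ ^ 2 + m) - Real.log (1 + ξ ^ 2 / m) / ξ ^ 2) +
      (ξ - ξ ^ 3) * (Real.log (1 + ξ ^ 2 / m) / ξ) =
    2 * (y ^ 2 / 2 + pot ξ) * (2 / (ξ ^ 2 + m) - Real.log (1 + ξ ^ 2 / m) / ξ ^ 2) +
      (2 - (2 * m + ξ ^ 4) / (ξ ^ 2 + m)) -
      ξ ^ 2 * Real.log (1 + ξ ^ 2 / m) / 2 := by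
  have h3 : ξ ^ 2 + m ≠ 0 := by positivity
  generalize Real.log (1 + ξ ^ 2 / m) = L
  unfold pot
  field_simp
  ring

lemma hasWeight_of_ne {a b : ℝ} (ha : a ≠ 0) : HasWeight a b univ := by
  intro M hM
  set κ := |a|
  have hκ : 0 < κ := abs_pos.2 ha
  obtain ⟨m, hm, hlarge⟩ := exists_log_large κ |b| M hκ (abs_nonneg b) hM
  obtain ⟨σ, hσ, hσa⟩ : ∃ σ : ℝ, (σ = 1 ∨ σ = -1) ∧ σ * a = κ := by
    rcases lt_or_gt_of_ne ha with h | h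
    · exact ⟨-1, Or.inr rfl, by simp only [κ, abs_of_neg h]; ring⟩
    · exact ⟨1, Or.inl rfl, by simp only [κ, abs_of_pos h]; ring⟩
  have hσ1 : |σ| = 1 := by rcases hσ with rfl | rfl <;> simp
  set V := |a| + |b| * M + M ^ 2
  have hV : 0 ≤ V := by positivity
  set δ := min (m / 16) (κ / (2 * (8 * M * (κ / 4 * (M / m)) * V + κ)))
  have hden : 0 < 8 * M * (κ / 4 * (M / m)) * V + κ := by positivity
  have hδ : 0 < δ := by positivity
  refine ⟨fun ξ => -(a / 4) * (Real.log (1 + ξ ^ 2 / m) / ξ),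
    fun ξ => -(a / 4) * (2 / (ξ ^ 2 + m) - Real.log (1 + ξ ^ 2 / m) / ξ ^ 2), σ,
    (continuous_log_div hm).const_mul _, fun ξ hξ => ?_, hσ, δ, hδ,
    fun ε h0 h1 ξ _ y hξ0 hξ hy hH => ?_⟩
  · exact (hasDerivAt_log_div hm (by simpa using hξ)).const_mul _
  · dsimp only
    have hsq : 0 < ξ ^ 2 := by positivity
    have hl := hlarge ξ hξ
    have hE := log_weight_eq (y := y) hm hξ0
    have hb := abs_log_div_le hm ξ
    have hv : |a + b * ξ - ξ ^ 2| ≤ V :=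
      calc |a + b * ξ - ξ ^ 2| ≤ |a| + |b * ξ| + |ξ ^ 2| :=
          (abs_sub _ _).trans (add_le_add (abs_add_le _ _) le_rfl)
        _ ≤ _ := by
          rw [abs_mul, abs_pow]
          show _ ≤ |a| + |b| * M + M ^ 2
          gcongr
    have hd : |2 / (ξ ^ 2 + m) - Real.log (1 + ξ ^ 2 / m) / ξ ^ 2| ≤ 2 / m := by
      obtain ⟨k1, k2⟩ := log_one_add_mem hm ξ
      have k3 : 2 / (ξ ^ 2 + m) ≤ 2 / m := by gcongr; linarith
      have k4 : 0 ≤ 2 / (ξ ^ 2 + m) := by positivity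
      have k5 : Real.log (1 + ξ ^ 2 / m) / ξ ^ 2 ≤ 1 / m := by
        rw [div_le_div_iff₀ hsq hm]
        rw [le_div_iff₀ hm] at k2; linarith
      have k6 : 0 ≤ Real.log (1 + ξ ^ 2 / m) / ξ ^ 2 := by positivity
      have k7 : 1 / m ≤ 2 / m := by gcongr; norm_num
      rw [abs_le]; constructor <;> linarith
    have hq : 0 ≤ (2 * m + ξ ^ 4) / (ξ ^ 2 + m) := by positivity
    generalize (2 * m + ξ ^ 4) / (ξ ^ 2 + m) = Q at *
    generalize 2 / (ξ ^ 2 + m) - Real.log (1 + ξ ^ 2 / m) / ξ ^ 2 = D at *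
    generalize Real.log (1 + ξ ^ 2 / m) / ξ = S at *
    generalize Real.log (1 + ξ ^ 2 / m) = L at *
    generalize y ^ 2 / 2 + pot ξ = H at *
    have e1 : σ * (a + b * ξ - ξ ^ 2 + y ^ 2 * (-(a / 4) * D) + (ξ - ξ ^ 3) * (-(a / 4) * S) +
        2 * ε * y * (-(a / 4) * S) * (a + b * ξ - ξ ^ 2)) =
        κ / 2 + κ / 4 * Q + κ / 8 * (ξ ^ 2 * L) + σ * (b * ξ - ξ ^ 2) - κ / 4 * (2 * H * D) -
        2 * ε * y * (κ / 4 * S) * (a + b * ξ - ξ ^ 2) := by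
      rw [← hσa]
      linear_combination (-σ * a / 4) * hE
    rw [e1]
    have t1 : -(|b| * |ξ| + ξ ^ 2) ≤ σ * (b * ξ - ξ ^ 2) := by
      have : |σ * (b * ξ - ξ ^ 2)| ≤ |b| * |ξ| + ξ ^ 2 := by
        rw [abs_mul, hσ1, one_mul, ← abs_mul]
        exact (abs_sub _ _).trans (by rw [abs_of_nonneg hsq.le])
      exact (abs_le.1 this).1
    have t2 : κ / 4 * (2 * H * D) ≤ κ / 16 := by
      have k1 : |H * D| ≤ m / 16 * (2 / m) := by
        rw [abs_mul]
        exact mul_le_mul (hH.le.trans (min_le_left _ _)) hd (abs_nonneg _) (by positivity)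
      have k2 : m / 16 * (2 / m) = 1 / 8 := by field_simp; norm_num
      have k3 : |H * D| ≤ 1 / 8 := k1.trans k2.le
      have := (abs_le.1 k3).2
      nlinarith
    have t3 : 2 * ε * y * (κ / 4 * S) * (a + b * ξ - ξ ^ 2) ≤ κ / 8 := by
      have k1 : |y * (κ / 4 * S) * (a + b * ξ - ξ ^ 2)| ≤ M * (κ / 4 * (M / m)) * V := by
        rw [abs_mul, abs_mul, abs_mul, abs_of_pos (by positivity : 0 < κ / 4)]
        have : |S| ≤ M / m := hb.trans (by gcongr)
        gcongr
      have k2 : ε * (2 * (8 * M * (κ / 4 * (M / m)) * V + κ)) ≤ κ := by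
        rw [← le_div_iff₀ (by positivity)]
        exact h1.le.trans (min_le_right _ _)
      have k3 := mul_le_mul_of_nonneg_left ((le_abs_self _).trans k1) h0.le
      nlinarith
    have : 0 ≤ κ / 4 * Q := by positivity
    linarith

lemma le_cubic {x : ℝ} (h2 : x ≤ 283 / 200) :
    0.02 ≤ 0.96 - 0.7 - 0.7 * x + 0.7 * x ^ 2 - 0.225 * x ^ 3 := by
  nlinarith [sq_nonneg (x - 0.8),
    mul_nonneg (sub_nonneg.2 h2) (sq_nonneg (x - 0.8)),
    mul_nonneg (sub_nonneg.2 h2) (sq_nonneg (x - 0.6))]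

lemma hasWeight_zero {b : ℝ} (hb : 0.96 ≤ b) : HasWeight 0 b (Ioi 0) := by
  intro M hM
  set B := M * (1 + M) * (b + M)
  have hB : 0 < B := by positivity
  refine ⟨fun ξ => -0.7 + 0.15 * ξ, fun _ => 0.15, 1, by fun_prop, fun ξ _ => ?_, Or.inl rfl,
    min (1 / 1000) (1 / (400 * B)), by positivity, fun ε h0 h1 ξ hξ y _ hξM hyM hH => ?_⟩
  · exact (((hasDerivAt_id ξ).const_mul 0.15).const_add (-0.7)).congr_deriv (by simp)
  have hξ : 0 < ξ := hξ
  have h2 := h1.trans_le (min_le_right _ _)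
  rw [lt_div_iff₀ (by positivity)] at h2
  have hH1 := hH.trans_le (min_le_left _ _)
  have hx : ξ ≤ 283 / 200 := by
    by_contra! h
    have h2 : (2.002 : ℝ) ≤ ξ ^ 2 := by nlinarith
    have := (abs_lt.1 hH1).2
    unfold pot at this
    nlinarith [sq_nonneg y]
  have hc := le_cubic hx
  have e : 0 + b * ξ - ξ ^ 2 + y ^ 2 * 0.15 + (ξ - ξ ^ 3) * (-0.7 + 0.15 * ξ) =
      ξ * (b - 0.7 - 0.7 * ξ + 0.7 * ξ ^ 2 - 0.225 * ξ ^ 3) + 0.15 * (2 * (y ^ 2 / 2 + pot ξ)) := by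
    unfold pot; ring
  have t1 : -(0.01 * ξ) ≤ 0.15 * (2 * (y ^ 2 / 2 + pot ξ)) := by
    rcases le_total ξ (1 / 15) with h | h
    · unfold pot
      nlinarith [sq_nonneg y, sq_nonneg (ξ ^ 2)]
    · have := (abs_lt.1 hH1).1
      linarith
  have t2 : -(0.005 * ξ) ≤ 2 * ε * y * (-0.7 + 0.15 * ξ) * (0 + b * ξ - ξ ^ 2) := by
    have k : |y * (-0.7 + 0.15 * ξ) * (b - ξ)| ≤ B := by
      rw [abs_mul, abs_mul]
      rw [abs_of_pos hξ] at hξM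
      have k1 : |-0.7 + 0.15 * ξ| ≤ 1 + M := by rw [abs_le]; constructor <;> linarith
      have k2 : |b - ξ| ≤ b + M := by rw [abs_le]; constructor <;> linarith
      show _ ≤ M * (1 + M) * (b + M)
      gcongr
    have k1 := (abs_le.1 k).1
    have k2 : -(0.0025) ≤ ε * (y * (-0.7 + 0.15 * ξ) * (b - ξ)) := by nlinarith
    nlinarith
  rw [one_mul, e]
  nlinarith [mul_le_mul_of_nonneg_left hb hξ.le, mul_le_mul_of_nonneg_left hc hξ.le]

/-- The cycle is close to the double loop. -/
def Cycle.Flat {ε a b : ℝ} (C : Cycle ε a b) (c : ℝ) : Prop :=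
  ∀ ξ ∈ Icc C.α C.β, |C.Y ξ ^ 2 / 2 + pot ξ| < c ∧ |C.Z ξ ^ 2 / 2 + pot ξ| < c

lemma Cycle.Flat.neg_lt {ε a b c : ℝ} {C : Cycle ε a b} (hC : C.Flat c) {ξ : ℝ}
    (hJ : (0 < C.α ∧ 0 ≤ ξ) ∨ (C.β < 0 ∧ ξ ≤ 0) ∨ (C.α < 0 ∧ 0 < C.β)) :
    -c < C.Y ξ ^ 2 / 2 + pot ξ ∧ -c < C.Z ξ ^ 2 / 2 + pot ξ := by
  by_cases h : ξ ∈ Icc C.α C.β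
  · obtain ⟨h1, h2⟩ := hC ξ h
    exact ⟨(abs_lt.1 h1).1, (abs_lt.1 h2).1⟩
  suffices -c < pot ξ by
    constructor <;> nlinarith [sq_nonneg (C.Y ξ), sq_nonneg (C.Z ξ)]
  have hα := (abs_lt.1 (hC C.α (left_mem_Icc.2 C.lt.le)).1).1
  have hβ := (abs_lt.1 (hC C.β (right_mem_Icc.2 C.lt.le)).1).1
  rw [C.up.zero_left _ le_rfl] at hα
  rw [C.up.zero_right _ le_rfl] at hβ
  have h1 := C.α_lt_one
  have h2 := C.neg_one_lt_β
  have h3 := C.lt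
  rcases lt_or_ge ξ C.α with h4 | h4
  · have : pot C.α ≤ pot ξ := by
      rcases lt_or_ge C.α 0 with h5 | h5
      · have := C.α_lt_neg_one h5
        have := pot_mono_right (x := -C.α) (y := -ξ) (by linarith) (by linarith)
        rwa [pot_neg, pot_neg] at this
      · rcases hJ with h6 | h6 | h6
        · exact pot_anti_right h6.2 h4.le h1.le
        · linarith
        · linarith
    linarith
  · have h4 : C.β < ξ := not_le.1 fun h5 => h ⟨h4, h5⟩
    have : pot C.β ≤ pot ξ := by
      rcases lt_or_ge 0 C.β with h5 | h5
      · exact pot_mono_right (C.one_lt_β h5).le h4.le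
      · rcases hJ with h6 | h6 | h6
        · linarith
        · have := pot_anti_right (x := -ξ) (y := -C.β) (by linarith) (by linarith) (by linarith)
          rwa [pot_neg, pot_neg] at this
        · linarith
    linarith

lemma abs_energy_lt {y y₁ y₂ p c : ℝ} (hy : y ∈ Ioo y₁ y₂) (h1 : 0 ≤ y₁)
    (hl : -c < y₁ ^ 2 / 2 + p) (hr : |y₂ ^ 2 / 2 + p| < c) : |y ^ 2 / 2 + p| < c := by
  obtain ⟨h2, h3⟩ := hy
  rw [abs_lt] at hr ⊢
  constructor <;> nlinarith

lemma Cycle.false_of_weight {ε a b M δ c : ℝ} (hε : 0 < ε) (C : Cycle ε a b) {Y Z F s s' : ℝ → ℝ}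
    {σ : ℝ} {J : Set ℝ} (hs : Continuous s) (hF : Continuous F) (S : Finset ℝ) (hS : 0 ∈ S)
    (hs' : ∀ ξ, ξ ∉ S → HasDerivAt s (s' ξ) ξ) (hσ : σ = 1 ∨ σ = -1)
    (hpos : ∀ ξ ∈ J, ∀ y, ξ ≠ 0 → |ξ| ≤ M → |y| ≤ M → |y ^ 2 / 2 + pot ξ| < δ →
      0 < σ * (a + b * ξ - ξ ^ 2 + y ^ 2 * s' ξ + (ξ - ξ ^ 3) * s ξ +
        2 * ε * y * s ξ * (a + b * ξ - ξ ^ 2)))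
    (hM : -M ≤ C.α ∧ C.β ≤ M ∧ ∀ ξ, C.Y ξ ≤ M ∧ C.Z ξ ≤ M) (hC : C.Flat c) (hc : c ≤ δ)
    (hJ : Ioo C.α C.β ⊆ J)
    (hFl : F C.α = 0) (hFr : F C.β = 0)
    (hFd : ∀ ξ, ξ ∉ S → HasDerivAt F
      (dulac ε (ξ - ξ ^ 3) (a + b * ξ - ξ ^ 2) (s ξ) (s' ξ) (Y ξ) -
      dulac ε (ξ - ξ ^ 3) (a + b * ξ - ξ ^ 2) (s ξ) (s' ξ) (-Z ξ)) ξ)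
    (hY : ∀ ξ ∈ Ioo C.α C.β, 0 ≤ Y ξ ∧ Y ξ < C.Y ξ ∧ -c < Y ξ ^ 2 / 2 + pot ξ)
    (hZ : ∀ ξ ∈ Ioo C.α C.β, 0 ≤ Z ξ ∧ Z ξ < C.Z ξ ∧ -c < Z ξ ^ 2 / 2 + pot ξ) : False := by
  refine dulac_false hε C hs hF S hs' hFl hFr hFd (fun ξ hξ => (hY ξ hξ).2.1)
    (fun ξ hξ => (hZ ξ hξ).2.1) hσ fun ξ hξ hξS y hy => ?_
  obtain ⟨m1, m2, m3⟩ := hM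
  have f := hC ξ (Ioo_subset_Icc_self hξ)
  refine hpos ξ (hJ hξ) y (fun h => hξS (h ▸ hS)) (abs_le.2 ⟨m1.trans hξ.1.le, hξ.2.le.trans m2⟩)
    ?_ ?_
  · have h1 := (hY ξ hξ).1
    have h2 := (hZ ξ hξ).1
    obtain ⟨m3, m4⟩ := m3 ξ
    rcases hy with hy | hy <;> rw [abs_le] <;> constructor <;> linarith [hy.1, hy.2]
  · refine lt_of_lt_of_le ?_ hc
    rcases hy with hy | hy
    · exact abs_energy_lt hy (hY ξ hξ).1 (hY ξ hξ).2.2 f.1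
    · rw [← neg_sq y]
      exact abs_energy_lt (y := -y) ⟨by linarith [hy.2], by linarith [hy.1]⟩ (hZ ξ hξ).1
        (hZ ξ hξ).2.2 f.2

/-- A weight excludes nested flat cycles. -/
lemma Nested.false_of_weight {ε a b M δ c : ℝ} (hε : 0 < ε) {C₁ C : Cycle ε a b} (h : Nested C₁ C)
    {s s' : ℝ → ℝ} {σ : ℝ} {J : Set ℝ} (hs : Continuous s)
    (hs' : ∀ ξ, ξ ∉ ({0} : Finset ℝ) → HasDerivAt s (s' ξ) ξ) (hσ : σ = 1 ∨ σ = -1)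
    (hpos : ∀ ξ ∈ J, ∀ y, ξ ≠ 0 → |ξ| ≤ M → |y| ≤ M → |y ^ 2 / 2 + pot ξ| < δ →
      0 < σ * (a + b * ξ - ξ ^ 2 + y ^ 2 * s' ξ + (ξ - ξ ^ 3) * s ξ +
        2 * ε * y * s ξ * (a + b * ξ - ξ ^ 2)))
    (hM : -M ≤ C.α ∧ C.β ≤ M ∧ ∀ ξ, C.Y ξ ≤ M ∧ C.Z ξ ≤ M) (hC : C.Flat c) (hC₁ : C₁.Flat c)
    (hc : c ≤ δ) (hJ : Ioo C.α C.β ⊆ J)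
    (ht : (0 < C.α ∧ 0 < C₁.α) ∨ (C₁.α < 0 ∧ 0 < C₁.β)) : False := by
  have hout : ∀ ξ ∈ Ioo C.α C.β, (ξ ∈ Icc C₁.α C₁.β ∨ (C₁.Y ξ = 0 ∧ C₁.Z ξ = 0)) := fun ξ _ => by
    by_cases h1 : ξ ∈ Icc C₁.α C₁.β
    · exact Or.inl h1
    · rcases le_or_gt ξ C₁.α with h2 | h2
      · exact Or.inr ⟨C₁.up.zero_left ξ h2, C₁.lo.zero_left ξ h2⟩
      · have h3 : C₁.β ≤ ξ := not_lt.1 fun h3 => h1 ⟨h2.le, h3.le⟩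
        exact Or.inr ⟨C₁.up.zero_right ξ h3, C₁.lo.zero_right ξ h3⟩
  have hlow : ∀ ξ ∈ Ioo C.α C.β, -c < C₁.Y ξ ^ 2 / 2 + pot ξ ∧ -c < C₁.Z ξ ^ 2 / 2 + pot ξ :=
    fun ξ hξ => hC₁.neg_lt (by
      rcases ht with h1 | h1
      · exact Or.inl ⟨h1.2, (h1.1.trans hξ.1).le⟩
      · exact Or.inr (Or.inr h1))
  refine C.false_of_weight hε (F := C₁.gap s) (Y := C₁.Y) (Z := C₁.Z) hs (C₁.gap_continuous hs)
    ({0} ∪ {C₁.α, C₁.β}) (by simp) (fun ξ hξ => hs' ξ ?_) hσ hpos hM hC hc hJ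
    (C₁.gap_eq_zero s ?_) (C₁.gap_eq_zero s ?_) (fun ξ hξ => ?_)
    (fun ξ hξ => ⟨C₁.up.nonneg ξ, ?_, (hlow ξ hξ).1⟩)
    (fun ξ hξ => ⟨C₁.lo.nonneg ξ, ?_, (hlow ξ hξ).2⟩)
  · simp only [Finset.mem_union, not_or] at hξ; exact hξ.1
  · exact fun h1 => lt_asymm h1.1 h.left
  · exact fun h1 => lt_asymm h1.2 h.right
  · simp only [Finset.mem_union, Finset.mem_insert, Finset.mem_singleton, not_or] at hξ
    exact C₁.hasDerivAt_gap (hs' ξ (by simpa using hξ.1)) hξ.2.1 hξ.2.2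
  · rcases hout ξ hξ with h1 | h1
    · exact h.Y_lt ξ h1
    · rw [h1.1]; exact C.up.pos ξ hξ
  · rcases hout ξ hξ with h1 | h1
    · exact h.Z_lt ξ h1
    · rw [h1.2]; exact C.lo.pos ξ hξ

lemma Cycle.subset_of_set_eq {ε a b : ℝ} {C₁ C₂ : Cycle ε a b} (h : C₁.set = C₂.set) :
    Icc C₁.α C₁.β ⊆ Icc C₂.α C₂.β := by
  intro ξ hξ
  obtain ⟨t, h1, -⟩ := C₁.exY ξ hξ
  have : (C₁.x t, C₁.y t) ∈ C₂.set := h ▸ ⟨t, rfl⟩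
  obtain ⟨u, hu⟩ := this
  have := C₂.memIcc u
  have e : C₂.x u = C₁.x t := (Prod.ext_iff.1 hu).1
  rw [← h1, ← e]
  exact this

/-- A weight excludes the simultaneous presence of flat cycles of the three types. -/
lemma false_of_weight {ε a b M δ c : ℝ} (hε : 0 < ε) {C R L : Cycle ε a b}
    (hCt : (C.α, C.β) ∈ typeE) (hRt : (R.α, R.β) ∈ typeR) (hLt : (L.α, L.β) ∈ typeL)
    {s s' : ℝ → ℝ} {σ : ℝ} (hs : Continuous s)
    (hs' : ∀ ξ, ξ ∉ ({0} : Finset ℝ) → HasDerivAt s (s' ξ) ξ) (hσ : σ = 1 ∨ σ = -1)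
    (hpos : ∀ ξ ∈ (univ : Set ℝ), ∀ y, ξ ≠ 0 → |ξ| ≤ M → |y| ≤ M → |y ^ 2 / 2 + pot ξ| < δ →
      0 < σ * (a + b * ξ - ξ ^ 2 + y ^ 2 * s' ξ + (ξ - ξ ^ 3) * s ξ +
        2 * ε * y * s ξ * (a + b * ξ - ξ ^ 2)))
    (hM : -M ≤ C.α ∧ C.β ≤ M ∧ ∀ ξ, C.Y ξ ≤ M ∧ C.Z ξ ≤ M) (hC : C.Flat c) (hR : R.Flat c)
    (hL : L.Flat c) (hc : c ≤ δ) : False := by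
  obtain ⟨c1, c2⟩ : C.α < 0 ∧ 0 < C.β := hCt
  have r1 : 0 < R.α := hRt
  have l1 : L.β < 0 := hLt
  have c3 := C.α_lt_neg_one c1
  have c4 := C.one_lt_β c2
  have r2 := R.α_lt_one
  have r3 := R.one_lt_β (r1.trans R.lt)
  have l2 := L.neg_one_lt_β
  have l3 := L.α_lt_neg_one (L.lt.trans l1)
  have nR : Nested R C := by
    have hne : R.set ≠ C.set := fun h => by
      have := (Cycle.subset_of_set_eq h.symm (left_mem_Icc.2 C.lt.le)).1
      linarith
    rcases Cycle.nested_or hne (ξ₀ := 1) ⟨r2.le, r3.le⟩ ⟨by linarith, c4.le⟩ with h | h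
    · exact h
    · have := h.left; linarith
  have nL : Nested L C := by
    have hne : L.set ≠ C.set := fun h => by
      have := (Cycle.subset_of_set_eq h.symm (right_mem_Icc.2 C.lt.le)).2
      linarith
    rcases Cycle.nested_or hne (ξ₀ := -1) ⟨l3.le, l2.le⟩ ⟨c3.le, by linarith⟩ with h | h
    · exact h
    · have := h.right; linarith
  have zR : ∀ ξ ≤ 0, R.Y ξ = 0 ∧ R.Z ξ = 0 := fun ξ h =>
    ⟨R.up.zero_left ξ (h.trans r1.le), R.lo.zero_left ξ (h.trans r1.le)⟩
  have zL : ∀ ξ, 0 ≤ ξ → L.Y ξ = 0 ∧ L.Z ξ = 0 := fun ξ h =>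
    ⟨L.up.zero_right ξ (l1.le.trans h), L.lo.zero_right ξ (l1.le.trans h)⟩
  have ltC : ∀ D : Cycle ε a b, Nested D C → ∀ ξ ∈ Ioo C.α C.β, D.Y ξ < C.Y ξ ∧ D.Z ξ < C.Z ξ := by
    intro D h ξ hξ
    by_cases h1 : ξ ∈ Icc D.α D.β
    · exact ⟨h.Y_lt ξ h1, h.Z_lt ξ h1⟩
    · rcases le_or_gt ξ D.α with h2 | h2
      · rw [D.up.zero_left ξ h2, D.lo.zero_left ξ h2]
        exact ⟨C.up.pos ξ hξ, C.lo.pos ξ hξ⟩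
      · have h3 : D.β ≤ ξ := not_lt.1 fun h3 => h1 ⟨h2.le, h3.le⟩
        rw [D.up.zero_right ξ h3, D.lo.zero_right ξ h3]
        exact ⟨C.up.pos ξ hξ, C.lo.pos ξ hξ⟩
  have dz : ∀ g v u w : ℝ, dulac ε g v u w 0 - dulac ε g v u w (-0) = 0 := fun g v u w => by
    rw [neg_zero, sub_self]
  refine C.false_of_weight hε (F := fun ξ => R.gap s ξ + L.gap s ξ) (Y := fun ξ => R.Y ξ + L.Y ξ)
    (Z := fun ξ => R.Z ξ + L.Z ξ) hs ((R.gap_continuous hs).add (L.gap_continuous hs))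
    ({0} ∪ {R.α, R.β, L.α, L.β}) (by simp) (fun ξ hξ => hs' ξ ?_) hσ hpos hM hC hc
    (subset_univ _) ?_ ?_ (fun ξ hξ => ?_)
    (fun ξ hξ => ?_) (fun ξ hξ => ?_)
  · simp only [Finset.mem_union, not_or] at hξ; exact hξ.1
  · rw [R.gap_eq_zero s fun h1 => lt_asymm h1.1 nR.left,
      L.gap_eq_zero s fun h1 => lt_asymm h1.1 nL.left, add_zero]
  · rw [R.gap_eq_zero s fun h1 => lt_asymm h1.2 nR.right,
      L.gap_eq_zero s fun h1 => lt_asymm h1.2 nL.right, add_zero]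
  · simp only [Finset.mem_union, Finset.mem_insert, Finset.mem_singleton, not_or] at hξ
    obtain ⟨h0, h1, h2, h3, h4⟩ := hξ
    have hs0 := hs' ξ (by simpa using h0)
    refine ((R.hasDerivAt_gap hs0 h1 h2).add (L.hasDerivAt_gap hs0 h3 h4)).congr_deriv ?_
    rcases le_total ξ 0 with h5 | h5
    · rw [(zR ξ h5).1, (zR ξ h5).2, dz, zero_add, zero_add, zero_add]
    · rw [(zL ξ h5).1, (zL ξ h5).2, dz, add_zero, add_zero, add_zero]
  · rcases le_total ξ 0 with h5 | h5
    · rw [(zR ξ h5).1, zero_add]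
      exact ⟨L.up.nonneg ξ, (ltC L nL ξ hξ).1, (hL.neg_lt (Or.inr (Or.inl ⟨l1, h5⟩))).1⟩
    · rw [(zL ξ h5).1, add_zero]
      exact ⟨R.up.nonneg ξ, (ltC R nR ξ hξ).1, (hR.neg_lt (Or.inl ⟨r1, h5⟩)).1⟩
  · rcases le_total ξ 0 with h5 | h5
    · rw [(zR ξ h5).2, zero_add]
      exact ⟨L.lo.nonneg ξ, (ltC L nL ξ hξ).2, (hL.neg_lt (Or.inr (Or.inl ⟨l1, h5⟩))).2⟩
    · rw [(zL ξ h5).2, add_zero]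
      exact ⟨R.lo.nonneg ξ, (ltC R nR ξ hξ).2, (hR.neg_lt (Or.inl ⟨r1, h5⟩)).2⟩

/-- Cycles with one nearly vanishing level are flat. -/
lemma exists_flat (a b : ℝ) : ∃ K : ℝ, 0 < K ∧ ∀ ε, 0 < ε → ε ≤ 1 → ∀ C : Cycle ε a b, ∀ c,
    |pot C.α| < c → C.Flat (c + K * ε) := by
  obtain ⟨K, hK, h⟩ := exists_oscillation a b
  refine ⟨K, hK, fun ε h0 h1 C c hc ξ hξ => ?_⟩
  obtain ⟨h2, h3⟩ := h ε h0 h1 C ξ hξ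
  rw [abs_le] at h2 h3
  rw [abs_lt] at hc
  constructor <;> rw [abs_lt] <;> constructor <;> linarith

/-- The part common to the neighbourhoods of the loop on both sides. -/
lemma nearFew_one_of_weight {a b : ℝ} {J : Set ℝ} (h : HasWeight a b J) {A : Set (ℝ × ℝ)}
    (hA : (A = typeR ∧ J = Ioi 0) ∨ (A = typeE ∧ J = univ)) : NearFew 1 a b A 0 := by
  obtain ⟨M, hM0, hM⟩ := exists_bound a b
  obtain ⟨K, hK, hflat⟩ := exists_flat a b
  obtain ⟨s, s', σ, hs, hs', hσ, δ, hδ, hpos⟩ := h M hM0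
  refine ⟨δ / 2, by positivity, Few.one ⟨min 1 (min δ (δ / 2 / K)), by positivity,
    fun ε h0 h1 => ?_⟩⟩
  rw [lt_min_iff, lt_min_iff, lt_div_iff₀ hK] at h1
  obtain ⟨h1, h2, h3⟩ := h1
  have main : ∀ C₁ C₂ : Cycle ε a b, (C₁.α, C₁.β) ∈ near A 0 (δ / 2) →
      (C₂.α, C₂.β) ∈ near A 0 (δ / 2) → Nested C₁ C₂ → False := by
    intro C₁ C₂ m1 m2 hN
    have f1 := hflat ε h0 h1.le C₁ (δ / 2) (by simpa using m1.2)
    have f2 := hflat ε h0 h1.le C₂ (δ / 2) (by simpa using m2.2)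
    refine hN.false_of_weight h0 hs hs' hσ (hpos ε h0 h2) (hM ε h0 h1.le C₂) f2 f1 (by linarith)
      ?_ ?_
    · rcases hA with ⟨rfl, rfl⟩ | ⟨rfl, rfl⟩
      · have : 0 < C₂.α := m2.1
        exact fun ξ hξ => this.trans hξ.1
      · exact subset_univ _
    · rcases hA with ⟨rfl, rfl⟩ | ⟨rfl, rfl⟩
      · exact Or.inl ⟨m2.1, m1.1⟩
      · exact Or.inr m1.1
  intro C₁ C₂ m1 m2
  by_contra hne
  have hmem : ∀ C : Cycle ε a b, (C.α, C.β) ∈ near A 0 (δ / 2) → (1 : ℝ) ∈ Icc C.α C.β := by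
    intro C m
    refine ⟨C.α_lt_one.le, (C.one_lt_β ?_).le⟩
    rcases hA with ⟨rfl, rfl⟩ | ⟨rfl, rfl⟩
    · have : 0 < C.α := m.1
      exact this.trans C.lt
    · exact m.1.2
  rcases Cycle.nested_or hne (hmem C₁ m1) (hmem C₂ m2) with h | h
  · exact main _ _ m1 m2 h
  · exact main _ _ m2 m1 h

lemma nearFewR_one {a b : ℝ} (h : a ≠ 0 ∨ 0.96 ≤ b) : NearFew 1 a b typeR 0 := by
  refine nearFew_one_of_weight (J := Ioi 0) ?_ (Or.inl ⟨rfl, rfl⟩)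
  by_cases ha : a = 0
  · subst ha
    exact hasWeight_zero (h.resolve_left (by simp))
  · exact (hasWeight_of_ne ha).mono (subset_univ _)

lemma nearFewE_one {a b : ℝ} (h : a ≠ 0) : NearFew 1 a b typeE 0 :=
  nearFew_one_of_weight (J := univ) (hasWeight_of_ne h) (Or.inr ⟨rfl, rfl⟩)

/-- Flat cycles of the three types never coexist. -/
lemma exists_exclusion {a b : ℝ} (ha : a ≠ 0) : ∃ δ > 0, ∀ ε, 0 < ε → ε < δ →
    ∀ C R L : Cycle ε a b, (C.α, C.β) ∈ typeE → (R.α, R.β) ∈ typeR → (L.α, L.β) ∈ typeL →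
      C.Flat δ → R.Flat δ → L.Flat δ → False := by
  obtain ⟨M, hM0, hM⟩ := exists_bound a b
  obtain ⟨s, s', σ, hs, hs', hσ, δ, hδ, hpos⟩ := hasWeight_of_ne (b := b) ha M hM0
  refine ⟨min 1 δ, by positivity, fun ε h0 h1 C R L hCt hRt hLt hC hR hL => ?_⟩
  exact false_of_weight h0 hCt hRt hLt hs hs' hσ
    (hpos ε h0 (h1.trans_le (min_le_right _ _))) (hM ε h0 (h1.le.trans (min_le_left _ _)) C) hC hR hL
    (min_le_right _ _)

/-! ### The neighbourhood of the foci -/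

lemma graph_lt {P Q f g : ℝ → ℝ} {U : ℝ} (hU : 0 < U) (hP : Continuous P) (hQ : Continuous Q)
    (h0 : P 0 = Q 0) (posP : ∀ u ∈ Ico 0 U, 0 < P u) (posQ : ∀ u ∈ Ico 0 U, 0 < Q u)
    (dP : ∀ u ∈ Ioo 0 U, HasDerivAt P (-u / (2 * P u) + f u) u)
    (dQ : ∀ u ∈ Ioo 0 U, HasDerivAt Q (-u / (2 * Q u) + g u) u)
    (hfg : ∀ u ∈ Ioo 0 U, g u < f u) : Q U < P U := by
  have hpos : ∀ u ∈ Ioo 0 U, 0 < P u - Q u := by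
    intro u₁ hu₁
    have hc : ContinuousOn (fun u => u / (2 * (P u * Q u))) (Icc 0 u₁) := by
      refine continuousOn_id.div (by fun_prop) fun u hu => ?_
      have h1 := posP u ⟨hu.1, hu.2.trans_lt hu₁.2⟩
      have h2 := posQ u ⟨hu.1, hu.2.trans_lt hu₁.2⟩
      positivity
    obtain ⟨K, hK⟩ := (isCompact_Icc.image_of_continuousOn hc).bddAbove
    set z := fun u => (P u - Q u) * Real.exp (-K * u)
    have hz : Continuous z := by fun_prop
    obtain ⟨u₂, hu₂, hmin⟩ := isCompact_Icc.exists_isMinOn (nonempty_Icc.2 hu₁.1.le) hz.continuousOn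
    by_contra! hneg
    have hz1 : z u₁ ≤ 0 := mul_nonpos_of_nonpos_of_nonneg hneg (Real.exp_pos _).le
    obtain ⟨u₃, hu₃, hz3, hmin3⟩ : ∃ u₃ ∈ Ioc 0 u₁, z u₃ ≤ 0 ∧ IsMinOn z (Icc 0 u₁) u₃ := by
      rcases hu₂.1.eq_or_lt with h | h
      · have e : z u₂ = 0 := by simp only [z, ← h, h0, sub_self, zero_mul]
        refine ⟨u₁, ⟨hu₁.1, le_rfl⟩, hz1, fun u hu => hz1.trans ?_⟩
        rw [← e]; exact hmin hu
      · exact ⟨u₂, ⟨h, hu₂.2⟩, (hmin (right_mem_Icc.2 hu₁.1.le)).trans hz1, hmin⟩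
    have h3 : u₃ ∈ Ioo 0 U := ⟨hu₃.1, hu₃.2.trans_lt hu₁.2⟩
    have p3 := posP u₃ ⟨h3.1.le, h3.2⟩
    have q3 := posQ u₃ ⟨h3.1.le, h3.2⟩
    have k3 : u₃ / (2 * (P u₃ * Q u₃)) ≤ K := hK ⟨u₃, ⟨hu₃.1.le, hu₃.2⟩, rfl⟩
    have d3 : P u₃ - Q u₃ ≤ 0 := by
      by_contra! h
      exact absurd hz3 (not_le.2 (mul_pos h (Real.exp_pos _)))
    have hd := ((dP u₃ h3).sub (dQ u₃ h3)).mul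
      (((hasDerivAt_id u₃).const_mul (-K)).exp)
    have hd' : 0 < (-u₃ / (2 * P u₃) + f u₃ - (-u₃ / (2 * Q u₃) + g u₃)) * Real.exp (-K * id u₃) +
        (P u₃ - Q u₃) * (Real.exp (-K * id u₃) * (-K * 1)) := by
      have e : -u₃ / (2 * P u₃) - -u₃ / (2 * Q u₃) = u₃ / (2 * (P u₃ * Q u₃)) * (P u₃ - Q u₃) := by
        field_simp
        ring
      have h4 := hfg u₃ h3
      have h5 : 0 ≤ (K - u₃ / (2 * (P u₃ * Q u₃))) * -(P u₃ - Q u₃) :=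
        mul_nonneg (sub_nonneg.2 k3) (neg_nonneg.2 d3)
      have h6 : 0 < (-u₃ / (2 * P u₃) + f u₃ - (-u₃ / (2 * Q u₃) + g u₃)) - K * (P u₃ - Q u₃) := by
        linarith
      have := mul_pos h6 (Real.exp_pos (-K * id u₃))
      linarith
    have hlt : ∀ᶠ u in 𝓝[<] u₃, z u < z u₃ := by
      have := hd.tendsto_slope.eventually (lt_mem_nhds hd')
      have h7 : ∀ᶠ u in 𝓝[<] u₃, 0 < slope (fun u => (P u - Q u) * Real.exp (-K * id u)) u₃ u :=
        this.filter_mono (nhdsWithin_mono _ fun u hu => ne_of_lt hu)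
      filter_upwards [h7, self_mem_nhdsWithin] with u h8 h9
      rw [slope_def_field, div_pos_iff] at h8
      have h9 : u < u₃ := h9
      rcases h8 with h8 | h8
      · linarith [h8.2]
      · simp only [z]; simp only [id] at h8; linarith [h8.1]
    obtain ⟨u, h8, h9⟩ := (hlt.and (Ioo_mem_nhdsLT hu₃.1)).exists
    exact absurd (hmin3 ⟨h9.1.le, h9.2.le.trans hu₃.2⟩) (not_le.2 h8)
  have key := lt_of_deriv_pos_off_finset (D := fun u => P u - Q u)
    (D' := fun u => -u / (2 * P u) + f u - (-u / (2 * Q u) + g u)) ∅ (hP.sub hQ) hU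
    fun u hu _ => ⟨(dP u hu).sub (dQ u hu), ?_⟩
  · simp only [h0, sub_self] at key
    linarith
  · have p3 := posP u ⟨hu.1.le, hu.2⟩
    have q3 := posQ u ⟨hu.1.le, hu.2⟩
    have e : -u / (2 * P u) - -u / (2 * Q u) = u / (2 * (P u * Q u)) * (P u - Q u) := by
      field_simp
      ring
    have h4 := hfg u hu
    have h5 := hpos u hu
    have h6 := hu.1
    have : 0 < u / (2 * (P u * Q u)) * (P u - Q u) := by positivity
    linarith

/-- The half branches of an arc around the focus. -/
lemma Arc.branches {ε a b : ℝ} {Y : ℝ → ℝ} {p q : ℝ} (A : Arc ε a b Y p q) (hp : 0 < p)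
    (hp1 : p < 1) (hq : 1 < q) :
    (∀ u, 0 ≤ u → u < q ^ 2 - 1 → 0 < Y √(1 + u) ∧ (0 < u → HasDerivAt (fun u => Y √(1 + u))
      (-u / (2 * Y √(1 + u)) + ε / 2 * (a / √(1 + u) + b - √(1 + u))) u)) ∧
    (∀ u, 0 ≤ u → u < 1 - p ^ 2 → 0 < Y √(1 - u) ∧ (0 < u → HasDerivAt (fun u => Y √(1 - u))
      (-u / (2 * Y √(1 - u)) - ε / 2 * (a / √(1 - u) + b - √(1 - u))) u)) := by
  constructor
  · intro u h0 h1
    have hm : √(1 + u) ∈ Ioo p q := by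
      constructor
      · exact hp1.trans_le (Real.one_le_sqrt.2 (by linarith))
      · rw [Real.sqrt_lt' (by linarith)]; linarith
    have hY := A.pos _ hm
    refine ⟨hY, fun h2 => ?_⟩
    have h3 : HasDerivAt (fun u : ℝ => √(1 + u)) (1 / (2 * √(1 + u))) u :=
      ((hasDerivAt_id u).const_add 1).sqrt (by simp only [id]; linarith)
    refine ((A.deriv _ hm).comp u h3).congr_deriv ?_
    have h4 : √(1 + u) ^ 2 = 1 + u := Real.sq_sqrt (by linarith)
    have h5 : 0 < √(1 + u) := by linarith [hm.1]
    generalize √(1 + u) = r at *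
    have : u = r ^ 2 - 1 := by linarith
    subst this
    field_simp
    ring
  · intro u h0 h1
    have hm : √(1 - u) ∈ Ioo p q := by
      constructor
      · rw [Real.lt_sqrt hp.le]; linarith
      · exact lt_of_le_of_lt (Real.sqrt_le_one.2 (by linarith)) hq
    have hY := A.pos _ hm
    refine ⟨hY, fun h2 => ?_⟩
    have h5 : 0 < √(1 - u) := by linarith [hm.1]
    have h3 : HasDerivAt (fun u : ℝ => √(1 - u)) (-1 / (2 * √(1 - u))) u :=
      ((hasDerivAt_id u).const_sub 1).sqrt (by simpa using (Real.sqrt_pos.1 h5).ne')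
    refine ((A.deriv _ hm).comp u h3).congr_deriv ?_
    have h4 : √(1 - u) ^ 2 = 1 - u := Real.sq_sqrt (Real.sqrt_pos.1 h5).le
    generalize √(1 - u) = r at *
    have : u = 1 - r ^ 2 := by linarith
    subst this
    field_simp
    ring

/-- Twice the mean damping at the abscissas `√(1 ± u)`. -/
noncomputable def meanDamping (a b u : ℝ) : ℝ :=
  (a / √(1 + u) + b - √(1 + u)) + (a / √(1 - u) + b - √(1 - u))

lemma Arc.asymm {ε a b : ℝ} {Y : ℝ → ℝ} {p q : ℝ} (A : Arc ε a b Y p q) (hp : 0 < p)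
    (hp1 : p < 1) (hq : 1 < q) :
    ((∀ u ∈ Ioo 0 (1 - p ^ 2), 0 < ε * meanDamping a b u) → 1 - p ^ 2 < q ^ 2 - 1) ∧
    ((∀ u ∈ Ioo 0 (1 - p ^ 2), ε * meanDamping a b u < 0) → q ^ 2 - 1 < 1 - p ^ 2) := by
  obtain ⟨hr, hl⟩ := A.branches hp hp1 hq
  have hY := A.cont
  have U1 : 0 < 1 - p ^ 2 := by nlinarith
  have U2 : 0 < q ^ 2 - 1 := by nlinarith
  set U := min (1 - p ^ 2) (q ^ 2 - 1)
  have hU : 0 < U := lt_min U1 U2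
  have l1 : U ≤ 1 - p ^ 2 := min_le_left _ _
  have l2 : U ≤ q ^ 2 - 1 := min_le_right _ _
  have cr : Continuous fun u => Y √(1 + u) := by fun_prop
  have cl : Continuous fun u => Y √(1 - u) := by fun_prop
  have zr : Y √(1 + (q ^ 2 - 1)) = 0 := A.zero_right _ (by
    rw [add_sub_cancel, Real.sqrt_sq (by linarith)])
  have zl : Y √(1 - (1 - p ^ 2)) = 0 := A.zero_left _ (by
    rw [sub_sub_cancel, Real.sqrt_sq (by linarith)])
  constructor
  · intro h
    have key := graph_lt (P := fun u => Y √(1 + u)) (Q := fun u => Y √(1 - u))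
      (f := fun u => ε / 2 * (a / √(1 + u) + b - √(1 + u)))
      (g := fun u => -(ε / 2 * (a / √(1 - u) + b - √(1 - u)))) hU cr cl (by simp)
      (fun u hu => (hr u hu.1 (hu.2.trans_le l2)).1) (fun u hu => (hl u hu.1 (hu.2.trans_le l1)).1)
      (fun u hu => (hr u hu.1.le (hu.2.trans_le l2)).2 hu.1)
      (fun u hu => ((hl u hu.1.le (hu.2.trans_le l1)).2 hu.1).congr_deriv (by ring))
      (fun u hu => by
        have := h u ⟨hu.1, hu.2.trans_le l1⟩
        unfold meanDamping at this
        linarith)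
    by_contra! h1
    have e : U = q ^ 2 - 1 := min_eq_right h1
    simp only [e, zr] at key
    exact absurd key (not_lt.2 (A.nonneg _))
  · intro h
    have key := graph_lt (Q := fun u => Y √(1 + u)) (P := fun u => Y √(1 - u))
      (g := fun u => ε / 2 * (a / √(1 + u) + b - √(1 + u)))
      (f := fun u => -(ε / 2 * (a / √(1 - u) + b - √(1 - u)))) hU cl cr (by simp)
      (fun u hu => (hl u hu.1 (hu.2.trans_le l1)).1) (fun u hu => (hr u hu.1 (hu.2.trans_le l2)).1)
      (fun u hu => ((hl u hu.1.le (hu.2.trans_le l1)).2 hu.1).congr_deriv (by ring))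
      (fun u hu => (hr u hu.1.le (hu.2.trans_le l2)).2 hu.1)
      (fun u hu => by
        have := h u ⟨hu.1, hu.2.trans_le l1⟩
        unfold meanDamping at this
        linarith)
    by_contra! h1
    have e : U = 1 - p ^ 2 := min_eq_left h1
    simp only [e, zl] at key
    exact absurd key (not_lt.2 (A.nonneg _))

/-- Eventual sign of a polynomial to the right of zero, by Horner's scheme. -/
lemma exists_sign_add_mul {q : ℝ → ℝ} (hq : Continuous q) (c : ℝ)
    (h : ∃ σ : ℝ, (σ = 1 ∨ σ = -1) ∧ ∀ᶠ t in 𝓝[>] (0 : ℝ), 0 < σ * q t) :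
    ∃ σ : ℝ, (σ = 1 ∨ σ = -1) ∧ ∀ᶠ t in 𝓝[>] (0 : ℝ), 0 < σ * (c + t * q t) := by
  rcases eq_or_ne c 0 with rfl | hc
  · obtain ⟨σ, hσ, h⟩ := h
    refine ⟨σ, hσ, ?_⟩
    filter_upwards [h, self_mem_nhdsWithin] with t h1 h2
    have := mul_pos (mem_Ioi.1 h2) h1
    linarith
  · obtain ⟨σ, hσ, hσc⟩ : ∃ σ : ℝ, (σ = 1 ∨ σ = -1) ∧ 0 < σ * c := by
      rcases lt_or_gt_of_ne hc with h | h
      · exact ⟨-1, Or.inr rfl, by linarith⟩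
      · exact ⟨1, Or.inl rfl, by linarith⟩
    refine ⟨σ, hσ, ?_⟩
    have h1 : Continuous fun t => σ * (c + t * q t) := by fun_prop
    have h2 : 0 < σ * (c + 0 * q 0) := by simpa using hσc
    exact ((h1.tendsto 0).eventually (lt_mem_nhds h2)).filter_mono nhdsWithin_le_nhds

lemma exists_sign_meanDamping (a b : ℝ) : ∃ σ : ℝ, (σ = 1 ∨ σ = -1) ∧ ∃ δ > 0, ∀ u ∈ Ioo 0 δ,
    0 < σ * meanDamping a b u := by
  obtain ⟨σ, hσ, h⟩ := exists_sign_add_mul (by fun_prop) (2 * a + 2 * b - 2)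
    (exists_sign_add_mul (by fun_prop) (5 - 4 * b - a)
    (exists_sign_add_mul (q := fun _ => 1 / 2) (by fun_prop) (b - 3)
      ⟨1, Or.inl rfl, Eventually.of_forall fun _ => by norm_num⟩))
  obtain ⟨δ, hδ, h⟩ := mem_nhdsGT_iff_exists_Ioo_subset.1 h
  refine ⟨σ, hσ, min 1 δ, lt_min one_pos hδ, fun u hu => ?_⟩
  have u1 : u < 1 := hu.2.trans_le (min_le_left _ _)
  have u2 : u < δ := hu.2.trans_le (min_le_right _ _)
  have u0 := hu.1
  have r2 : √(1 + u) ^ 2 = 1 + u := Real.sq_sqrt (by linarith)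
  have l2 : √(1 - u) ^ 2 = 1 - u := Real.sq_sqrt (by linarith)
  have r0 : 0 < √(1 + u) := Real.sqrt_pos.2 (by linarith)
  have l0 : 0 < √(1 - u) := Real.sqrt_pos.2 (by linarith)
  unfold meanDamping
  generalize √(1 + u) = r at *
  generalize √(1 - u) = l at *
  have t1 : r + l < 2 := by nlinarith [sq_nonneg (r - l), sq_nonneg (r + l - 2)]
  have t2 : 2 - (r + l) < δ := by
    have r1 : 1 ≤ r := by nlinarith
    have : 1 - u ≤ l := by nlinarith
    linarith
  have key := h (show 2 - (r + l) ∈ Ioo 0 δ from ⟨by linarith, t2⟩)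
  have hs : l ^ 2 = 2 - r ^ 2 := by linarith
  have e : r * l * ((a / r + b - r) + (a / l + b - l)) =
      2 * a + 2 * b - 2 + (2 - (r + l)) * (5 - 4 * b - a + (2 - (r + l)) * (b - 3 +
        (2 - (r + l)) * (1 / 2))) := by
    field_simp
    linear_combination (-2 * b + (r + l)) * hs
  have key : 0 < σ * (2 * a + 2 * b - 2 + (2 - (r + l)) * (5 - 4 * b - a + (2 - (r + l)) *
    (b - 3 + (2 - (r + l)) * (1 / 2)))) := key
  rw [← e, mul_left_comm] at key
  exact (mul_pos_iff_of_pos_left (by positivity)).1 key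

lemma nearFewR_focus (a b : ℝ) : NearFew 0 a b typeR (-1 / 4) := by
  obtain ⟨σ, hσ, δ, hδ, h⟩ := exists_sign_meanDamping a b
  refine ⟨δ ^ 2 / 4, by positivity, Few.zero ⟨1, one_pos, fun ε h0 _ C hC => ?_⟩⟩
  have hα : 0 < C.α := hC.1
  have hC2 : |pot C.α - -1 / 4| < δ ^ 2 / 4 := hC.2
  have h1 := C.α_lt_one
  have h2 := C.one_lt_β (hα.trans C.lt)
  have hU : 1 - C.α ^ 2 < δ := by
    have e : pot C.α - -1 / 4 = (1 - C.α ^ 2) ^ 2 / 4 := by unfold pot; ring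
    rw [e, abs_of_nonneg (by positivity)] at hC2
    nlinarith
  have hs : ∀ u ∈ Ioo 0 (1 - C.α ^ 2), 0 < ε * (σ * meanDamping a b u) := fun u hu =>
    mul_pos h0 (h u ⟨hu.1, hu.2.trans hU⟩)
  obtain ⟨y1, y2⟩ := C.up.asymm hα h1 h2
  obtain ⟨z1, z2⟩ := C.lo.asymm hα h1 h2
  rcases hσ with rfl | rfl
  · have k1 := y1 fun u hu => by have := hs u hu; linarith
    have k2 := z2 fun u hu => by have := hs u hu; linarith
    linarith
  · have k1 := y2 fun u hu => by have := hs u hu; linarith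
    have k2 := z1 fun u hu => by have := hs u hu; linarith
    linarith

/-! ### Counting all closed orbits -/

lemma Few.of_cover {n : ℕ∞} {a b : ℝ} {A B : Set (ℝ × ℝ)} (h : Few n a b B)
    (hAB : ∃ δ > 0, ∀ ε, 0 < ε → ε < δ → ∀ C : Cycle ε a b, (C.α, C.β) ∈ A → (C.α, C.β) ∈ B) :
    Few n a b A := by
  obtain ⟨δ, hδ, h⟩ := h
  obtain ⟨δ', hδ', h'⟩ := hAB
  refine ⟨min δ δ', lt_min hδ hδ', fun ε h0 h1 => le_trans (encard_le_encard ?_)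
    (h ε h0 (h1.trans_le (min_le_left _ _)))⟩
  rintro _ ⟨C, hC, rfl⟩
  exact ⟨C, h' ε h0 (h1.trans_le (min_le_right _ _)) C hC, rfl⟩

lemma Few.empty {a b : ℝ} {A : Set (ℝ × ℝ)} (h : Few 0 a b A) :
    ∃ δ > 0, ∀ ε, 0 < ε → ε < δ → ∀ C : Cycle ε a b, (C.α, C.β) ∉ A := by
  obtain ⟨δ, hδ, h⟩ := h
  refine ⟨δ, hδ, fun ε h0 h1 C hC => ?_⟩
  have h2 := h ε h0 h1
  rw [nonpos_iff_eq_zero, encard_eq_zero] at h2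
  have : C.set ∈ family ε a b A := ⟨C, hC, rfl⟩
  rw [h2] at this
  exact this

lemma near_mono (A : Set (ℝ × ℝ)) (e : ℝ) {δ δ' : ℝ} (h : δ ≤ δ') : near A e δ ⊆ near A e δ' :=
  fun _ hp => ⟨hp.1, hp.2.trans_le h⟩

lemma exists_coverR (a b : ℝ) {δ : ℝ} (hδ : 0 < δ) : ∃ K ⊆ Ioo (-1 / 4 : ℝ) 0, IsCompact K ∧
    ∃ δ' > 0, ∀ ε, 0 < ε → ε < δ' → ∀ C : Cycle ε a b, (C.α, C.β) ∈ typeR →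
      (C.α, C.β) ∈ {p | p ∈ typeR ∧ pot p.1 ∈ K} ∪ near typeR 0 δ := by
  obtain ⟨δ₁, hδ₁, h⟩ := nearFewR_focus a b
  obtain ⟨δ', hδ', h⟩ := h.empty
  refine ⟨Icc (-1 / 4 + δ₁) (-δ), fun e he => ⟨by linarith [he.1], by linarith [he.2]⟩,
    isCompact_Icc, δ', hδ', fun ε h0 h1 C hC => ?_⟩
  have hα : 0 < C.α := hC
  have h2 : C.α ^ 2 < 1 := by nlinarith [C.α_lt_one]
  have e : pot C.α = ((1 - C.α ^ 2) ^ 2 - 1) / 4 := by unfold pot; ring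
  have l1 : -1 / 4 < pot C.α := by rw [e]; nlinarith
  have l2 : pot C.α < 0 := by rw [e]; nlinarith [sq_nonneg C.α]
  have h3 : -1 / 4 + δ₁ ≤ pot C.α := by
    by_contra! h3
    exact h ε h0 h1 C ⟨hC, by rw [abs_lt]; constructor <;> dsimp only <;> linarith⟩
  by_cases h4 : pot C.α ≤ -δ
  · exact Or.inl ⟨hC, h3, h4⟩
  · exact Or.inr ⟨hC, by rw [abs_lt]; constructor <;> dsimp only <;> linarith⟩

lemma exists_coverE (a b : ℝ) {δ : ℝ} (hδ : 0 < δ) : ∃ K ⊆ Ioi (0 : ℝ), IsCompact K ∧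
    ∃ δ' > 0, ∀ ε, 0 < ε → ε < δ' → ∀ C : Cycle ε a b, (C.α, C.β) ∈ typeE →
      (C.α, C.β) ∈ {p | p ∈ typeE ∧ pot p.1 ∈ K} ∪ near typeE 0 δ := by
  obtain ⟨M, hM0, hM⟩ := exists_bound a b
  obtain ⟨K, hK, hosc⟩ := exists_oscillation a b
  refine ⟨Icc δ (M ^ 4 / 4), fun e he => hδ.trans_le he.1, isCompact_Icc, min 1 (δ / K),
    by positivity, fun ε h0 h1 C hC => ?_⟩
  rw [lt_min_iff, lt_div_iff₀ hK] at h1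
  obtain ⟨c1, c2⟩ : C.α < 0 ∧ 0 < C.β := hC
  have h2 := (abs_le.1 (hosc ε h0 h1.1.le C 0 ⟨c1.le, c2.le⟩).1).2
  have h3 : pot 0 = 0 := by simp [pot]
  have h4 := (hM ε h0 h1.1.le C).1
  have h5 : pot C.α ≤ M ^ 4 / 4 := by
    have h6 : (-C.α) ^ 4 ≤ M ^ 4 := pow_le_pow_left₀ (by linarith) (by linarith) 4
    unfold pot
    nlinarith [sq_nonneg C.α]
  have h7 : -δ < pot C.α := by nlinarith [sq_nonneg (C.Y 0)]
  by_cases h8 : δ ≤ pot C.α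
  · exact Or.inl ⟨⟨c1, c2⟩, h8, h5⟩
  · exact Or.inr ⟨⟨c1, c2⟩, by rw [abs_lt]; constructor <;> dsimp only <;> linarith⟩

lemma fewR_total {a b : ℝ} {n m : ℕ∞} (hn : ∀ K ⊆ Ioo (-1 / 4 : ℝ) 0, IsCompact K →
    Few n a b {p | p ∈ typeR ∧ pot p.1 ∈ K}) (hm : NearFew m a b typeR 0) :
    Few (n + m) a b typeR := by
  obtain ⟨δ, hδ, hm⟩ := hm
  obtain ⟨K, hK, hKc, h⟩ := exists_coverR a b hδ
  exact ((hn K hK hKc).union hm).of_cover h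

lemma fewE_total {a b : ℝ} {n m : ℕ∞} (hn : ∀ K ⊆ Ioi (0 : ℝ), IsCompact K →
    Few n a b {p | p ∈ typeE ∧ pot p.1 ∈ K}) (hm : NearFew m a b typeE 0) :
    Few (n + m) a b typeE := by
  obtain ⟨δ, hδ, hm⟩ := hm
  obtain ⟨K, hK, hKc, h⟩ := exists_coverE a b hδ
  exact ((hn K hK hKc).union hm).of_cover h

lemma melnikov_eq (a b : ℝ) : a * (8 * √2 / 3) + b * Real.pi - 32 * √2 / 15 =
    4 * √2 * (2 / 3 * a + b * (√2 * Real.pi / 8) - 8 / 15) := by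
  have := Real.sq_sqrt (zero_le_two : (0 : ℝ) ≤ 2)
  linear_combination (-b * Real.pi / 2) * this

lemma fewR_zero {a b : ℝ} (hb : b ≤ 0) (ha : a < 4 / 5 ∨ (a = 4 / 5 ∧ b < 0)) :
    Few 0 a b typeR := by
  have hp : 0 < √2 * Real.pi / 8 := by positivity
  have h1 : 2 / 3 * a + b * (√2 * Real.pi / 8) - 8 / 15 < 0 := by
    rcases ha with h | ⟨rfl, h⟩ <;> nlinarith
  refine (fewR_total (n := 0) (m := 0) (fun K hK hKc => (fewR a b hKc hK).2.2 fun r hr =>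
    GR_ne_zero ?_ hr) (nearFewR_loop h1.ne)).mono (by simp) subset_rfl
  rcases le_total a 0 with h | h
  · exact Or.inl ⟨h, hb⟩
  · refine Or.inr ⟨h, ?_⟩
    rw [melnikov_eq]
    exact mul_nonpos_of_nonneg_of_nonpos (by positivity) h1.le

lemma fewR_one {a b : ℝ} (ha : 0 ≤ a) : Few 1 a b typeR := by
  by_cases h : 2 / 3 * a + b * (√2 * Real.pi / 8) - 8 / 15 = 0
  · refine (fewR_total (n := 0) (m := 1) (fun K hK hKc => (fewR a b hKc hK).2.2 fun r hr =>
      GR_ne_zero (Or.inr ⟨ha, ?_⟩) hr) (nearFewR_one ?_)).mono (by simp) subset_rfl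
    · rw [melnikov_eq, h, mul_zero]
    · rcases eq_or_ne a 0 with rfl | h0
      · right
        have h1 : √2 ≤ 1.41422 := by
          rw [Real.sqrt_le_left (by norm_num)]; norm_num
        have h2 := Real.pi_lt_d4
        have h3 : √2 * Real.pi ≤ 1.41422 * 3.1416 := by
          have := Real.pi_pos
          gcongr
        have h4 : 0 < √2 * Real.pi := by positivity
        by_contra! h5
        nlinarith
      · exact Or.inl h0
  · exact (fewR_total (n := 1) (m := 0) (fun K hK hKc => (fewR a b hKc hK).2.1 ha)
      (nearFewR_loop h)).mono (by simp) subset_rfl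

lemma fewR_three (a b : ℝ) : Few 3 a b typeR := by
  rcases le_or_gt 0 a with h | h
  · exact (fewR_one h).mono (by norm_num) subset_rfl
  · exact (fewR_total (n := 2) (m := 1) (fun K hK hKc => (fewR a b hKc hK).1)
      (nearFewR_one (Or.inl h.ne))).mono (by norm_num) subset_rfl

lemma fewE_zero {a b : ℝ} (ha : a ≤ 0) : Few 0 a b typeE :=
  (fewE_total (n := 0) (m := 0) (fun K hK hKc => (fewE a b hKc hK).2.2 ha)
    (nearFewE_loop (by linarith))).mono (by simp) subset_rfl

lemma fewE_two {a b : ℝ} (ha : a ≤ 4 / 5) : Few 2 a b typeE := by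
  rcases ha.lt_or_eq with h | rfl
  · exact (fewE_total (n := 2) (m := 0) (fun K hK hKc => (fewE a b hKc hK).1)
      (nearFewE_loop h.ne)).mono (by simp) subset_rfl
  · exact (fewE_total (n := 1) (m := 1) (fun K hK hKc => (fewE _ b hKc hK).2.1 le_rfl)
      (nearFewE_one (by norm_num))).mono (by norm_num) subset_rfl

lemma fewE_one {a b : ℝ} (ha : 4 / 5 < a) : Few 1 a b typeE :=
  (fewE_total (n := 1) (m := 0) (fun K hK hKc => (fewE a b hKc hK).2.1 ha.le)
    (nearFewE_loop ha.ne')).mono (by simp) subset_rfl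

lemma Cycle.isPeriodicOrbit {ε a b : ℝ} (C : Cycle ε a b) : IsPeriodicOrbit ε a b C.x C.y := by
  refine ⟨C.loop.sol.hx, C.loop.sol.hy, ⟨C.T, C.loop.τ_pos.trans C.loop.τ_lt, fun t =>
    ⟨C.loop.perX t, C.loop.perY t⟩⟩, 0, C.τ, fun h => ?_⟩
  have h1 := (Prod.ext_iff.1 h).1
  simp only [C.α_eq, C.β_eq] at h1
  exact C.lt.ne h1

/-- The central symmetry exchanges the systems with parameters `b` and `-b`. -/
lemma Cycle.exists_neg {ε a b : ℝ} (C : Cycle ε a b) : ∃ D : Cycle ε a (-b),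
    C.set = (fun p : ℝ × ℝ => -p) '' D.set ∧ D.α = -C.β := by
  have hp := C.isPeriodicOrbit
  obtain ⟨h1, h2, ⟨T, hT, h3⟩, t₁, t₂, h4⟩ := hp
  have hs := C.loop.sol.neg
  have hq : IsPeriodicOrbit ε a (-b) (fun t => -C.x t) (fun t => -C.y t) := by
    refine ⟨hs.hx, hs.hy, ⟨T, hT, fun t => by simp [h3 t]⟩, t₁, t₂, fun h => h4 ?_⟩
    simpa using h
  obtain ⟨D, hD⟩ := exists_cycle hq
  refine ⟨D, ?_, ?_⟩
  · rw [hD, ← range_comp]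
    unfold Cycle.set
    congr 1
    ext t <;> simp
  · refine le_antisymm ?_ ?_
    · obtain ⟨t, h5, -⟩ := C.exY C.β (right_mem_Icc.2 C.lt.le)
      have : (-C.x t, -C.y t) ∈ D.set := hD ▸ ⟨t, rfl⟩
      obtain ⟨u, hu⟩ := this
      have e : D.x u = -C.x t := (Prod.ext_iff.1 hu).1
      rw [← h5, ← e]
      exact (D.memIcc u).1
    · obtain ⟨t, h5, -⟩ := D.exY D.α (left_mem_Icc.2 D.lt.le)
      have : (D.x t, D.y t) ∈ D.set := ⟨t, rfl⟩
      rw [hD] at this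
      obtain ⟨u, hu⟩ := this
      have e : -C.x u = D.x t := (Prod.ext_iff.1 hu).1
      rw [← h5, ← e]
      exact neg_le_neg (C.memIcc u).2

lemma Few.typeL {n : ℕ∞} {a b : ℝ} (h : Few n a (-b) typeR) : Few n a b typeL := by
  obtain ⟨δ, hδ, h⟩ := h
  refine ⟨δ, hδ, fun ε h0 h1 => le_trans ?_ (h ε h0 h1)⟩
  refine le_trans (encard_le_encard ?_)
    (encard_image_le (fun S => (fun p : ℝ × ℝ => -p) '' S) (family ε a (-b) typeR))
  rintro _ ⟨C, hC, rfl⟩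
  obtain ⟨D, h2, h3⟩ := C.exists_neg
  have hC : C.β < 0 := hC
  exact ⟨D.set, ⟨D, show 0 < D.α by linarith, rfl⟩, h2.symm⟩

lemma Cycle.mem_types {ε a b : ℝ} (C : Cycle ε a b) :
    (C.α, C.β) ∈ typeE ∪ (typeR ∪ typeL) := by
  have h1 := C.left
  have h2 := C.right
  rcases lt_trichotomy C.α 0 with h | h | h
  · rcases lt_trichotomy C.β 0 with h3 | h3 | h3
    · exact Or.inr (Or.inr h3)
    · rw [h3] at h2; norm_num at h2
    · exact Or.inl ⟨h, h3⟩
  · rw [h] at h1; norm_num at h1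
  · exact Or.inr (Or.inl h)

lemma few_three_of_few {a b : ℝ} {n m k : ℕ∞} (hE : Few n a b typeE) (hR : Few m a b typeR)
    (hL : Few k a b typeL) (h : n + (m + k) ≤ 3) : Few 3 a b univ :=
  ((hE.union (hR.union hL)).mono h subset_rfl).of_cover
    ⟨1, one_pos, fun _ _ _ C _ => C.mem_types⟩

/-- For the parameters of the double loop all small cycles are close to the loop. -/
lemma exists_near_of_loop {δ : ℝ} (hδ : 0 < δ) : ∃ δ' > 0, ∀ ε, 0 < ε → ε < δ' →
    ∀ C : Cycle ε (4 / 5) 0, (C.α, C.β) ∈ typeR → |pot C.α| < δ := by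
  obtain ⟨K, hK, hKc, δ₁, hδ₁, h⟩ := exists_coverR (4 / 5) 0 hδ
  have hz : Few 0 (4 / 5) 0 {p | p ∈ typeR ∧ pot p.1 ∈ K} := (fewR _ _ hKc hK).2.2 fun r hr =>
    GR_ne_zero (Or.inr ⟨by norm_num, by rw [melnikov_eq]; norm_num⟩) hr
  obtain ⟨δ₂, hδ₂, h2⟩ := hz.empty
  refine ⟨min δ₁ δ₂, lt_min hδ₁ hδ₂, fun ε h0 h1 C hC => ?_⟩
  rw [lt_min_iff] at h1
  rcases h ε h0 h1.1 C hC with h3 | h3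
  · exact absurd h3 (h2 ε h0 h1.2 C)
  · simpa using h3.2

lemma few_three_loop : Few 3 (4 / 5) 0 univ := by
  obtain ⟨δ, hδ, hex⟩ := exists_exclusion (a := 4 / 5) (b := 0) (by norm_num)
  obtain ⟨K, hK, hosc⟩ := exists_oscillation (4 / 5) 0
  obtain ⟨K', hK', hflat⟩ := exists_flat (4 / 5) 0
  obtain ⟨δ₁, hδ₁, hE⟩ := nearFewE_one (a := 4 / 5) (b := 0) (by norm_num)
  obtain ⟨S, hS, hSc, δ₂, hδ₂, hcov⟩ := exists_coverE (4 / 5) 0 (lt_min hδ₁ (half_pos hδ))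
  obtain ⟨δ₃, hδ₃, hES⟩ : Few 1 (4 / 5) 0 {p | p ∈ typeE ∧ pot p.1 ∈ S} :=
    (fewE _ _ hSc hS).2.1 le_rfl
  obtain ⟨δ₄, hδ₄, hnear⟩ := exists_near_of_loop (δ := δ / 4) (by positivity)
  have hR1 : Few 1 (4 / 5) 0 typeR := fewR_one (by norm_num)
  have hL1 : Few 1 (4 / 5) 0 typeL := Few.typeL (fewR_one (by norm_num))
  obtain ⟨δ₅, hδ₅, hE⟩ := hE
  obtain ⟨δ₆, hδ₆, hR1⟩ := hR1
  obtain ⟨δ₇, hδ₇, hL1⟩ := hL1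
  have hev : ∀ᶠ ε in 𝓝[>] (0 : ℝ), ε < δ ∧ ε < δ₂ ∧ ε < δ₃ ∧ ε < δ₄ ∧ ε < δ₅ ∧ ε < δ₆ ∧ ε < δ₇ ∧
      ε < δ / 4 / K ∧ ε < δ / 4 / K' ∧ ε < 1 := by
    have : ∀ {d : ℝ}, 0 < d → ∀ᶠ ε in 𝓝[>] (0 : ℝ), ε < d := fun h =>
      (gt_mem_nhds h).filter_mono nhdsWithin_le_nhds
    refine (this hδ).and ((this hδ₂).and ((this hδ₃).and ((this hδ₄).and ((this hδ₅).and
      ((this hδ₆).and ((this hδ₇).and ((this ?_).and ((this ?_).and (this one_pos)))))))))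
    · positivity
    · positivity
  obtain ⟨δ₀, hδ₀, hev⟩ := mem_nhdsGT_iff_exists_Ioo_subset.1 hev
  refine ⟨δ₀, hδ₀, fun ε h0 h1 => ?_⟩
  obtain ⟨e1, e2, e3, e4, e5, e6, e7, e8, e9, e10⟩ := hev (show ε ∈ Ioo 0 δ₀ from ⟨h0, h1⟩)
  rw [lt_div_iff₀ hK] at e8
  rw [lt_div_iff₀ hK'] at e9
  have f1 := hES ε h0 e3
  have f2 := hE ε h0 e5
  have f3 := hR1 ε h0 e6
  have f4 := hL1 ε h0 e7
  have hsub : family ε (4 / 5) 0 univ ⊆ (family ε (4 / 5) 0 {p | p ∈ typeE ∧ pot p.1 ∈ S} ∪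
      family ε (4 / 5) 0 (near typeE 0 (min δ₁ (δ / 2)))) ∪
      (family ε (4 / 5) 0 typeR ∪ family ε (4 / 5) 0 typeL) := by
    rintro _ ⟨C, -, rfl⟩
    rcases C.mem_types with h | h | h
    · rcases hcov ε h0 e2 C h with h | h
      · exact Or.inl (Or.inl ⟨C, h, rfl⟩)
      · exact Or.inl (Or.inr ⟨C, h, rfl⟩)
    · exact Or.inr (Or.inl ⟨C, h, rfl⟩)
    · exact Or.inr (Or.inr ⟨C, h, rfl⟩)
  have f2' : (family ε (4 / 5) 0 (near typeE 0 (min δ₁ (δ / 2)))).encard ≤ 1 :=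
    (encard_le_encard (family_mono (near_mono _ _ (min_le_left _ _)))).trans f2
  have hone : (family ε (4 / 5) 0 (near typeE 0 (min δ₁ (δ / 2)))).encard +
      ((family ε (4 / 5) 0 typeR).encard + (family ε (4 / 5) 0 typeL).encard) ≤ 2 := by
    rcases eq_empty_or_nonempty (family ε (4 / 5) 0 typeR) with h | ⟨_, R, hR, -⟩
    · rw [h, encard_empty, zero_add]
      exact (add_le_add f2' f4).trans (by norm_num)
    rcases eq_empty_or_nonempty (family ε (4 / 5) 0 typeL) with h | ⟨_, L, hL, -⟩
    · rw [h, encard_empty, add_zero]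
      exact (add_le_add f2' f3).trans (by norm_num)
    rcases eq_empty_or_nonempty (family ε (4 / 5) 0 (near typeE 0 (min δ₁ (δ / 2)))) with
      h | ⟨_, C, hC, -⟩
    · rw [h, encard_empty, zero_add]
      exact (add_le_add f3 f4).trans (by norm_num)
    exfalso
    have mono : ∀ {D : Cycle ε (4 / 5) 0} {c : ℝ}, c ≤ δ → D.Flat c → D.Flat δ :=
      fun hc h ξ hξ => ⟨(h ξ hξ).1.trans_le hc, (h ξ hξ).2.trans_le hc⟩
    refine hex ε h0 e1 C R L hC.1 hR hL ?_ ?_ ?_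
    · have : |pot C.α| < δ / 2 := by
        have := hC.2.trans_le (min_le_right _ _)
        simpa using this
      exact mono (by linarith) (hflat ε h0 e10.le C _ this)
    · exact mono (by linarith) (hflat ε h0 e10.le R _ (hnear ε h0 e4 R hR))
    · have hL : L.β < 0 := hL
      have : |pot L.β| < δ / 4 := by
        obtain ⟨D, -, hD⟩ := L.exists_neg
        have h5 : ∀ b' : ℝ, b' = 0 → ∀ D : Cycle ε (4 / 5) b', 0 < D.α → |pot D.α| < δ / 4 := by
          rintro _ rfl D hD
          exact hnear ε h0 e4 D hD
        have := h5 _ neg_zero D (by linarith)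
        rwa [hD, pot_neg] at this
      have h6 := (hosc ε h0 e10.le L L.β (right_mem_Icc.2 L.lt.le)).1
      rw [L.up.zero_right _ le_rfl] at h6
      have h7 : |pot L.α| < δ / 2 := by
        rw [abs_lt] at this ⊢
        rw [abs_le] at h6
        constructor <;> linarith
      exact mono (by linarith) (hflat ε h0 e10.le L _ h7)
  calc (family ε (4 / 5) 0 univ).encard
      ≤ ((family ε (4 / 5) 0 {p | p ∈ typeE ∧ pot p.1 ∈ S}).encard +
        (family ε (4 / 5) 0 (near typeE 0 (min δ₁ (δ / 2)))).encard) +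
        ((family ε (4 / 5) 0 typeR).encard + (family ε (4 / 5) 0 typeL).encard) :=
        (encard_le_encard hsub).trans ((encard_union_le _ _).trans
          (add_le_add (encard_union_le _ _) (encard_union_le _ _)))
    _ ≤ 1 + 2 := by rw [add_assoc]; exact add_le_add f1 hone
    _ = 3 := by norm_num

theorem few_three (a b : ℝ) : Few 3 a b univ := by
  rcases le_or_gt a 0 with h0 | h0
  · rcases le_total b 0 with hb | hb
    · exact few_three_of_few (fewE_zero h0) (fewR_zero hb (Or.inl (by linarith)))
        (fewR_three a (-b)).typeL (by simp)
    · exact few_three_of_few (fewE_zero h0) (fewR_three a b)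
        (fewR_zero (neg_nonpos.2 hb) (Or.inl (by linarith))).typeL (by simp)
  rcases lt_trichotomy a (4 / 5) with h1 | rfl | h1
  · rcases le_total b 0 with hb | hb
    · exact few_three_of_few (fewE_two h1.le) (fewR_zero hb (Or.inl h1)) (fewR_one h0.le).typeL
        (by norm_num)
    · exact few_three_of_few (fewE_two h1.le) (fewR_one h0.le)
        (fewR_zero (neg_nonpos.2 hb) (Or.inl h1)).typeL (by norm_num)
  · rcases lt_trichotomy b 0 with hb | rfl | hb
    · exact few_three_of_few (fewE_two le_rfl) (fewR_zero hb.le (Or.inr ⟨rfl, hb⟩))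
        (fewR_one h0.le).typeL (by norm_num)
    · exact few_three_loop
    · have hb' := neg_lt_zero.2 hb
      exact few_three_of_few (fewE_two le_rfl) (fewR_one h0.le)
        (fewR_zero hb'.le (Or.inr ⟨rfl, hb'⟩)).typeL (by norm_num)
  · exact few_three_of_few (fewE_one h1) (fewR_one h0.le) (fewR_one h0.le).typeL (by norm_num)

end DuffingVanDerPol

/-- Theorem 2: for sufficiently small ε > 0, the total number of limit cycles of the
perturbed system in the plane does not exceed three. -/
theorem at_most_three_limit_cycles (p₁ p₂ : ℝ) :
    ∃ ε₀ > (0:ℝ), ∀ ε : ℝ, 0 < ε → ε < ε₀ →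
      {Γ : Set (ℝ × ℝ) | IsLimitCycle ε p₁ p₂ Γ}.encard ≤ 3 := by
  obtain ⟨δ, hδ, h⟩ := DuffingVanDerPol.few_three p₁ p₂
  refine ⟨δ, hδ, fun ε h0 h1 => (Set.encard_le_encard ?_).trans (h ε h0 h1)⟩
  rintro Γ ⟨⟨x, y, hp, rfl⟩, -⟩
  obtain ⟨C, hC⟩ := DuffingVanDerPol.exists_cycle hp
  exact ⟨C, trivial, hC⟩
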